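/- Let l ≥ 3 be an odd integer, q ∈ ℂ a primitive l-th root of unity, m an integer with m ≢ 0, 1, −1 (mod l), k an integer with 2k ≡ m (mod l), and n ≥ 2. Then the blob algebra b_n(m) is isomorphic as a ℂ-algebra to the quotient of the level-two cyclotomic Khovanov–Lauda–Rouquier algebra R_n by the two-sided ideal generated by all idempotents e(i) with i ∈ (ℤ/lℤ)^n such that (i_1, i_2) ≡ (k, k−1) (mod l) or (i_1, i_2) ≡ (−k, −k−1) (mod l). In particular, since these generators are homogeneous of degree 0, the quotient carries an induced ℤ-grading and hence b_n(m) becomes a ℤ-graded algebra. -/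

import Mathlib

noncomputable section

namespace Statement0

/-- The Gaussian integer `[j] = (q^j - q^{-j})/(q - q⁻¹)`. -/
def gauss (q : ℂ) (j : ℤ) : ℂ := (q ^ j - q ^ (-j)) / (q - q⁻¹)

/-- Generators of the blob algebra: `e` and `U_1, …, U_{n-1}` (0-indexed). -/
inductive BlobGen (n : ℕ) : Type
  | e : BlobGen n
  | U : Fin (n - 1) → BlobGen n

/-- The generator `e` in the free algebra. -/
def eF (n : ℕ) : FreeAlgebra ℂ (BlobGen n) := FreeAlgebra.ι ℂ BlobGen.e

/-- The generator `U_i` in the free algebra. -/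
def UF (n : ℕ) (i : Fin (n - 1)) : FreeAlgebra ℂ (BlobGen n) :=
  FreeAlgebra.ι ℂ (BlobGen.U i)

/-- The defining relations of the blob algebra `b_n(m)`; here `y_e = -[m-1]/[m]`. -/
inductive BlobRel (q : ℂ) (m : ℤ) (n : ℕ) :
    FreeAlgebra ℂ (BlobGen n) → FreeAlgebra ℂ (BlobGen n) → Prop
  | Usq (i : Fin (n - 1)) : BlobRel q m n (UF n i * UF n i) ((-(q + q⁻¹)) • UF n i)
  | UUU (i j : Fin (n - 1)) (h : i.val + 1 = j.val ∨ j.val + 1 = i.val) :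
      BlobRel q m n (UF n i * UF n j * UF n i) (UF n i)
  | Ucomm (i j : Fin (n - 1)) (h : i.val + 1 < j.val ∨ j.val + 1 < i.val) :
      BlobRel q m n (UF n i * UF n j) (UF n j * UF n i)
  | UeU (i : Fin (n - 1)) (h : i.val = 0) :
      BlobRel q m n (UF n i * eF n * UF n i) ((-(gauss q (m - 1) / gauss q m)) • UF n i)
  | ee : BlobRel q m n (eF n * eF n) (eF n)
  | Ue (i : Fin (n - 1)) (h : 1 ≤ i.val) : BlobRel q m n (UF n i * eF n) (eF n * UF n i)

/-- The blob algebra `b_n(m)`. -/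
abbrev Blob (q : ℂ) (m : ℤ) (n : ℕ) := RingQuot (BlobRel q m n)

/-- The image of `e` in the blob algebra. -/
def emk (q : ℂ) (m : ℤ) (n : ℕ) : Blob q m n :=
  RingQuot.mkAlgHom ℂ (BlobRel q m n) (eF n)

/-- The image of `U_i` in the blob algebra. -/
def Umk (q : ℂ) (m : ℤ) (n : ℕ) (i : Fin (n - 1)) : Blob q m n :=
  RingQuot.mkAlgHom ℂ (BlobRel q m n) (UF n i)

/-- The rescaled generator `U_0 = -[m]·e`. -/
def U0el (q : ℂ) (m : ℤ) (n : ℕ) : Blob q m n := (-(gauss q m)) • emk q m n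

/-- Residue sequences of length `n` with values in `ℤ/lℤ`. -/
abbrev Res (l n : ℕ) := Fin n → ZMod l

/-- Generators of the Khovanov–Lauda–Rouquier algebra. -/
inductive KLRGen (l n : ℕ) : Type
  | e : Res l n → KLRGen l n
  | y : Fin n → KLRGen l n
  | psi : Fin (n - 1) → KLRGen l n

/-- The generator `e(i)` in the free algebra. -/
def eG (l n : ℕ) (i : Res l n) : FreeAlgebra ℂ (KLRGen l n) :=
  FreeAlgebra.ι ℂ (KLRGen.e i)

/-- The generator `y_r` in the free algebra. -/
def yG (l n : ℕ) (r : Fin n) : FreeAlgebra ℂ (KLRGen l n) :=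
  FreeAlgebra.ι ℂ (KLRGen.y r)

/-- The generator `ψ_r` in the free algebra. -/
def pG (l n : ℕ) (r : Fin (n - 1)) : FreeAlgebra ℂ (KLRGen l n) :=
  FreeAlgebra.ι ℂ (KLRGen.psi r)

/-- The position `r` as an element of `Fin n`. -/
def lo {n : ℕ} (r : Fin (n - 1)) : Fin n := ⟨r.val, by have := r.2; omega⟩

/-- The position `r + 1` as an element of `Fin n`. -/
def hi {n : ℕ} (r : Fin (n - 1)) : Fin n := ⟨r.val + 1, by have := r.2; omega⟩

/-- The defining relations of the cyclotomic KLR algebra, where `Lam ⊆ ℤ/lℤ` is the set of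
residues allowed at the first position (the multiset of cyclotomic parameters). -/
inductive KLRRel (l n : ℕ) [NeZero l] (Lam : Set (ZMod l)) :
    FreeAlgebra ℂ (KLRGen l n) → FreeAlgebra ℂ (KLRGen l n) → Prop
  | cyc1 (i : Res l n) (r : Fin n) (hr : r.val = 0) (h : i r ∉ Lam) :
      KLRRel l n Lam (eG l n i) 0
  | cyc2 (i : Res l n) (r : Fin n) (hr : r.val = 0) (h : i r ∈ Lam) :
      KLRRel l n Lam (yG l n r * eG l n i) 0
  | orth (i j : Res l n) (h : i ≠ j) : KLRRel l n Lam (eG l n i * eG l n j) 0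
  | idem (i : Res l n) : KLRRel l n Lam (eG l n i * eG l n i) (eG l n i)
  | sum1 : KLRRel l n Lam (∑ i : Res l n, eG l n i) 1
  | ye (r : Fin n) (i : Res l n) :
      KLRRel l n Lam (yG l n r * eG l n i) (eG l n i * yG l n r)
  | psie (r : Fin (n - 1)) (i : Res l n) :
      KLRRel l n Lam (pG l n r * eG l n i) (eG l n (i ∘ Equiv.swap (lo r) (hi r)) * pG l n r)
  | yy (r s : Fin n) : KLRRel l n Lam (yG l n r * yG l n s) (yG l n s * yG l n r)
  | psiy (r : Fin (n - 1)) (s : Fin n) (h1 : s.val ≠ r.val) (h2 : s.val ≠ r.val + 1) :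
      KLRRel l n Lam (pG l n r * yG l n s) (yG l n s * pG l n r)
  | pp (r s : Fin (n - 1)) (h : r.val + 1 < s.val ∨ s.val + 1 < r.val) :
      KLRRel l n Lam (pG l n r * pG l n s) (pG l n s * pG l n r)
  | py (r : Fin (n - 1)) (i : Res l n) :
      KLRRel l n Lam (pG l n r * (yG l n (hi r) * eG l n i))
        ((yG l n (lo r) * pG l n r + if i (lo r) = i (hi r) then 1 else 0) * eG l n i)
  | yp (r : Fin (n - 1)) (i : Res l n) :
      KLRRel l n Lam (yG l n (hi r) * (pG l n r * eG l n i))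
        ((pG l n r * yG l n (lo r) + if i (lo r) = i (hi r) then 1 else 0) * eG l n i)
  | psisq (r : Fin (n - 1)) (i : Res l n) :
      KLRRel l n Lam (pG l n r * pG l n r * eG l n i)
        ((if i (hi r) = i (lo r) then 0
          else if i (hi r) = i (lo r) + 1 then yG l n (hi r) - yG l n (lo r)
          else if i (hi r) = i (lo r) - 1 then yG l n (lo r) - yG l n (hi r)
          else 1) * eG l n i)
  | braid (r s : Fin (n - 1)) (h : s.val = r.val + 1) (i : Res l n) :
      KLRRel l n Lam (pG l n r * pG l n s * pG l n r * eG l n i)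
        ((pG l n s * pG l n r * pG l n s +
          (if i (hi s) = i (lo r) ∧ i (lo s) = i (lo r) + 1 then 1
           else if i (hi s) = i (lo r) ∧ i (lo s) = i (lo r) - 1 then -1
           else 0)) * eG l n i)

/-- The cyclotomic KLR algebra with cyclotomic residue set `Lam`. -/
abbrev KLR (l n : ℕ) [NeZero l] (Lam : Set (ZMod l)) := RingQuot (KLRRel l n Lam)

/-- The relation identifying the chosen KLR idempotents `e(i)`, `i ∈ bad`, with `0`;
quotienting by it is the same as quotienting by the two-sided ideal they generate. -/
def quotRel (l n : ℕ) [NeZero l] (Lam : Set (ZMod l)) (bad : Set (Res l n)) :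
    KLR l n Lam → KLR l n Lam → Prop := fun a b =>
  b = 0 ∧ ∃ i ∈ bad, a = RingQuot.mkAlgHom ℂ (KLRRel l n Lam) (eG l n i)

/-- The quotient of the cyclotomic KLR algebra by the two-sided ideal generated by the
idempotents `e(i)`, `i ∈ bad`. -/
abbrev BQuot (l n : ℕ) [NeZero l] (Lam : Set (ZMod l)) (bad : Set (Res l n)) :=
  RingQuot (quotRel l n Lam bad)

/-- The canonical map from the free algebra onto the quotient. -/
def bmk (l n : ℕ) [NeZero l] (Lam : Set (ZMod l)) (bad : Set (Res l n)) :
    FreeAlgebra ℂ (KLRGen l n) →ₐ[ℂ] BQuot l n Lam bad :=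
  (RingQuot.mkAlgHom ℂ (quotRel l n Lam bad)).comp (RingQuot.mkAlgHom ℂ (KLRRel l n Lam))

/-- The entries of the Cartan matrix of type `A_{l-1}^{(1)}`. -/
def cartan (l : ℕ) (i j : ZMod l) : ℤ :=
  if i = j then 2 else if j = i + 1 ∨ j = i - 1 then -1 else 0

/-- The level-two cyclotomic set `{k, -k} ⊆ ℤ/lℤ`. -/
def Lam2 (l : ℕ) (k : ℤ) : Set (ZMod l) := {x | x = (k : ZMod l) ∨ x = -(k : ZMod l)}

/-- The residue sequences `i` with `(i₁, i₂) ≡ (k, k-1)` or `(i₁, i₂) ≡ (-k, -k-1) (mod l)`. -/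
def badSet2 (l n : ℕ) (k : ℤ) (hn : 2 ≤ n) : Set (Res l n) :=
  {i | (i ⟨0, by omega⟩ = (k : ZMod l) ∧ i ⟨1, by omega⟩ = (k : ZMod l) - 1) ∨
    (i ⟨0, by omega⟩ = -(k : ZMod l) ∧ i ⟨1, by omega⟩ = -(k : ZMod l) - 1)}

section

/-- The transposition of the entries `r` and `r + 1` of a residue sequence. -/
def sw {l n : ℕ} (r : Fin (n - 1)) (i : Res l n) : Res l n := i ∘ Equiv.swap (lo r) (hi r)

section Swap

variable {l n : ℕ}

@[simp] lemma sw_lo (r : Fin (n - 1)) (i : Res l n) : sw r i (lo r) = i (hi r) := by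
  simp [sw]

@[simp] lemma sw_hi (r : Fin (n - 1)) (i : Res l n) : sw r i (hi r) = i (lo r) := by
  simp [sw]

lemma sw_of_ne {r : Fin (n - 1)} (i : Res l n) {t : Fin n} (h1 : t ≠ lo r) (h2 : t ≠ hi r) :
    sw r i t = i t := by
  simp [sw, Equiv.swap_apply_of_ne_of_ne h1 h2]

@[simp] lemma sw_sw (r : Fin (n - 1)) (i : Res l n) : sw r (sw r i) = i := by
  funext t; simp [sw]

lemma sw_eq_self {r : Fin (n - 1)} {i : Res l n} (h : i (hi r) = i (lo r)) : sw r i = i := by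
  funext t
  by_cases h1 : t = lo r
  · subst h1; simp [h]
  by_cases h2 : t = hi r
  · subst h2; simp [h]
  exact sw_of_ne i h1 h2

lemma sw_ne_self {r : Fin (n - 1)} {i : Res l n} (h : i (hi r) ≠ i (lo r)) : sw r i ≠ i := by
  intro h'
  apply h
  rw [← congrFun h' (lo r), sw_lo]

lemma sw_lo_of_far {r t : Fin (n - 1)} (h : r.val + 1 < t.val ∨ t.val + 1 < r.val)
    (i : Res l n) : sw t i (lo r) = i (lo r) :=
  sw_of_ne i (by simp [lo, Fin.ext_iff]; omega) (by simp [lo, hi, Fin.ext_iff]; omega)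

lemma sw_hi_of_far {r t : Fin (n - 1)} (h : r.val + 1 < t.val ∨ t.val + 1 < r.val)
    (i : Res l n) : sw t i (hi r) = i (hi r) :=
  sw_of_ne i (by simp [lo, hi, Fin.ext_iff]; omega) (by simp [hi, Fin.ext_iff]; omega)

lemma sw_comm {r t : Fin (n - 1)} (h : r.val + 1 < t.val ∨ t.val + 1 < r.val)
    (i : Res l n) : sw r (sw t i) = sw t (sw r i) := by
  funext x
  by_cases h1 : x = lo r
  · subst h1; rw [sw_lo, sw_hi_of_far h, sw_lo_of_far h, sw_lo]
  by_cases h2 : x = hi r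
  · subst h2; rw [sw_hi, sw_hi_of_far h, sw_lo_of_far h, sw_hi]
  rw [sw_of_ne _ h1 h2]
  by_cases h3 : x = lo t
  · subst h3; rw [sw_lo, sw_lo, sw_hi_of_far h.symm]
  by_cases h4 : x = hi t
  · subst h4; rw [sw_hi, sw_hi, sw_lo_of_far h.symm]
  rw [sw_of_ne _ h3 h4, sw_of_ne _ h3 h4, sw_of_ne _ h1 h2]

variable {r s : Fin (n - 1)}

lemma lo_eq_hi (h : s.val = r.val + 1) : lo s = hi r := by
  simp [lo, hi, h]

lemma sw_hi_next (h : s.val = r.val + 1) (i : Res l n) : sw r i (hi s) = i (hi s) :=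
  sw_of_ne i (by simp [lo, hi, Fin.ext_iff]; omega) (by simp [hi, Fin.ext_iff]; omega)

lemma sw_lo_prev (h : s.val = r.val + 1) (i : Res l n) : sw s i (lo r) = i (lo r) :=
  sw_of_ne i (by simp [lo, Fin.ext_iff]; omega) (by simp [lo, hi, Fin.ext_iff]; omega)

lemma sw_hi_prev (h : s.val = r.val + 1) (i : Res l n) : sw s i (hi r) = i (hi s) := by
  rw [← lo_eq_hi h, sw_lo]

end Swap

variable {A : Type*} [Ring A] [Algebra ℂ A]

/-- The defining relations of the quotient of the cyclotomic KLR algebra, for elements `E i`,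
`y r`, `p r` of an arbitrary algebra. -/
structure IsKLR {l n : ℕ} [NeZero l] (κ : ZMod l) (E : Res l n → A) (y : Fin n → A)
    (p : Fin (n - 1) → A) : Prop where
  cyc1 : ∀ (i : Res l n) (r : Fin n), r.val = 0 → i r ≠ κ → i r ≠ -κ → E i = 0
  cyc2 : ∀ (i : Res l n) (r : Fin n), r.val = 0 → y r * E i = 0
  orth : ∀ i j : Res l n, i ≠ j → E i * E j = 0
  idem : ∀ i : Res l n, E i * E i = E i
  sum1 : ∑ i : Res l n, E i = 1
  ye : ∀ (r : Fin n) (i : Res l n), y r * E i = E i * y r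
  psie : ∀ (r : Fin (n - 1)) (i : Res l n), p r * E i = E (sw r i) * p r
  yy : ∀ r s : Fin n, y r * y s = y s * y r
  psiy : ∀ (r : Fin (n - 1)) (s : Fin n), s.val ≠ r.val → s.val ≠ r.val + 1 →
    p r * y s = y s * p r
  pp : ∀ r s : Fin (n - 1), (r.val + 1 < s.val ∨ s.val + 1 < r.val) → p r * p s = p s * p r
  py : ∀ (r : Fin (n - 1)) (i : Res l n), p r * (y (hi r) * E i) =
    (y (lo r) * p r + if i (lo r) = i (hi r) then 1 else 0) * E i
  yp : ∀ (r : Fin (n - 1)) (i : Res l n), y (hi r) * (p r * E i) =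
    (p r * y (lo r) + if i (lo r) = i (hi r) then 1 else 0) * E i
  psisq : ∀ (r : Fin (n - 1)) (i : Res l n), p r * p r * E i =
    (if i (hi r) = i (lo r) then 0
      else if i (hi r) = i (lo r) + 1 then y (hi r) - y (lo r)
      else if i (hi r) = i (lo r) - 1 then y (lo r) - y (hi r)
      else 1) * E i
  braid : ∀ (r s : Fin (n - 1)), s.val = r.val + 1 → ∀ i : Res l n,
    p r * p s * p r * E i = (p s * p r * p s +
      (if i (hi s) = i (lo r) ∧ i (lo s) = i (lo r) + 1 then 1
        else if i (hi s) = i (lo r) ∧ i (lo s) = i (lo r) - 1 then -1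
        else 0)) * E i
  bad : ∀ (i : Res l n) (r : Fin (n - 1)), r.val = 0 → (i (lo r) = κ ∨ i (lo r) = -κ) →
    i (hi r) = i (lo r) - 1 → E i = 0

/-- The defining relations of the blob algebra, for elements of an arbitrary algebra. -/
structure IsBlob (q : ℂ) (m : ℤ) {n : ℕ} (e : A) (U : Fin (n - 1) → A) : Prop where
  Usq : ∀ i : Fin (n - 1), U i * U i = (-(q + q⁻¹)) • U i
  UUU : ∀ i j : Fin (n - 1), (i.val + 1 = j.val ∨ j.val + 1 = i.val) → U i * U j * U i = U i
  Ucomm : ∀ i j : Fin (n - 1), (i.val + 1 < j.val ∨ j.val + 1 < i.val) → U i * U j = U j * U i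
  UeU : ∀ i : Fin (n - 1), i.val = 0 → U i * e * U i = (-(gauss q (m - 1) / gauss q m)) • U i
  ee : e * e = e
  Ue : ∀ i : Fin (n - 1), 1 ≤ i.val → U i * e = e * U i

section Lift

lemma isBlob_mk (q : ℂ) (m : ℤ) (n : ℕ) : IsBlob q m (emk q m n) (Umk q m n) where
  Usq i := by
    simpa [Umk] using RingQuot.mkAlgHom_rel ℂ (BlobRel.Usq (q := q) (m := m) (n := n) i)
  UUU i j h := by
    simpa [Umk] using RingQuot.mkAlgHom_rel ℂ (BlobRel.UUU (q := q) (m := m) (n := n) i j h)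
  Ucomm i j h := by
    simpa [Umk] using RingQuot.mkAlgHom_rel ℂ (BlobRel.Ucomm (q := q) (m := m) (n := n) i j h)
  UeU i h := by
    have := RingQuot.mkAlgHom_rel ℂ (BlobRel.UeU (q := q) (m := m) (n := n) i h)
    rwa [map_smul, map_mul, map_mul] at this
  ee := by
    simpa [emk] using RingQuot.mkAlgHom_rel ℂ (BlobRel.ee (q := q) (m := m) (n := n))
  Ue i h := by
    simpa [Umk, emk] using RingQuot.mkAlgHom_rel ℂ (BlobRel.Ue (q := q) (m := m) (n := n) i h)

lemma IsBlob.exists_lift {q : ℂ} {m : ℤ} {n : ℕ} {e : A} {U : Fin (n - 1) → A}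
    (h : IsBlob q m e U) :
    ∃ f : Blob q m n →ₐ[ℂ] A, f (emk q m n) = e ∧ ∀ r, f (Umk q m n r) = U r := by
  let g : FreeAlgebra ℂ (BlobGen n) →ₐ[ℂ] A :=
    FreeAlgebra.lift ℂ (fun x => match x with | .e => e | .U r => U r)
  have ge : g (eF n) = e := by simp [g, eF]
  have gU : ∀ r, g (UF n r) = U r := by intro r; simp [g, UF]
  refine ⟨RingQuot.liftAlgHom ℂ ⟨g, ?_⟩, ?_, ?_⟩
  · rintro _ _ (i | ⟨i, j, h'⟩ | ⟨i, j, h'⟩ | ⟨i, h'⟩ | _ | ⟨i, h'⟩)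
    · simpa [gU] using h.Usq i
    · simpa [gU] using h.UUU i j h'
    · simpa [gU] using h.Ucomm i j h'
    · simpa [gU, ge] using h.UeU i h'
    · simpa [ge] using h.ee
    · simpa [gU, ge] using h.Ue i h'
  · simp [emk, ge]
  · intro r; simp [Umk, gU]

lemma blob_hom_ext {q : ℂ} {m : ℤ} {n : ℕ} {f g : Blob q m n →ₐ[ℂ] A}
    (he : f (emk q m n) = g (emk q m n)) (hU : ∀ r, f (Umk q m n r) = g (Umk q m n r)) :
    f = g := by
  refine RingQuot.ringQuot_ext' ℂ _ _ (FreeAlgebra.hom_ext (funext fun x => ?_))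
  cases x with
  | e => exact he
  | U r => exact hU r

variable {l n : ℕ} [NeZero l] {k : ℤ} {hn : 2 ≤ n}

variable (l n k hn) in
/-- The generator `e(i)` of the quotient. -/
def Eq' (i : Res l n) : BQuot l n (Lam2 l k) (badSet2 l n k hn) :=
  bmk l n (Lam2 l k) (badSet2 l n k hn) (eG l n i)

variable (l n k hn) in
/-- The generator `y_r` of the quotient. -/
def yq (r : Fin n) : BQuot l n (Lam2 l k) (badSet2 l n k hn) :=
  bmk l n (Lam2 l k) (badSet2 l n k hn) (yG l n r)

variable (l n k hn) in
/-- The generator `ψ_r` of the quotient. -/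
def pq (r : Fin (n - 1)) : BQuot l n (Lam2 l k) (badSet2 l n k hn) :=
  bmk l n (Lam2 l k) (badSet2 l n k hn) (pG l n r)

lemma bmk_rel {a b : FreeAlgebra ℂ (KLRGen l n)} (h : KLRRel l n (Lam2 l k) a b) :
    bmk l n (Lam2 l k) (badSet2 l n k hn) a = bmk l n (Lam2 l k) (badSet2 l n k hn) b := by
  simp only [bmk, AlgHom.comp_apply]
  rw [RingQuot.mkAlgHom_rel ℂ h]

omit [NeZero l] in
lemma mem_badSet2 {i : Res l n} {r : Fin (n - 1)} (hr : r.val = 0) :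
    i ∈ badSet2 l n k hn ↔ (i (lo r) = k ∧ i (hi r) = k - 1) ∨
      (i (lo r) = -k ∧ i (hi r) = -k - 1) := by
  have h0 : lo r = ⟨0, by omega⟩ := by simp [lo, hr]
  have h1 : hi r = ⟨1, by omega⟩ := by simp [hi, hr]
  rw [h0, h1]; rfl

lemma isKLR_mk : IsKLR (k : ZMod l) (Eq' l n k hn) (yq l n k hn) (pq l n k hn) where
  cyc1 i r hr h1 h2 := by
    simpa [Eq'] using bmk_rel (hn := hn) (KLRRel.cyc1 (Lam := Lam2 l k) i r hr (by
      simp [Lam2, h1, h2]))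
  cyc2 i r hr := by
    by_cases h : i r ∈ Lam2 l k
    · simpa [Eq', yq] using bmk_rel (hn := hn) (KLRRel.cyc2 (Lam := Lam2 l k) i r hr h)
    · have := bmk_rel (hn := hn) (KLRRel.cyc1 (Lam := Lam2 l k) i r hr h)
      simp [Eq', this]
  orth i j h := by
    simpa [Eq'] using bmk_rel (hn := hn) (KLRRel.orth (Lam := Lam2 l k) i j h)
  idem i := by
    simpa [Eq'] using bmk_rel (hn := hn) (KLRRel.idem (Lam := Lam2 l k) i)
  sum1 := by
    simpa [Eq'] using bmk_rel (hn := hn) (KLRRel.sum1 (n := n) (Lam := Lam2 l k))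
  ye r i := by
    simpa [Eq', yq] using bmk_rel (hn := hn) (KLRRel.ye (Lam := Lam2 l k) r i)
  psie r i := by
    simpa [Eq', pq, sw] using bmk_rel (hn := hn) (KLRRel.psie (Lam := Lam2 l k) r i)
  yy r s := by
    simpa [yq] using bmk_rel (hn := hn) (KLRRel.yy (Lam := Lam2 l k) r s)
  psiy r s h1 h2 := by
    simpa [yq, pq] using bmk_rel (hn := hn) (KLRRel.psiy (Lam := Lam2 l k) r s h1 h2)
  pp r s h := by
    simpa [pq] using bmk_rel (hn := hn) (KLRRel.pp (Lam := Lam2 l k) r s h)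
  py r i := by
    have := bmk_rel (hn := hn) (KLRRel.py (Lam := Lam2 l k) r i)
    simpa [Eq', yq, pq, apply_ite (bmk l n (Lam2 l k) (badSet2 l n k hn)), add_mul] using this
  yp r i := by
    have := bmk_rel (hn := hn) (KLRRel.yp (Lam := Lam2 l k) r i)
    simpa [Eq', yq, pq, apply_ite (bmk l n (Lam2 l k) (badSet2 l n k hn)), add_mul] using this
  psisq r i := by
    have := bmk_rel (hn := hn) (KLRRel.psisq (Lam := Lam2 l k) r i)
    simpa [Eq', yq, pq, apply_ite (bmk l n (Lam2 l k) (badSet2 l n k hn))] using this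
  braid r s h i := by
    have := bmk_rel (hn := hn) (KLRRel.braid (Lam := Lam2 l k) r s h i)
    simpa only [Eq', yq, pq, apply_ite (bmk l n (Lam2 l k) (badSet2 l n k hn)), map_add, map_mul,
      map_one, map_zero, map_neg] using this
  bad i r hr h1 h2 := by
    have : i ∈ badSet2 l n k hn := by
      rw [mem_badSet2 hr, h2]
      rcases h1 with h1 | h1 <;> simp [h1]
    have h3 : quotRel l n (Lam2 l k) (badSet2 l n k hn)
      (RingQuot.mkAlgHom ℂ (KLRRel l n (Lam2 l k)) (eG l n i)) 0 := ⟨rfl, i, this, rfl⟩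
    simpa [Eq', bmk] using RingQuot.mkAlgHom_rel ℂ h3

lemma IsKLR.exists_lift {E : Res l n → A} {y : Fin n → A} {p : Fin (n - 1) → A}
    (h : IsKLR (k : ZMod l) E y p) :
    ∃ f : BQuot l n (Lam2 l k) (badSet2 l n k hn) →ₐ[ℂ] A,
      (∀ i, f (Eq' l n k hn i) = E i) ∧ (∀ r, f (yq l n k hn r) = y r) ∧
      ∀ r, f (pq l n k hn r) = p r := by
  let g : FreeAlgebra ℂ (KLRGen l n) →ₐ[ℂ] A :=
    FreeAlgebra.lift ℂ (fun x => match x with | .e i => E i | .y r => y r | .psi r => p r)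
  have ge : ∀ i, g (eG l n i) = E i := by intro i; simp [g, eG]
  have gy : ∀ i, g (yG l n i) = y i := by intro i; simp [g, yG]
  have gp : ∀ i, g (pG l n i) = p i := by intro i; simp [g, pG]
  have hg : ∀ ⦃a b⦄, KLRRel l n (Lam2 l k) a b → g a = g b := by
    rintro _ _ (⟨i, r, hr, h'⟩ | ⟨i, r, hr, h'⟩ | ⟨i, j, h'⟩ | i | _ | ⟨r, i⟩ | ⟨r, i⟩ | ⟨r, s⟩ |
      ⟨r, s, h1, h2⟩ | ⟨r, s, h'⟩ | ⟨r, i⟩ | ⟨r, i⟩ | ⟨r, i⟩ | ⟨r, s, h', i⟩)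
    · simp only [Lam2, Set.mem_ofPred_eq, not_or] at h'
      simpa [ge] using h.cyc1 i r hr h'.1 h'.2
    · simpa [ge, gy] using h.cyc2 i r hr
    · simpa [ge] using h.orth i j h'
    · simpa [ge] using h.idem i
    · simpa [ge] using h.sum1
    · simpa [ge, gy] using h.ye r i
    · simpa [ge, gp, sw] using h.psie r i
    · simpa [gy] using h.yy r s
    · simpa [gy, gp] using h.psiy r s h1 h2
    · simpa [gp] using h.pp r s h'
    · simpa [ge, gy, gp, apply_ite g, add_mul] using h.py r i
    · simpa [ge, gy, gp, apply_ite g, add_mul] using h.yp r i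
    · simpa [ge, gy, gp, apply_ite g] using h.psisq r i
    · simpa [ge, gy, gp, apply_ite g, add_mul] using h.braid r s h' i
  let g' : KLR l n (Lam2 l k) →ₐ[ℂ] A := RingQuot.liftAlgHom ℂ ⟨g, hg⟩
  have hg' : ∀ a, g' (RingQuot.mkAlgHom ℂ (KLRRel l n (Lam2 l k)) a) = g a := by
    intro a; simp [g']
  refine ⟨RingQuot.liftAlgHom ℂ ⟨g', ?_⟩, ?_, ?_, ?_⟩
  · rintro _ _ ⟨rfl, i, hi, rfl⟩
    rw [hg', ge, map_zero]
    rw [mem_badSet2 (r := ⟨0, by omega⟩) rfl] at hi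
    refine h.bad i ⟨0, by omega⟩ rfl (hi.imp And.left And.left) ?_
    rcases hi with hi | hi <;> rw [hi.1, hi.2]
  · intro i; simp [Eq', bmk, hg', ge]
  · intro i; simp [yq, bmk, hg', gy]
  · intro i; simp [pq, bmk, hg', gp]

lemma bquot_hom_ext {f g : BQuot l n (Lam2 l k) (badSet2 l n k hn) →ₐ[ℂ] A}
    (he : ∀ i, f (Eq' l n k hn i) = g (Eq' l n k hn i))
    (hy : ∀ r, f (yq l n k hn r) = g (yq l n k hn r))
    (hp : ∀ r, f (pq l n k hn r) = g (pq l n k hn r)) : f = g := by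
  refine RingQuot.ringQuot_ext' ℂ _ _ (RingQuot.ringQuot_ext' ℂ _ _
    (FreeAlgebra.hom_ext (funext fun x => ?_)))
  cases x with
  | e i => exact he i
  | y r => exact hy r
  | psi r => exact hp r

end Lift

end

/-- The conditions on the residue `κ` under which the quotient is the blob algebra. -/
structure IsAdm {l : ℕ} (κ : ZMod l) : Prop where
  one : (1 : ZMod l) ≠ 0
  two : (2 : ZMod l) ≠ 0
  three : (3 : ZMod l) ≠ 0
  m0 : 2 * κ ≠ 0
  m1 : 2 * κ ≠ 1
  mm1 : 2 * κ ≠ -1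

lemma IsAdm.consts {l : ℕ} {κ : ZMod l} (h : IsAdm κ) :
    ∃ u v w : ZMod l, u ≠ 0 ∧ v ≠ 0 ∧ w ≠ 0 ∧ u - 1 = 0 ∧ v - 2 = 0 ∧ w - 3 = 0 :=
  ⟨1, 2, 3, h.one, h.two, h.three, sub_self _, sub_self _, sub_self _⟩

namespace IsKLR

variable {A : Type*} [Ring A]
variable {l n : ℕ} [NeZero l] {κ : ZMod l} {E : Res l n → A} {y : Fin n → A}
  {p : Fin (n - 1) → A}

section Basic

variable (h : IsKLR κ E y p) {r s : Fin (n - 1)} {i : Res l n}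
include h

lemma p_zero (H : E (sw r i) = 0) : p r * E i = 0 := by rw [h.psie, H, zero_mul]

lemma pp_far (h0 : i (hi r) ≠ i (lo r)) (h1 : i (hi r) ≠ i (lo r) + 1)
    (h2 : i (hi r) ≠ i (lo r) - 1) : p r * (p r * E i) = E i := by
  rw [← mul_assoc, h.psisq, if_neg h0, if_neg h1, if_neg h2, one_mul]

lemma pp_succ (hA : IsAdm κ) (h1 : i (hi r) = i (lo r) + 1) :
    p r * (p r * E i) = y (hi r) * E i - y (lo r) * E i := by
  obtain ⟨u, v, w, hu, hv, hw, hu', hv', hw'⟩ := hA.consts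
  rw [← mul_assoc, h.psisq, if_neg (by grind), if_pos h1, sub_mul]

lemma pp_pred (hA : IsAdm κ) (h1 : i (hi r) = i (lo r) - 1) :
    p r * (p r * E i) = y (lo r) * E i - y (hi r) * E i := by
  obtain ⟨u, v, w, hu, hv, hw, hu', hv', hw'⟩ := hA.consts
  rw [← mul_assoc, h.psisq, if_neg (by grind), if_neg (by grind), if_pos h1, sub_mul]

lemma pp_eq (h1 : i (hi r) = i (lo r)) : p r * (p r * E i) = 0 := by
  rw [← mul_assoc, h.psisq, if_pos h1, zero_mul]

lemma far_eq (h0 : i (hi r) ≠ i (lo r)) (h1 : i (hi r) ≠ i (lo r) + 1)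
    (h2 : i (hi r) ≠ i (lo r) - 1) : p r * (E (sw r i) * p r) = E i := by
  rw [← h.psie, h.pp_far h0 h1 h2]

lemma far_zero (h0 : i (hi r) ≠ i (lo r)) (h1 : i (hi r) ≠ i (lo r) + 1)
    (h2 : i (hi r) ≠ i (lo r) - 1) (H : E (sw r i) = 0) : E i = 0 := by
  rw [← h.far_eq h0 h1 h2, H, zero_mul, mul_zero]

lemma y_eq (hA : IsAdm κ) (h1 : i (hi r) = i (lo r) + 1 ∨ i (hi r) = i (lo r) - 1)
    (H : p r * E i = 0) : y (hi r) * E i = y (lo r) * E i := by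
  rcases h1 with h1 | h1
  · have := h.pp_succ hA h1
    rw [H, mul_zero] at this
    exact (sub_eq_zero.1 this.symm)
  · have := h.pp_pred hA h1
    rw [H, mul_zero] at this
    exact (sub_eq_zero.1 this.symm).symm

lemma y_hi_p (h0 : i (hi r) ≠ i (lo r)) :
    y (hi r) * (p r * E i) = p r * (y (lo r) * E i) := by
  rw [h.yp, if_neg h0.symm, add_zero, mul_assoc]

lemma y_lo_p (h0 : i (hi r) ≠ i (lo r)) :
    y (lo r) * (p r * E i) = p r * (y (hi r) * E i) := by
  rw [h.py, if_neg h0.symm, add_zero, mul_assoc]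

lemma y_hi_p_eq (h0 : i (hi r) = i (lo r)) :
    y (hi r) * (p r * E i) = p r * (y (lo r) * E i) + E i := by
  rw [h.yp, if_pos h0.symm, add_mul, one_mul, mul_assoc]

lemma y_lo_p_eq (h0 : i (hi r) = i (lo r)) :
    y (lo r) * (p r * E i) = p r * (y (hi r) * E i) - E i := by
  rw [h.py, if_pos h0.symm, add_mul, one_mul, mul_assoc, add_sub_cancel_right]

lemma y_hi_far (h0 : i (hi r) ≠ i (lo r)) (h1 : i (hi r) ≠ i (lo r) + 1)
    (h2 : i (hi r) ≠ i (lo r) - 1) :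
    y (hi r) * E i = p r * (y (lo r) * E (sw r i)) * p r := by
  rw [← h.y_hi_p (by rw [sw_lo, sw_hi]; exact h0.symm), ← h.far_eq h0 h1 h2]
  simp only [mul_assoc]

lemma psie_eq (h0 : i (hi r) = i (lo r)) : p r * E i = E i * p r := by
  rw [h.psie, sw_eq_self h0]

omit [NeZero l] h in
lemma eq_zero_of_nilHecke {P yl yh z W : A} (e1 : yl * (P * W) = P * (yh * W) - W)
    (e2 : P * (P * W) = 0) (e3 : P * W = W * P) (e4 : yh * W = W * yh) (hz : yl * W = z * W)
    (zP : P * z = z * P) : W = 0 := by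
  have e5 : P * W = 0 := by
    linear_combination (norm := noncomm_ring) P * e1 + e2 * yh + P * P * e4 -
      P * yl * e3 - P * hz * P + P * z * e3 - zP * P * W - z * e2
  rw [e5, e4, ← mul_assoc, e5] at e1
  simpa using e1.symm

lemma eq_zero_of_lo (h0 : i (hi r) = i (lo r)) {z : A} (hz : y (lo r) * E i = z * E i)
    (zP : p r * z = z * p r) : E i = 0 :=
  eq_zero_of_nilHecke (h.y_lo_p_eq h0) (h.pp_eq h0) (h.psie_eq h0) (h.ye (hi r) i) hz zP

lemma eq_zero_of_hi (h0 : i (hi r) = i (lo r)) {z : A} (hz : y (hi r) * E i = z * E i)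
    (zP : p r * z = z * p r) : E i = 0 := by
  have e1 := h.y_hi_p_eq h0
  have e2 := h.pp_eq h0
  have e3 := h.psie_eq h0
  have e4 := h.ye (lo r) i
  have e5 : p r * E i = 0 := by
    linear_combination (norm := noncomm_ring) (-p r) * e1 - e2 * y (lo r) - p r * p r * e4 +
      p r * y (hi r) * e3 + p r * hz * p r - p r * z * e3 + zP * p r * E i + z * e2
  rw [e5, e4, ← mul_assoc, e5] at e1
  simpa using e1.symm

lemma psiy_next (hs : s.val = r.val + 1) : p r * y (hi s) = y (hi s) * p r :=
  h.psiy _ _ (by simp [hi]; omega) (by simp [hi]; omega)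

lemma psiy_prev (hs : s.val = r.val + 1) : p s * y (lo r) = y (lo r) * p s :=
  h.psiy _ _ (by simp [lo]; omega) (by simp [lo]; omega)

lemma braid_up (hs : s.val = r.val + 1) (h1 : i (hi s) = i (lo r))
    (h2 : i (hi r) = i (lo r) + 1) :
    p r * (p s * (p r * E i)) = p s * (p r * (p s * E i)) + E i := by
  have := h.braid r s hs i
  rw [if_pos ⟨h1, by rw [lo_eq_hi hs, h2]⟩] at this
  simpa [add_mul, mul_assoc] using this

lemma braid_down (hs : s.val = r.val + 1) (hA : IsAdm κ) (h1 : i (hi s) = i (lo r))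
    (h2 : i (hi r) = i (lo r) - 1) :
    p r * (p s * (p r * E i)) = p s * (p r * (p s * E i)) - E i := by
  have := h.braid r s hs i
  obtain ⟨u, v, w, hu, hv, hw, hu', hv', hw'⟩ := hA.consts
  rw [if_neg (by rw [lo_eq_hi hs]; grind), if_pos ⟨h1, by rw [lo_eq_hi hs, h2]⟩] at this
  simpa [add_mul, mul_assoc, sub_eq_add_neg] using this

end Basic

end IsKLR

namespace IsKLR

variable {A : Type*} [Ring A]
variable {l n : ℕ} [NeZero l] {κ : ZMod l} {E : Res l n → A} {y : Fin n → A}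
  {p : Fin (n - 1) → A}

/-- The vanishing facts at the positions `r`, `r + 1`. -/
structure Level (E : Res l n → A) (y : Fin n → A) (r : Fin (n - 1)) : Prop where
  idem_zero : ∀ i, i (hi r) ≠ i (lo r) + 1 → i (lo r) + i (hi r) ≠ (r.val : ZMod l) → E i = 0
  y_neg : ∀ i, i (hi r) ≠ i (lo r) + 1 → y (hi r) * E i = -(y (lo r) * E i)

lemma Level.of_zero (hA : IsAdm κ) (h : IsKLR κ E y p) {r : Fin (n - 1)} (hr : r.val = 0) :
    Level E y r := by
  obtain ⟨u, v, w, hu, hv, hw, hu', hv', hw'⟩ := hA.consts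
  have m0 := hA.m0
  have hκ : ∀ i, ¬ (i (lo r) = κ ∨ i (lo r) = -κ) → E i = 0 := fun i hi =>
    h.cyc1 i (lo r) hr (fun h1 => hi (Or.inl h1)) (fun h1 => hi (Or.inr h1))
  have key : ∀ i, i (hi r) ≠ i (lo r) + 1 → i (lo r) + i (hi r) ≠ 0 → E i = 0 := by
    intro i h1 h2
    by_cases ha : i (lo r) = κ ∨ i (lo r) = -κ
    swap
    · exact hκ i ha
    by_cases h3 : i (hi r) = i (lo r)
    · refine h.eq_zero_of_lo h3 (z := 0) ?_ (by simp)
      rw [h.cyc2 _ _ hr, zero_mul]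
    by_cases h4 : i (hi r) = i (lo r) - 1
    · exact h.bad i r hr ha h4
    · refine h.far_zero h3 h1 h4 (hκ _ ?_)
      rw [sw_lo]
      rcases ha with ha | ha <;> rw [ha] at h2 h3 <;> grind
  refine ⟨by simpa [hr] using key, fun i h1 => ?_⟩
  rw [h.cyc2 _ (lo r) hr, neg_zero]
  by_cases h2 : i (lo r) + i (hi r) = 0
  swap
  · rw [key i h1 h2, mul_zero]
  by_cases ha : i (lo r) = κ ∨ i (lo r) = -κ
  swap
  · rw [hκ i ha, mul_zero]
  have m1 := hA.m1
  have mm1 := hA.mm1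
  have h3 : i (hi r) ≠ i (lo r) := by grind
  have h4 : i (hi r) ≠ i (lo r) - 1 := by grind
  rw [h.y_hi_far h3 h1 h4, h.cyc2 _ (lo r) hr, mul_zero, zero_mul]

section Step

variable (hA : IsAdm κ) (h : IsKLR κ E y p) {r s : Fin (n - 1)} (hs : s.val = r.val + 1)
  (L : Level E y r)
include hA h hs L

lemma idem_zero_far {i : Res l n} (h0 : i (hi s) ≠ i (hi r)) (h1 : i (hi s) ≠ i (hi r) + 1)
    (h2 : i (hi s) ≠ i (hi r) - 1) (h3 : i (hi r) + i (hi s) ≠ (r.val : ZMod l) + 1) :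
    E i = 0 := by
  obtain ⟨u, v, w, hu, hv, hw, hu', hv', hw'⟩ := hA.consts
  by_cases h4 : i (hi r) ≠ i (lo r) + 1 ∧ i (lo r) + i (hi r) ≠ (r.val : ZMod l)
  · exact L.idem_zero i h4.1 h4.2
  refine h.far_zero (r := s) (by rwa [lo_eq_hi hs]) (by rwa [lo_eq_hi hs]) (by rwa [lo_eq_hi hs])
    (L.idem_zero _ ?_ ?_) <;> simp only [sw_lo_prev hs, sw_hi_prev hs] <;> grind

lemma idem_zero_eq {i : Res l n} (h0 : i (hi s) = i (hi r))
    (h3 : i (hi r) + i (hi s) ≠ (r.val : ZMod l) + 1) : E i = 0 := by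
  obtain ⟨u, v, w, hu, hv, hw, hu', hv', hw'⟩ := hA.consts
  by_cases h1 : i (hi r) = i (lo r) + 1
  · refine h.eq_zero_of_lo (r := s) (by rwa [lo_eq_hi hs]) (z := y (lo r)) ?_ (h.psiy_prev hs)
    rw [lo_eq_hi hs]
    refine h.y_eq hA (Or.inl h1) (h.p_zero (L.idem_zero _ ?_ ?_)) <;>
      simp only [sw_lo, sw_hi] <;> grind
  · refine h.eq_zero_of_lo (r := s) (by rwa [lo_eq_hi hs]) (z := -y (lo r)) ?_ (by
      rw [mul_neg, neg_mul, h.psiy_prev hs])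
    rw [lo_eq_hi hs, L.y_neg i h1, neg_mul]

lemma idem_zero_up {i : Res l n} (h0 : i (hi r) = i (lo r) + 1) (h1 : i (hi s) = i (lo r))
    (h3 : i (hi r) + i (hi s) ≠ (r.val : ZMod l) + 1) : E i = 0 := by
  obtain ⟨u, v, w, hu, hv, hw, hu', hv', hw'⟩ := hA.consts
  have e1 := h.braid_up hs h1 h0
  have e2 : p s * E i = 0 := by
    refine h.p_zero (L.idem_zero _ ?_ ?_) <;> simp only [sw_lo_prev hs, sw_hi_prev hs] <;> grind
  have e3 : p r * E i = 0 := by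
    refine h.p_zero ?_
    by_cases h4 : i (lo r) + i (hi r) = (r.val : ZMod l)
    · refine idem_zero_eq hA h hs L ?_ ?_ <;> simp only [sw_hi, sw_hi_next hs] <;> grind
    · refine L.idem_zero _ ?_ ?_ <;> simp only [sw_lo, sw_hi] <;> grind
  rw [e2, e3] at e1
  simpa using e1.symm

lemma idem_zero_down (hp : ∀ t : Fin (n - 1), r.val = t.val + 1 → Level E y t) {i : Res l n}
    (h0 : i (hi r) ≠ i (lo r) + 1) (h1 : i (lo r) + i (hi r) = (r.val : ZMod l))
    (h2 : i (hi s) = i (hi r) - 1)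
    (h3 : i (hi r) + i (hi s) ≠ (r.val : ZMod l) + 1) : E i = 0 := by
  obtain ⟨u, v, w, hu, hv, hw, hu', hv', hw'⟩ := hA.consts
  have h4 : i (hi r) ≠ i (lo r) + 2 := by grind
  have hps (hne : i (hi r) ≠ i (lo r) + 2) : p s * E i = 0 := by
    refine h.p_zero (L.idem_zero _ ?_ ?_) <;> simp only [sw_lo_prev hs, sw_hi_prev hs] <;> grind
  by_cases h5 : i (hi r) = i (lo r)
  · refine h.eq_zero_of_hi (r := r) h5 (z := y (hi s)) ?_ (h.psiy_next hs)
    rw [← lo_eq_hi hs, h.y_eq hA (Or.inr (by rw [h2, lo_eq_hi hs])) (hps h4)]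
  by_cases h6 : i (hi r) = i (lo r) - 1
  swap
  · refine h.far_zero h5 h0 h6 (idem_zero_far hA h hs L ?_ ?_ ?_ ?_) <;>
      simp only [sw_hi, sw_hi_next hs] <;> grind
  rcases Nat.eq_zero_or_pos r.val with hr | hr
  · have m1 := hA.m1
    have mm1 := hA.mm1
    rw [hr, Nat.cast_zero] at h1
    refine h.cyc1 i (lo r) hr ?_ ?_ <;> intro h7 <;> rw [h7] at h6 <;> grind
  obtain ⟨t, ht⟩ : ∃ t : Fin (n - 1), r.val = t.val + 1 := ⟨⟨r.val - 1, by omega⟩, by simp; omega⟩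
  have Lt := hp t ht
  have hrt : (r.val : ZMod l) = t.val + 1 := by rw [ht]; push_cast; rfl
  have hl := lo_eq_hi ht
  by_cases h7 : i (hi t) = i (lo t) + 1 ∨ i (lo t) + i (hi t) = (t.val : ZMod l)
  swap
  · exact Lt.idem_zero i (fun h => h7 (Or.inl h)) (fun h => h7 (Or.inr h))
  rcases h7 with h7 | h7
  · have e1 := h.braid_up ht (i := i) (by grind) h7
    rw [h.p_zero (r := t), h.p_zero (r := r)] at e1
    · simpa using e1.symm
    · refine idem_zero_far hA h hs L ?_ ?_ ?_ ?_ <;> simp only [sw_hi, sw_hi_next hs] <;> grind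
    · refine Lt.idem_zero _ ?_ ?_ <;> simp only [sw_lo, sw_hi] <;> grind
  · have hts : ∀ j : Res l n, sw t j (hi s) = j (hi s) := fun j => sw_of_ne j
      (by simp [lo, hi, Fin.ext_iff]; omega) (by simp [hi, Fin.ext_iff]; omega)
    refine h.far_zero (r := t) (by grind) (by grind) (by grind)
      (idem_zero_up hA h hs L ?_ ?_ ?_) <;>
      simp only [hl, hts, sw_hi, sw_hi_next ht] <;> grind

lemma idem_zero_step (hp : ∀ t : Fin (n - 1), r.val = t.val + 1 → Level E y t) {i : Res l n}
    (h0 : i (hi s) ≠ i (hi r) + 1) (h3 : i (hi r) + i (hi s) ≠ (r.val : ZMod l) + 1) :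
    E i = 0 := by
  by_cases h1 : i (hi s) = i (hi r)
  · exact idem_zero_eq hA h hs L h1 h3
  by_cases h2 : i (hi s) = i (hi r) - 1
  swap
  · exact idem_zero_far hA h hs L h1 h0 h2 h3
  by_cases h4 : i (hi r) = i (lo r) + 1
  · exact idem_zero_up hA h hs L h4 (by grind) h3
  by_cases h5 : i (lo r) + i (hi r) = (r.val : ZMod l)
  · exact idem_zero_down hA h hs L hp h4 h5 h2 h3
  · exact L.idem_zero i h4 h5

lemma y_neg_step {i : Res l n} (h0 : i (hi s) ≠ i (hi r) + 1)
    (H : ∀ j : Res l n, j (hi s) ≠ j (hi r) + 1 → j (hi r) + j (hi s) ≠ (r.val : ZMod l) + 1 →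
      E j = 0) :
    y (hi s) * E i = -(y (lo s) * E i) := by
  obtain ⟨u, v, w, hu, hv, hw, hu', hv', hw'⟩ := hA.consts
  by_cases h1 : i (hi r) + i (hi s) = (r.val : ZMod l) + 1
  swap
  · rw [H i h0 h1, mul_zero, mul_zero, neg_zero]
  rw [lo_eq_hi hs]
  by_cases h2 : i (lo r) + i (hi r) = (r.val : ZMod l)
  · have h3 : i (hi r) ≠ i (lo r) := by grind
    have hz : y (hi s) * E (sw r i) = y (hi r) * E (sw r i) := by
      rw [← lo_eq_hi hs]
      refine h.y_eq hA (Or.inl ?_) (h.p_zero (L.idem_zero _ ?_ ?_)) <;>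
        simp only [sw_lo, sw_hi, sw_hi_next hs, sw_lo_prev hs, sw_hi_prev hs, lo_eq_hi hs] <;> grind
    have hc := h.psiy_next hs
    by_cases h5 : i (hi r) = i (lo r) - 1
    · have h4 : i (hi r) ≠ i (lo r) + 1 := by grind
      rw [h.y_hi_far (r := s), lo_eq_hi hs, h.y_eq (r := r) (i := sw s i) hA (Or.inl ?_)
        (h.p_zero (L.idem_zero _ ?_ ?_)), L.y_neg i h4, neg_neg, ← mul_assoc, h.psiy_prev hs,
        mul_assoc, mul_assoc, h.far_eq] <;>
        simp only [sw_lo, sw_hi, sw_lo_prev hs, sw_hi_prev hs, lo_eq_hi hs] <;> grind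
    have hn : y (hi r) * E (sw r i) = -(y (lo r) * E (sw r i)) := by
      refine L.y_neg _ ?_
      simp only [sw_lo, sw_hi]; grind
    by_cases h4 : i (hi r) = i (lo r) + 1
    · have f1 := h.pp_succ hA h4
      have f2 := h.y_hi_p (r := r) (i := sw r i) (by rw [sw_lo, sw_hi]; exact h3.symm)
      have f3 := h.psie r i
      have g1 := h.y_hi_p_eq (r := s) (i := i) (by rw [lo_eq_hi hs]; grind)
      have g2 := h.y_lo_p_eq (r := s) (i := i) (by rw [lo_eq_hi hs]; grind)
      have g3 := h.pp_eq (r := s) (i := i) (by rw [lo_eq_hi hs]; grind)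
      have g4 := h.psie_eq (r := s) (i := i) (by rw [lo_eq_hi hs]; grind)
      have g5 := h.ye (hi r) i
      have g6 := h.ye (hi s) i
      have g7 := h.yy (hi r) (hi s)
      have g8 := h.yy (hi r) (lo r)
      have g9 := h.yy (hi s) (lo r)
      rw [lo_eq_hi hs] at g1 g2
      have hY : p s * ((y (hi r) + y (hi s)) * E i) = (y (hi r) + y (hi s)) * (p s * E i) := by
        linear_combination (norm := noncomm_ring) -g1 - g2
      have hY' : (y (hi r) + y (hi s)) * E i = E i * (y (hi r) + y (hi s)) := by
        linear_combination (norm := noncomm_ring) g5 + g6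
      have hW : (y (hi r) + y (hi s)) * E i = 0 := by
        refine eq_zero_of_nilHecke (P := p s) (yl := y (hi r)) (yh := y (hi s)) (z := y (lo r))
          ?_ ?_ ?_ ?_ ?_ (h.psiy_prev hs)
        · rw [hY]
          linear_combination (norm := noncomm_ring) (y (hi r) + y (hi s)) * g2 + g7 * p s * E i -
            hY * y (hi s) - p s * (y (hi r) + y (hi s)) * g6 + (y (hi r) + y (hi s)) * p s * g6 +
            p s * g7 * E i
        · rw [hY]
          linear_combination (norm := noncomm_ring) p s * (y (hi r) + y (hi s)) * g4 +
            hY * p s - (y (hi r) + y (hi s)) * p s * g4 + (y (hi r) + y (hi s)) * g3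
        · rw [hY, g4, ← mul_assoc]
        · linear_combination (norm := noncomm_ring) (y (hi r) + y (hi s)) * g6 - g7 * E i
        · have : (y (hi r) + y (hi s)) * (p r * (p r * E i)) = 0 := by
            rw [f3]
            linear_combination (norm := noncomm_ring) f2 * p r - hc * E (sw r i) * p r +
              p r * hz * p r + p r * hn * p r
          linear_combination (norm := noncomm_ring) this - (y (hi r) + y (hi s)) * f1 + g7 * E i +
            g8 * E i + g9 * E i
      linear_combination (norm := noncomm_ring) hW
    · rw [h.y_hi_far h3 h4 h5]
      have := h.far_eq h3 h4 h5
      linear_combination (norm := noncomm_ring) (-y (hi s)) * this - hc * E (sw r i) * p r +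
        p r * hz * p r + p r * hn * p r
  by_cases h3 : i (hi r) = i (lo r) + 1
  swap
  · rw [L.idem_zero i h3 h2, mul_zero, mul_zero, neg_zero]
  have hy : y (hi r) * E i = y (lo r) * E i := by
    refine h.y_eq hA (Or.inl h3) (h.p_zero (L.idem_zero _ ?_ ?_)) <;>
      simp only [sw_lo, sw_hi] <;> grind
  by_cases h4 : i (hi s) = i (lo r)
  · have e1 := h.braid_up hs h4 h3
    have e2 : p r * E i = 0 := by
      refine h.p_zero (L.idem_zero _ ?_ ?_) <;> simp only [sw_lo, sw_hi] <;> grind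
    have h5 : i (hi r) ≠ i (lo r) := by grind
    have e3 : y (hi r) * E (sw s i) = -(y (lo r) * E (sw s i)) := by
      refine L.y_neg _ ?_
      simp only [sw_lo_prev hs, sw_hi_prev hs]; grind
    have e4 := h.psie s i
    have e5 : sw r (sw s i) = sw s i := sw_eq_self (by
      simp only [sw_lo_prev hs, sw_hi_prev hs]; grind)
    have e6 := h.psie r (sw s i)
    rw [e5] at e6
    have e7 := h.psiy_prev hs
    have e8 := h.y_hi_p (r := s) (i := sw s i) (by
      simp only [sw_hi, sw_hi_prev hs, lo_eq_hi hs]; grind)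
    rw [lo_eq_hi hs] at e8
    have e9 : (y (hi s) + y (lo r)) * (p s * E (sw s i)) = 0 := by
      linear_combination (norm := noncomm_ring) e8 + p s * e3 - e7 * E (sw s i)
    rw [e2, mul_zero, mul_zero, e4, ← mul_assoc (p r), e6] at e1
    linear_combination (norm := noncomm_ring) hy - (y (hi s) + y (lo r)) * e1 - e9 * p r * p s
  · have e7 := h.psiy_prev hs
    have e8 := h.far_eq (r := s) (i := i) (by rw [lo_eq_hi hs]; grind) (by rw [lo_eq_hi hs]; grind)
      (by rw [lo_eq_hi hs]; grind)
    rw [h.y_hi_far (r := s), lo_eq_hi hs, L.y_neg _ ?_]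
    · linear_combination (norm := noncomm_ring) hy - y (lo r) * e8 - e7 * E (sw s i) * p s
    all_goals simp only [sw_lo_prev hs, sw_hi_prev hs, lo_eq_hi hs]; grind

end Step

lemma level (hA : IsAdm κ) (h : IsKLR κ E y p) (r : Fin (n - 1)) : Level E y r := by
  obtain ⟨r, hr⟩ := r
  induction r using Nat.strong_induction_on with
  | _ r ih =>
    rcases r with _ | r
    · exact Level.of_zero hA h rfl
    have L := ih r (by omega) (by omega)
    have H := fun i => idem_zero_step hA h (r := ⟨r, by omega⟩) (s := ⟨r + 1, hr⟩) rfl L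
      (fun t ht => ih t.val (by simp at ht; omega) t.2) (i := i)
    refine ⟨fun i h0 h1 => H i h0 fun h2 => h1 ?_, fun i h0 => y_neg_step hA h rfl L h0 H⟩
    rw [Nat.cast_succ]
    exact h2

section Consequences

variable (hA : IsAdm κ) (h : IsKLR κ E y p) {r s : Fin (n - 1)}
include hA h

lemma idem_zero {i : Res l n} (h0 : i (hi r) ≠ i (lo r) + 1)
    (h1 : i (lo r) + i (hi r) ≠ (r.val : ZMod l)) : E i = 0 :=
  (h.level hA r).idem_zero i h0 h1

lemma y_neg {i : Res l n} (h0 : i (hi r) ≠ i (lo r) + 1) :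
    y (hi r) * E i = -(y (lo r) * E i) :=
  (h.level hA r).y_neg i h0

lemma p_mul_zero {i : Res l n} (h1 : i (lo r) + i (hi r) ≠ (r.val : ZMod l)) :
    p r * E i = 0 := by
  obtain ⟨u, v, w, hu, hv, hw, hu', hv', hw'⟩ := hA.consts
  by_cases h0 : i (hi r) = i (lo r) + 1
  · refine h.p_zero (h.idem_zero hA (r := r) ?_ ?_) <;> simp only [sw_lo, sw_hi] <;> grind
  · rw [h.idem_zero hA h0 h1, mul_zero]

lemma y_sq_eq (r : Fin (n - 1)) : y (hi r) * y (hi r) = y (lo r) * y (lo r) := by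
  obtain ⟨u, v, w, hu, hv, hw, hu', hv', hw'⟩ := hA.consts
  rw [← mul_one (y (hi r) * y (hi r)), ← mul_one (y (lo r) * y (lo r)), ← h.sum1, Finset.mul_sum,
    Finset.mul_sum]
  refine Finset.sum_congr rfl fun i _ => ?_
  have g := h.yy (lo r) (hi r)
  by_cases h0 : i (hi r) = i (lo r) + 1
  · have h1 : i (lo r) ≠ i (hi r) := by grind
    have e1 := h.pp_succ hA h0
    have e2 := h.y_lo_p (r := r) (i := sw r i) (by simpa using h1)
    have e3 := h.y_hi_p (r := r) (i := sw r i) (by simpa using h1)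
    have e4 := h.y_neg hA (r := r) (i := sw r i) (by simp; grind)
    have e5 := h.psie r i
    linear_combination (norm := noncomm_ring) (-(y (hi r) + y (lo r))) * e1 + e2 * p r +
      (y (hi r) + y (lo r)) * p r * e5 + e3 * p r + p r * e4 * p r - g * E i
  · have e1 := h.y_neg hA h0
    linear_combination (norm := noncomm_ring) y (hi r) * e1 - y (lo r) * e1 + g * E i

omit hA in
lemma y_zero {r : Fin n} (hr : r.val = 0) : y r = 0 := by
  rw [← mul_one (y r), ← h.sum1, Finset.mul_sum]
  exact Finset.sum_eq_zero fun i _ => h.cyc2 i r hr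

lemma y_sq (r : Fin n) : y r * y r = 0 := by
  obtain ⟨r, hr⟩ := r
  induction r with
  | zero => rw [h.y_zero rfl, mul_zero]
  | succ r ih =>
    rw [← ih (by omega)]
    exact h.y_sq_eq hA ⟨r, by omega⟩

end Consequences

end IsKLR

section Aff

variable {A : Type*} [Ring A] [Algebra ℂ A]

/-- The element `c₁ + c₂ t`. -/
def aff (c : ℂ × ℂ) (t : A) : A := algebraMap ℂ A c.1 + algebraMap ℂ A c.2 * t

/-- The coefficients of the inverse of `c₁ + c₂ t`, where `t² = 0`. -/
def affInv (c : ℂ × ℂ) : ℂ × ℂ := (c.1⁻¹, -(c.2 / c.1 ^ 2))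

lemma aff_zero (c : ℂ × ℂ) : aff c (0 : A) = algebraMap ℂ A c.1 := by simp [aff]

lemma aff_mul_of_comm (c : ℂ × ℂ) {t t' x : A} (h : t * x = x * t') :
    aff c t * x = x * aff c t' := by
  have h1 := Algebra.commutes c.1 x
  have h2 := Algebra.commutes c.2 x
  unfold aff
  linear_combination (norm := noncomm_ring) h1 + algebraMap ℂ A c.2 * h + h2 * t'

lemma aff_mul_congr (c : ℂ × ℂ) {t t' x : A} (h : t * x = t' * x) :
    aff c t * x = aff c t' * x := by
  unfold aff
  linear_combination (norm := noncomm_ring) algebraMap ℂ A c.2 * h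

lemma aff_neg (c : ℂ × ℂ) (t : A) : aff c (-t) = aff (c.1, -c.2) t := by simp [aff]

lemma aff_mul_aff {c c' : ℂ × ℂ} {t : A} (ht : t * t = 0) :
    aff c t * aff c' t = aff (c.1 * c'.1, c.1 * c'.2 + c.2 * c'.1) t := by
  have h1 := Algebra.commutes c'.1 t
  have h2 := Algebra.commutes c'.2 t
  simp only [aff, map_mul, map_add]
  linear_combination (norm := noncomm_ring) -algebraMap ℂ A c.2 * h1 -
    algebraMap ℂ A c.2 * h2 * t + algebraMap ℂ A c.2 * algebraMap ℂ A c'.2 * ht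

lemma aff_mul_eq {c c' : ℂ × ℂ} {t : A} (ht : t * t = 0) {x : ℂ} (h0 : c.1 * c'.1 = x)
    (h1 : c.1 * c'.2 + c.2 * c'.1 = 0) : aff c t * aff c' t = algebraMap ℂ A x := by
  rw [aff_mul_aff ht, h0, h1]; simp [aff]

lemma aff_mul_affInv {c : ℂ × ℂ} (hc : c.1 ≠ 0) {t : A} (ht : t * t = 0) :
    aff c t * aff (affInv c) t = 1 := by
  rw [aff_mul_eq ht (x := 1), map_one]
  · simp [affInv, hc]
  · simp only [affInv]; field_simp; ring

lemma affInv_mul_aff {c : ℂ × ℂ} (hc : c.1 ≠ 0) {t : A} (ht : t * t = 0) :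
    aff (affInv c) t * aff c t = 1 := by
  rw [aff_mul_eq ht (x := 1), map_one]
  · simp [affInv, hc]
  · simp only [affInv]; field_simp; ring

end Aff

section Coef

variable {l : ℕ}

/-- The character of `ℤ/lℤ` sending `1` to `q²`. -/
structure IsChar (q : ℂ) (χ : AddChar (ZMod l) ℂ) : Prop where
  q0 : q ≠ 0
  one : χ 1 = q ^ 2
  inj : ∀ d, χ d = 1 → d = 0

variable (q : ℂ) (χ : AddChar (ZMod l) ℂ)

/-- The coefficients of `U_r` on `e(i)` with `i_{r+1} - i_r = d`, `d ≠ 0, 1`. -/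
def cD (d : ZMod l) : ℂ × ℂ :=
  ((q⁻¹ * χ d - q) / (1 - χ d), 2 * χ d * (q - q⁻¹) / (1 - χ d) ^ 2)

/-- The coefficients of `U_r` on `e(i)` with `i_{r+1} = i_r`. -/
def cg : ℂ × ℂ := (q - q⁻¹, q + q⁻¹)

/-- The coefficients of `U_r` on `e(i)` with `i_{r+1} = i_r + 1`. -/
def ch : ℂ × ℂ := (-(q - q⁻¹)⁻¹, -((q + q⁻¹) * ((q - q⁻¹) ^ 2)⁻¹))

/-- The coefficients of `U_r` on `e(i)` with `i_{r+1} - i_r = d`. -/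
def cG (d : ZMod l) : ℂ × ℂ := if d = 0 then cg q else if d = 1 then ch q else cD q χ d

variable {q χ}

namespace IsChar

variable (hχ : IsChar q χ)
include hχ

lemma ne_one {d : ZMod l} (hd : d ≠ 0) : 1 - χ d ≠ 0 := fun h =>
  hd (hχ.inj d (by linear_combination -h))

lemma sq_ne (h1 : (1 : ZMod l) ≠ 0) : 1 - q ^ 2 ≠ 0 := by
  rw [← hχ.one]; exact hχ.ne_one h1

lemma delta_ne (h1 : (1 : ZMod l) ≠ 0) : q - q⁻¹ ≠ 0 := by
  have h0 := hχ.q0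
  have := hχ.sq_ne h1
  intro h
  field_simp at h
  exact this (by linear_combination -h)

lemma add_one (d : ZMod l) : χ (d + 1) = χ d * q ^ 2 := by
  rw [AddChar.map_add_eq_mul, hχ.one]

omit hχ in
lemma neg_eq (d : ZMod l) : χ (-d) = (χ d)⁻¹ := AddChar.map_neg_eq_inv χ d

omit hχ in
lemma ne_zero (d : ZMod l) : χ d ≠ 0 := fun h => by
  have := AddChar.map_add_eq_mul χ d (-d)
  simp [h] at this

lemma cG_fst_ne (h1 : (1 : ZMod l) ≠ 0) (d : ZMod l) : (cG q χ d).1 ≠ 0 := by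
  unfold cG
  split_ifs with hd hd'
  · exact hχ.delta_ne h1
  · exact neg_ne_zero.2 (inv_ne_zero (hχ.delta_ne h1))
  · have h2 := hχ.ne_one hd
    have h3 := hχ.ne_one (sub_ne_zero.2 hd')
    have h4 := hχ.add_one (d - 1)
    rw [sub_add_cancel] at h4
    have h0 := hχ.q0
    refine div_ne_zero ?_ h2
    intro h
    rw [h4] at h
    refine h3 (mul_left_cancel₀ h0 ?_)
    field_simp at h
    linear_combination -h

section

variable {A : Type*} [Ring A] [Algebra ℂ A] {t : A}

lemma cD_mul {d : ZMod l} (ht : t * t = 0) (h0 : d ≠ 0) (h1 : d + 1 ≠ 0) :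
    aff (cD q χ (-d)) (-t) * aff (cD q χ (d + 1)) t = 1 := by
  have e0 := hχ.ne_one h0
  have e1 := hχ.ne_one h1
  have hq := hχ.q0
  have hd := ne_zero (χ := χ) d
  rw [aff_neg, aff_mul_eq ht (x := 1), map_one]
  all_goals
    rw [hχ.add_one, mul_comm] at e1
    simp only [cD, hχ.add_one, neg_eq]
    have e2 : 1 - (χ d)⁻¹ ≠ 0 := by
      intro h; field_simp at h; exact e0 (by linear_combination -h)
    generalize χ d = z at *
    have e3 : z - 1 ≠ 0 := fun h => e0 (by linear_combination -h)
    field_simp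
    try ring

lemma cD_add {d : ZMod l} (h0 : d ≠ 0) :
    aff (cD q χ d) t + aff (cD q χ (-d)) (-t) = -algebraMap ℂ A (q + q⁻¹) := by
  have e0 := hχ.ne_one h0
  have hq := hχ.q0
  have hd := ne_zero (χ := χ) d
  have H : ∀ c c' : ℂ × ℂ, c.1 + c'.1 = -(q + q⁻¹) → c.2 = c'.2 →
      aff c t + aff c' (-t) = -algebraMap ℂ A (q + q⁻¹) := by
    intro c c' h1 h2
    rw [← map_neg, ← h1]
    simp only [aff, map_add, h2]
    noncomm_ring
  have e3 : χ d - 1 ≠ 0 := fun h => e0 (by linear_combination -h)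
  apply H
  all_goals
    simp only [cD, neg_eq]
    have e2 : 1 - (χ d)⁻¹ ≠ 0 := by
      intro h; field_simp at h; exact e0 (by linear_combination -h)
    generalize χ d = z at *
    field_simp
    ring

lemma cD_neg_one (h1 : (1 : ZMod l) ≠ 0) (ht : t * t = 0) :
    aff (cD q χ (-1)) t + 2 * t * aff (ch q) (-t) = -algebraMap ℂ A (q + q⁻¹) := by
  have e0 := hχ.sq_ne h1
  have hq := hχ.q0
  have e1 : (cD q χ (-1)).1 = -(q + q⁻¹) := by
    simp only [cD, neg_eq, hχ.one]
    have : 1 - (q ^ 2)⁻¹ ≠ 0 := by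
      intro h; field_simp at h; exact e0 (by linear_combination -h)
    have e3 : q ^ 2 - 1 ≠ 0 := fun h => e0 (by linear_combination -h)
    field_simp
    ring
  have e2 : (cD q χ (-1)).2 + 2 * (ch q).1 = 0 := by
    simp only [cD, ch, neg_eq, hχ.one]
    have h4 := hχ.delta_ne h1
    have : 1 - (q ^ 2)⁻¹ ≠ 0 := by
      intro h; field_simp at h; exact e0 (by linear_combination -h)
    have e3 : q ^ 2 - 1 ≠ 0 := fun h => e0 (by linear_combination -h)
    field_simp
    ring
  have e3 : (cD q χ (-1)).2 = -2 * (ch q).1 := by linear_combination e2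
  simp only [aff, e1, e3]
  have c1 := Algebra.commutes (ch q).1 t
  have c2 := Algebra.commutes (ch q).2 t
  simp only [map_mul, map_neg, map_ofNat]
  linear_combination (norm := noncomm_ring) -2 * c1 + 2 * c2 * t -
    2 * algebraMap ℂ A (ch q).2 * ht

lemma ch_mul_cg (h1 : (1 : ZMod l) ≠ 0) (ht : t * t = 0) :
    aff (ch q) (-t) * aff (cg q) t = -1 := by
  have h4 := hχ.delta_ne h1
  rw [aff_neg, aff_mul_eq ht (x := -1), map_neg, map_one] <;> simp only [ch, cg] <;> (
    generalize q - q⁻¹ = z at *; field_simp; try ring)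

end

end IsChar

end Coef

section UB

variable {A : Type*} [Ring A] [Algebra ℂ A]
variable {l n : ℕ} [NeZero l]

/-- The component of `U_r` commuting with `e(i)`. -/
def uC (q : ℂ) (χ : AddChar (ZMod l) ℂ) (d : ZMod l) (t t' : A) : A :=
  if d = 0 then 0 else if d = 1 then (t' - t) * aff (ch q) t else aff (cD q χ d) t

/-- The image of the generator `U_r` of the blob algebra. -/
def UB (q : ℂ) (χ : AddChar (ZMod l) ℂ) (E : Res l n → A) (y : Fin n → A) (p : Fin (n - 1) → A)
    (r : Fin (n - 1)) : A :=
  ∑ i : Res l n, (p r * aff (cG q χ (i (hi r) - i (lo r))) (y (lo r)) +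
    uC q χ (i (hi r) - i (lo r)) (y (lo r)) (y (hi r))) * E i

/-- The image of the generator `e` of the blob algebra. -/
def eB (κ : ZMod l) (hn : 0 < n) (E : Res l n → A) : A :=
  ∑ i : Res l n, if i ⟨0, hn⟩ = -κ then E i else 0

end UB

namespace IsKLR

variable {A : Type*} [Ring A] [Algebra ℂ A]
variable {l n : ℕ} [NeZero l] {κ : ZMod l} {E : Res l n → A} {y : Fin n → A}
  {p : Fin (n - 1) → A} {q : ℂ} {χ : AddChar (ZMod l) ℂ}

section

variable (h : IsKLR κ E y p)
include h

omit [Algebra ℂ A] in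
lemma sum_mul_E (f : Res l n → A) (i : Res l n) : (∑ j, f j * E j) * E i = f i * E i := by
  rw [Finset.sum_mul, Finset.sum_eq_single i]
  · rw [mul_assoc, h.idem]
  · intro j _ hj
    rw [mul_assoc, h.orth j i hj, mul_zero]
  · simp

omit [Algebra ℂ A] in
lemma ext_E {a b : A} (H : ∀ i, a * E i = b * E i) : a = b := by
  rw [← mul_one a, ← mul_one b, ← h.sum1, Finset.mul_sum, Finset.mul_sum]
  exact Finset.sum_congr rfl fun i _ => H i

lemma aff_E (c : ℂ × ℂ) (r : Fin n) (i : Res l n) :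
    aff c (y r) * E i = E i * aff c (y r) := aff_mul_of_comm c (h.ye r i)

lemma UB_E (r : Fin (n - 1)) (i : Res l n) : UB q χ E y p r * E i =
    (p r * aff (cG q χ (i (hi r) - i (lo r))) (y (lo r)) +
      uC q χ (i (hi r) - i (lo r)) (y (lo r)) (y (hi r))) * E i :=
  h.sum_mul_E _ i

variable {r s : Fin (n - 1)} {i : Res l n}

lemma UB_gen (h0 : i (hi r) ≠ i (lo r)) (h1 : i (hi r) ≠ i (lo r) + 1) {d : ZMod l}
    (hd : i (hi r) - i (lo r) = d) :
    UB q χ E y p r * E i = (p r + 1) * E i * aff (cD q χ d) (y (lo r)) := by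
  have h0' : d ≠ 0 := fun H => h0 (by grind)
  have h1' : d ≠ 1 := fun H => h1 (by grind)
  rw [h.UB_E, hd, cG, uC, if_neg h0', if_neg h1', if_neg h0', if_neg h1']
  linear_combination (norm := noncomm_ring) (p r + 1) * h.aff_E (cD q χ d) (lo r) i

lemma UB_eq (h0 : i (hi r) = i (lo r)) :
    UB q χ E y p r * E i = p r * E i * aff (cg q) (y (lo r)) := by
  rw [h.UB_E, h0, sub_self, cG, uC, if_pos rfl, if_pos rfl]
  linear_combination (norm := noncomm_ring) p r * h.aff_E (cg q) (lo r) i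

lemma UB_succ (hA : IsAdm κ) (h1 : i (hi r) = i (lo r) + 1) :
    UB q χ E y p r * E i = (p r + 1) * p r * E i * aff (ch q) (y (lo r)) := by
  rw [h.UB_E, h1, add_sub_cancel_left, cG, uC, if_neg hA.one, if_pos rfl, if_neg hA.one,
    if_pos rfl]
  linear_combination (norm := noncomm_ring) (p r + y (hi r) - y (lo r)) *
    h.aff_E (ch q) (lo r) i - h.pp_succ hA h1 * aff (ch q) (y (lo r))

lemma UB_zero (hA : IsAdm κ) (h1 : i (lo r) + i (hi r) ≠ (r.val : ZMod l)) :
    UB q χ E y p r * E i = 0 := by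
  have e := h.p_mul_zero hA h1
  by_cases h2 : i (hi r) = i (lo r) + 1
  · rw [h.UB_succ hA h2]
    linear_combination (norm := noncomm_ring) (p r + 1) * e * aff (ch q) (y (lo r))
  · rw [h.idem_zero hA h2 h1, mul_zero]

lemma aff_lo_p (c : ℂ × ℂ) (h0 : i (hi r) ≠ i (lo r)) :
    aff c (y (lo r)) * p r * E i = p r * E i * aff c (y (hi r)) := by
  rw [mul_assoc]
  refine aff_mul_of_comm c ?_
  rw [h.y_lo_p h0, h.ye, mul_assoc]

lemma aff_hi_p (c : ℂ × ℂ) (h0 : i (hi r) ≠ i (lo r)) :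
    aff c (y (hi r)) * p r * E i = p r * E i * aff c (y (lo r)) := by
  rw [mul_assoc]
  refine aff_mul_of_comm c ?_
  rw [h.y_hi_p h0, h.ye, mul_assoc]

lemma E_aff_hi (hA : IsAdm κ) (c : ℂ × ℂ) (h1 : i (hi r) ≠ i (lo r) + 1) :
    E i * aff c (y (hi r)) = E i * aff c (-y (lo r)) := by
  rw [← h.aff_E]
  rw [aff_mul_congr c (t' := -y (lo r)) (by rw [h.y_neg hA h1, neg_mul])]
  exact aff_mul_of_comm c (by rw [neg_mul, h.ye, mul_neg])

lemma aff_prev (c : ℂ × ℂ) (hs : s.val = r.val + 1) :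
    aff c (y (lo r)) * p s = p s * aff c (y (lo r)) :=
  aff_mul_of_comm c (h.psiy_prev hs).symm

lemma aff_next (c : ℂ × ℂ) (hs : s.val = r.val + 1) :
    aff c (y (hi s)) * p r = p r * aff c (y (hi s)) :=
  aff_mul_of_comm c (h.psiy_next hs).symm

lemma p_aff_p_eq (h0 : i (hi r) = i (lo r)) :
    p r * (aff (cg q) (y (lo r)) * (p r * E i)) = -algebraMap ℂ A (q + q⁻¹) * (p r * E i) := by
  have e1 := h.y_lo_p_eq h0
  have e2 := h.pp_eq h0
  have c1 := Algebra.commutes (cg q).1 (p r)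
  have c2 := Algebra.commutes (cg q).2 (p r)
  have e3 := h.ye (hi r) i
  have : (cg q).2 = q + q⁻¹ := rfl
  rw [← this, aff]
  linear_combination (norm := noncomm_ring) p r * algebraMap ℂ A (cg q).2 * e1 -
    c1 * p r * E i + algebraMap ℂ A (cg q).1 * e2 - c2 * p r * y (hi r) * E i +
    algebraMap ℂ A (cg q).2 * e2 * y (hi r) + algebraMap ℂ A (cg q).2 * p r * p r * e3 + c2 * E i

lemma UB_sq (hA : IsAdm κ) (hχ : IsChar q χ) (r : Fin (n - 1)) :
    UB q χ E y p r * UB q χ E y p r = (-(q + q⁻¹)) • UB q χ E y p r := by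
  obtain ⟨u, v, w, hu, hv, hw, hu', hv', hw'⟩ := hA.consts
  refine h.ext_E fun i => ?_
  rw [neg_smul, neg_mul, Algebra.smul_def]
  have hτ := Algebra.commutes (A := A) (q + q⁻¹)
  have e3 := h.psie r i
  have hy := h.y_sq hA (lo r)
  by_cases h0 : i (hi r) = i (lo r)
  · have e1 := h.UB_eq (q := q) (χ := χ) h0
    have e2 := h.p_aff_p_eq (q := q) h0
    have e4 := h.aff_E (cg q) (lo r) i
    rw [sw_eq_self h0] at e3
    linear_combination (norm := noncomm_ring) UB q χ E y p r * e1 +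
      UB q χ E y p r * e3 * aff (cg q) (y (lo r)) + e1 * p r * aff (cg q) (y (lo r)) -
      p r * e4 * p r * aff (cg q) (y (lo r)) - p r * aff (cg q) (y (lo r)) * e3 *
      aff (cg q) (y (lo r)) + e2 * aff (cg q) (y (lo r)) + algebraMap ℂ A (q + q⁻¹) * e1
  by_cases h1 : i (hi r) = i (lo r) + 1
  · have e1 := h.UB_succ (q := q) (χ := χ) hA h1
    have e2 := h.UB_gen (q := q) (χ := χ) (r := r) (i := sw r i) (d := -1) (by simp; grind)
      (by simp; grind) (by simp; grind)
    have e4 := h.aff_lo_p (ch q) (r := r) (i := sw r i) (by simp; grind)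
    have e5 := h.E_aff_hi hA (ch q) (r := r) (i := sw r i) (by simp; grind)
    have e6 := h.pp_pred hA (r := r) (i := sw r i) (by simp; grind)
    have e7 := h.y_neg hA (r := r) (i := sw r i) (by simp; grind)
    have e8 := hχ.cD_neg_one hA.one hy
    have e9 := h.ye (lo r) (sw r i)
    have e10 := h.psie r (sw r i)
    rw [sw_sw] at e10
    have eH := h.aff_E (ch q) (lo r) i
    generalize UB q χ E y p r = U at *
    generalize p r = P at *
    generalize aff (ch q) (y (lo r)) = H at *
    generalize aff (ch q) (-y (lo r)) = H' at *
    generalize aff (ch q) (y (hi r)) = Hh at *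
    generalize aff (cD q χ (-1)) (y (lo r)) = D at *
    generalize y (lo r) = Y at *
    generalize y (hi r) = Y' at *
    generalize E (sw r i) = F at *
    generalize E i = W at *
    generalize algebraMap ℂ A (q + q⁻¹) = T at *
    have k1 : U * P * F = (P + 1) * F * (2 * Y * H') := by
      linear_combination (norm := noncomm_ring) U * e10 + e1 * P - (P + 1) * P * eH * P -
        (P + 1) * P * H * e10 + (P + 1) * P * e4 + (P + 1) * P * P * e5 + (P + 1) * e6 * H' -
        (P + 1) * e7 * H' + 2 * (P + 1) * e9 * H'
    linear_combination (norm := noncomm_ring) U * e1 + U * (P + 1) * e3 * H + k1 * P * H +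
      e2 * P * H + (P + 1) * F * e8 * P * H + T * e1 + hτ ((P + 1) * F) * P * H +
      T * (P + 1) * e3 * H
  · have e1 := h.UB_gen (q := q) (χ := χ) h0 h1 rfl
    have hd : i (hi r) - i (lo r) ≠ 0 := sub_ne_zero.2 h0
    have eD := h.aff_E (cD q χ (i (hi r) - i (lo r))) (lo r) i
    by_cases h2 : i (hi r) = i (lo r) - 1
    · have e2 := h.UB_succ (q := q) (χ := χ) (r := r) (i := sw r i) hA (by simp; grind)
      have e4 := h.aff_lo_p (ch q) h0
      have e5 := h.E_aff_hi hA (ch q) h1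
      have e6 := h.pp_pred hA h2
      have e7 := h.y_neg hA h1
      have hd' : i (hi r) - i (lo r) = -1 := by rw [h2]; ring
      rw [hd'] at e1 eD
      have e8 := hχ.cD_neg_one hA.one hy
      have e9 := h.ye (lo r) i
      have eH := h.aff_E (ch q) (lo r) (sw r i)
      generalize UB q χ E y p r = U at *
      generalize p r = P at *
      generalize aff (ch q) (y (lo r)) = H at *
      generalize aff (ch q) (-y (lo r)) = H' at *
      generalize aff (ch q) (y (hi r)) = Hh at *
      generalize aff (cD q χ (-1)) (y (lo r)) = D at *
      generalize y (lo r) = Y at *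
      generalize y (hi r) = Y' at *
      generalize E (sw r i) = F at *
      generalize E i = W at *
      generalize algebraMap ℂ A (q + q⁻¹) = T at *
      have k1 : U * P * W = (P + 1) * W * (2 * Y * H') := by
        linear_combination (norm := noncomm_ring) U * e3 + e2 * P - (P + 1) * P * eH * P -
          (P + 1) * P * H * e3 + (P + 1) * P * e4 + (P + 1) * P * P * e5 + (P + 1) * e6 * H' -
          (P + 1) * e7 * H' + 2 * (P + 1) * e9 * H'
      linear_combination (norm := noncomm_ring) U * e1 + k1 * D + e1 * D + (P + 1) * W * e8 * D +
        T * e1 + hτ ((P + 1) * W) * D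
    · have e2 := h.UB_gen (q := q) (χ := χ) (r := r) (i := sw r i)
        (d := -(i (hi r) - i (lo r))) (by simp; grind) (by simp; grind) (by simp)
      have e4 := h.aff_lo_p (cD q χ (-(i (hi r) - i (lo r)))) h0
      have e5 := h.E_aff_hi hA (cD q χ (-(i (hi r) - i (lo r)))) h1
      have e6 := h.pp_far h0 h1 h2
      have e8 := hχ.cD_add (t := y (lo r)) hd
      have eH := h.aff_E (cD q χ (-(i (hi r) - i (lo r)))) (lo r) (sw r i)
      generalize i (hi r) - i (lo r) = d at *
      generalize UB q χ E y p r = U at *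
      generalize p r = P at *
      generalize aff (cD q χ (-d)) (y (lo r)) = H at *
      generalize aff (cD q χ (-d)) (-y (lo r)) = H' at *
      generalize aff (cD q χ (-d)) (y (hi r)) = Hh at *
      generalize aff (cD q χ d) (y (lo r)) = D at *
      generalize E (sw r i) = F at *
      generalize E i = W at *
      generalize algebraMap ℂ A (q + q⁻¹) = T at *
      have k1 : U * P * W = (P + 1) * W * H' := by
        linear_combination (norm := noncomm_ring) U * e3 + e2 * P - (P + 1) * eH * P -
          (P + 1) * H * e3 + (P + 1) * e4 + (P + 1) * P * e5 + e6 * H'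
      linear_combination (norm := noncomm_ring) U * e1 + k1 * D + e1 * D + (P + 1) * W * e8 * D +
        T * e1 + hτ ((P + 1) * W) * D

end

end IsKLR

namespace IsKLR

variable {A : Type*} [Ring A] [Algebra ℂ A]
variable {l n : ℕ} [NeZero l] {κ : ZMod l} {E : Res l n → A} {y : Fin n → A}
  {p : Fin (n - 1) → A} {q : ℂ} {χ : AddChar (ZMod l) ℂ}

variable (h : IsKLR κ E y p) {r s : Fin (n - 1)} {i : Res l n}
include h

lemma sw_UB (hA : IsAdm κ) (h0 : i (hi r) ≠ i (lo r)) (h1 : i (hi r) ≠ i (lo r) - 1) :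
    (p r + 1) * E (sw r i) * UB q χ E y p r * E i = UB q χ E y p r * E i := by
  obtain ⟨u, v, w, hu, hv, hw, hu', hv', hw'⟩ := hA.consts
  have e3 := h.psie r i
  have e4 := h.orth _ _ (sw_ne_self h0)
  have e5 := h.idem (sw r i)
  by_cases h2 : i (hi r) = i (lo r) + 1
  · have e1 := h.UB_succ (q := q) (χ := χ) hA h2
    have e6 := h.pp_succ hA h2
    have e7 := h.ye (hi r) i
    have e8 := h.ye (lo r) i
    linear_combination (norm := noncomm_ring) (p r + 1) * E (sw r i) * e1 - e1 +
      (p r + 1) * E (sw r i) * e6 * aff (ch q) (y (lo r)) +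
      (p r + 1) * E (sw r i) * (e7 - e8) * aff (ch q) (y (lo r)) +
      (p r + 1) * e4 * (y (hi r) - y (lo r)) * aff (ch q) (y (lo r)) +
      (p r + 1) * E (sw r i) * e3 * aff (ch q) (y (lo r)) +
      (p r + 1) * (e5 * p r - e3) * aff (ch q) (y (lo r))
  · have e1 := h.UB_gen (q := q) (χ := χ) h0 h2 rfl
    have e6 := h.pp_far h0 h2 h1
    linear_combination (norm := noncomm_ring) (p r + 1) * E (sw r i) * e1 - e1 +
      (p r + 1) * (E (sw r i) * e3 + e5 * p r - e3 + e4) *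
      aff (cD q χ (i (hi r) - i (lo r))) (y (lo r)) +
      e6 * aff (cD q χ (i (hi r) - i (lo r))) (y (lo r))

lemma word_rsr (hA : IsAdm κ) (hχ : IsChar q χ) (hs : s.val = r.val + 1)
    (h0 : i (hi r) = i (lo r) - 1)
    (h1 : i (hi s) = i (lo r)) (h2 : i (lo r) + i (hi r) = (r.val : ZMod l)) :
    p r * aff (ch q) (y (lo r)) * p s * aff (cg q) (y (lo s)) * p r * E i = E i := by
  obtain ⟨u, v, w, hu, hv, hw, hu', hv', hw'⟩ := hA.consts
  have e1 := h.aff_prev (ch q) hs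
  have e2 := h.aff_hi_p (cg q) (r := r) (i := i) (by grind)
  have e3 := h.aff_lo_p (ch q) (r := r) (i := i) (by grind)
  have e4 := h.E_aff_hi hA (ch q) (r := r) (i := i) (by grind)
  have e5 := hχ.ch_mul_cg hA.one (h.y_sq hA (lo r))
  have e6 := h.braid_down hs hA h1 h0
  rw [h.p_mul_zero hA (r := s) (by rw [lo_eq_hi hs, hs, Nat.cast_succ]; grind), mul_zero,
    mul_zero] at e6
  rw [lo_eq_hi hs]
  linear_combination (norm := noncomm_ring) p r * aff (ch q) (y (lo r)) * p s * e2 +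
    p r * (e1 * p r * E i + p s * e3) * aff (cg q) (y (lo r)) +
    p r * p s * p r * e4 * aff (cg q) (y (lo r)) + p r * p s * p r * E i * e5 - e6

lemma word_srs (hA : IsAdm κ) (hχ : IsChar q χ) (hs : s.val = r.val + 1)
    (h0 : i (hi r) = i (lo r) + 1)
    (h1 : i (hi s) = i (lo r)) (h2 : i (lo r) + i (lo r) = (r.val : ZMod l)) :
    p s * aff (ch q) (y (lo s)) * p r * aff (cg q) (y (lo r)) * p s * E i = E i := by
  obtain ⟨u, v, w, hu, hv, hw, hu', hv', hw'⟩ := hA.consts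
  have e0 := h.aff_next (ch q) hs
  have e1 := h.aff_prev (cg q) hs
  have hz := h.p_mul_zero hA (r := r) (i := i) (by grind)
  have e6 := h.braid_up hs h1 h0
  rw [hz, mul_zero, mul_zero] at e6
  have e2 := h.aff_hi_p (ch q) (r := s) (i := sw s i) (by
    rw [sw_hi, sw_lo, lo_eq_hi hs]; grind)
  have e3 := h.psie s i
  have e4 := h.psie r (sw s i)
  rw [sw_eq_self (i := sw s i) (by rw [sw_lo_prev hs, sw_hi_prev hs, h1])] at e4
  have e5 := h.E_aff_hi hA (ch q) (r := s) (i := i) (by rw [lo_eq_hi hs]; grind)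
  have e7 : aff (cg q) (y (lo r)) * E i = aff (cg q) (y (lo s)) * E i :=
    aff_mul_congr _ (by rw [lo_eq_hi hs, h.y_eq hA (Or.inl h0) hz])
  have e8 := hχ.ch_mul_cg hA.one (h.y_sq hA (lo s))
  have e9 := h.aff_E (cg q) (lo s) i
  have e10 := h.aff_E (ch q) (lo s) (sw s i)
  have e11 := h.aff_E (ch q) (hi s) i
  generalize aff (cg q) (y (lo r)) = G at *
  generalize aff (cg q) (y (lo s)) = Gs at *
  generalize aff (ch q) (y (lo s)) = H at *
  generalize aff (ch q) (-y (lo s)) = H' at *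
  generalize aff (ch q) (y (hi s)) = Hh at *
  generalize p r = R at *
  generalize p s = S at *
  linear_combination (norm := noncomm_ring) S * H * R * e1 * E i + S * H * R * S * (e7 + e9) +
    S * H * R * e3 * Gs + S * H * e4 * S * Gs + S * e10 * R * S * Gs - e2 * R * S * Gs -
    Hh * S * R * e3 * Gs - Hh * S * e4 * S * Gs - Hh * e6 * Gs - e11 * Gs - e5 * Gs - E i * e8

end IsKLR

namespace IsKLR

variable {A : Type*} [Ring A] [Algebra ℂ A]
variable {l n : ℕ} [NeZero l] {κ : ZMod l} {E : Res l n → A} {y : Fin n → A}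
  {p : Fin (n - 1) → A} {q : ℂ} {χ : AddChar (ZMod l) ℂ}

variable (h : IsKLR κ E y p) {r s : Fin (n - 1)} {i : Res l n}
include h

lemma UB_split (hA : IsAdm κ) (h0 : i (hi r) ≠ i (lo r)) :
    UB q χ E y p r * E i =
      E (sw r i) * UB q χ E y p r * E i + E i * UB q χ E y p r * E i := by
  have e3 := h.psie r i
  have e4 := h.orth _ _ (sw_ne_self h0)
  have e4' := h.orth _ _ (sw_ne_self h0).symm
  have e5 := h.idem (sw r i)
  have e6 := h.idem i
  by_cases h2 : i (hi r) = i (lo r) + 1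
  · have e1 := h.UB_succ (q := q) (χ := χ) hA h2
    have e7 := h.psie r (sw r i)
    rw [sw_sw] at e7
    linear_combination (norm := noncomm_ring) e1 - E (sw r i) * e1 - E i * e1 +
      ((1 - E (sw r i) - E i) * (p r + 1) * e3 + (1 - E (sw r i) - E i) * e7 * p r - e5 * p r -
        e6 * p r * p r - e4 * p r * p r - e4' * p r) * aff (ch q) (y (lo r))
  · have e1 := h.UB_gen (q := q) (χ := χ) h0 h2 rfl
    linear_combination (norm := noncomm_ring) e1 - E (sw r i) * e1 - E i * e1 +
      ((1 - E (sw r i) - E i) * e3 - e5 * p r - e6 - e4' * p r - e4) *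
      aff (cD q χ (i (hi r) - i (lo r))) (y (lo r))

lemma UB_diag (h0 : i (hi r) ≠ i (lo r)) (h1 : i (hi r) ≠ i (lo r) + 1) {d : ZMod l}
    (hd : i (hi r) - i (lo r) = d) :
    E i * UB q χ E y p r * E i = E i * aff (cD q χ d) (y (lo r)) := by
  have e3 := h.psie r i
  have e4' := h.orth _ _ (sw_ne_self h0).symm
  have e6 := h.idem i
  have e1 := h.UB_gen (q := q) (χ := χ) h0 h1 hd
  linear_combination (norm := noncomm_ring) E i * e1 + (E i * e3 + e4' * p r + e6) *
    aff (cD q χ d) (y (lo r))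

lemma UB_p_zero (hA : IsAdm κ) (h0 : sw s i (lo r) + sw s i (hi r) ≠ (r.val : ZMod l)) :
    UB q χ E y p r * p s * E i = 0 := by
  rw [mul_assoc, h.psie, ← mul_assoc, h.UB_zero hA h0, zero_mul]

lemma UB_rsr (hA : IsAdm κ) (hχ : IsChar q χ) (hs : s.val = r.val + 1) :
    UB q χ E y p r * UB q χ E y p s * UB q χ E y p r * E i = UB q χ E y p r * E i := by
  obtain ⟨u, v, w, hu, hv, hw, hu', hv', hw'⟩ := hA.consts
  have hsr : (s.val : ZMod l) = r.val + 1 := by rw [hs, Nat.cast_succ]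
  by_cases hab : i (lo r) + i (hi r) = (r.val : ZMod l)
  swap
  · rw [mul_assoc, h.UB_zero hA hab, mul_zero]
  by_cases hE : i (hi s) ≠ i (hi r) + 1 ∧ i (hi s) ≠ i (lo r) + 1
  · rw [h.idem_zero hA (r := s), mul_zero, mul_zero] <;> rw [lo_eq_hi hs] <;> grind
  have e3 := h.psie r i
  by_cases hc : i (hi s) = i (lo r) + 1
  swap
  · have hc' : i (hi s) = i (hi r) + 1 := by grind
    have h0 : i (hi r) ≠ i (lo r) := by grind
    have z1 := h.UB_zero (q := q) (χ := χ) hA (r := s) (i := i) (by rw [lo_eq_hi hs]; grind)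
    by_cases h1 : i (hi r) = i (lo r) - 1
    · have e1 := h.UB_gen (q := q) (χ := χ) h0 (by grind) rfl
      have e2 := h.UB_succ (q := q) (χ := χ) (r := r) (i := sw r i) hA (by simp; grind)
      have e4 := h.UB_eq (q := q) (χ := χ) (r := s) (i := sw r i)
        (by rw [sw_hi_next hs, lo_eq_hi hs, sw_hi]; grind)
      have e5 := h.psie s (sw r i)
      rw [sw_eq_self (i := sw r i) (by rw [sw_hi_next hs, lo_eq_hi hs, sw_hi]; grind)] at e5
      have e6 := h.word_rsr hA hχ hs h1 (by grind) hab
      have e7 := h.aff_E (ch q) (lo r) (sw r i)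
      have e8 := h.aff_E (cg q) (lo s) (sw r i)
      generalize aff (cg q) (y (lo s)) = G at *
      generalize aff (ch q) (y (lo r)) = H at *
      generalize UB q χ E y p r = U at *
      generalize UB q χ E y p s = V at *
      generalize p r = R at *
      generalize p s = S at *
      generalize aff (cD q χ (i (hi r) - i (lo r))) (y (lo r)) = D at *
      generalize E (sw r i) = F at *
      generalize E i = W at *
      linear_combination (norm := noncomm_ring) U * V * e1 + U * V * e3 * D + U * z1 * D +
        U * e4 * R * D + U * e5 * G * R * D + e2 * S * G * R * D - (R + 1) * R * e7 * S * G * R * D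
        - (R + 1) * R * H * (e5 * G * R + S * e8 * R + S * G * e3) * D + (R + 1) * e6 * D - e1
    · have hd0 : i (hi r) - i (lo r) ≠ 0 := by grind
      have hd1 : i (hi r) - i (lo r) + 1 ≠ 0 := by grind
      have e1 := h.UB_split (q := q) (χ := χ) hA h0
      have e2 := h.UB_gen (q := q) (χ := χ) (r := r) (i := sw r i)
        (d := -(i (hi r) - i (lo r))) (by simp; grind) (by simp; grind) (by simp)
      have e4 := h.UB_gen (q := q) (χ := χ) (r := s) (i := sw r i)
        (d := i (hi r) - i (lo r) + 1)
        (by rw [sw_hi_next hs, lo_eq_hi hs, sw_hi]; grind)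
        (by rw [sw_hi_next hs, lo_eq_hi hs, sw_hi]; grind)
        (by rw [sw_hi_next hs, lo_eq_hi hs, sw_hi]; grind)
      have z2 := h.UB_p_zero (q := q) (χ := χ) (s := s) (r := r) (i := sw r i) hA
        (by rw [sw_lo_prev hs, sw_hi_prev hs, sw_lo, sw_hi_next hs]; grind)
      have e5 := h.sw_UB (q := q) (χ := χ) hA h0 h1
      have e6 := h.aff_E (cD q χ (-(i (hi r) - i (lo r)))) (lo r) (sw r i)
      have e7 := h.E_aff_hi hA (cD q χ (i (hi r) - i (lo r) + 1)) (r := r) (i := sw r i)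
        (by simp; grind)
      have e8 := hχ.cD_mul (A := A) (t := -y (lo r)) (by rw [neg_mul_neg, h.y_sq hA]) hd0 hd1
      rw [neg_neg] at e8
      rw [lo_eq_hi hs] at e4
      generalize i (hi r) - i (lo r) = d at *
      generalize aff (cD q χ (-d)) (y (lo r)) = D at *
      generalize aff (cD q χ (d + 1)) (y (hi r)) = D1 at *
      generalize aff (cD q χ (d + 1)) (-y (lo r)) = D2 at *
      generalize UB q χ E y p r = U at *
      generalize UB q χ E y p s = V at *
      generalize p r = R at *
      generalize p s = S at *
      generalize E (sw r i) = F at *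
      generalize E i = W at *
      linear_combination (norm := noncomm_ring) U * V * e1 + U * z1 * U * W + U * e4 * U * W +
        z2 * D1 * U * W + e2 * D1 * U * W - (R + 1) * e6 * D1 * U * W +
        (R + 1) * D * e7 * U * W + (R + 1) * e6 * D2 * U * W + (R + 1) * F * e8 * U * W + e5
  by_cases h0 : i (hi r) = i (lo r)
  · have e1 := h.UB_eq (q := q) (χ := χ) h0
    have e2 := h.UB_succ (q := q) (χ := χ) (r := s) (i := i) hA (by rw [lo_eq_hi hs]; grind)
    rw [sw_eq_self h0] at e3
    have z2 := h.UB_p_zero (q := q) (χ := χ) (s := s) (r := r) (i := i) hA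
        (by rw [sw_lo_prev hs, sw_hi_prev hs]; grind)
    have e4 := h.pp_succ (r := s) (i := i) hA (by rw [lo_eq_hi hs]; grind)
    have e5 := h.E_aff_hi hA (ch q) (r := r) (i := i) (by grind)
    have e6 := hχ.ch_mul_cg hA.one (h.y_sq hA (lo r))
    have e7 := h.psiy_next hs
    have e8 := h.pp_eq h0
    have e9 := h.y_hi_p_eq h0
    have e10 := h.ye (lo r) i
    have e11 := h.ye (hi r) i
    have e12 := h.ye (hi s) i
    have e13 := aff_mul_of_comm (cg q) (h.yy (lo r) (hi r))
    have e14 := aff_mul_of_comm (cg q) (h.yy (lo r) (hi s))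
    have e15 := aff_mul_of_comm (ch q) (t := y (hi r)) (t' := y (hi r))
      (aff_mul_of_comm (cg q) (h.yy (lo r) (hi r))).symm
    rw [lo_eq_hi hs] at e2 e4
    generalize aff (cg q) (y (lo r)) = G at *
    generalize aff (ch q) (y (hi r)) = H at *
    generalize aff (ch q) (-y (lo r)) = H' at *
    generalize UB q χ E y p r = U at *
    generalize UB q χ E y p s = V at *
    generalize p r = R at *
    generalize p s = S at *
    generalize E i = W at *
    generalize y (lo r) = Y at *
    generalize y (hi r) = Y1 at *
    generalize y (hi s) = Y2 at *
    have k1 : U * V * W = -(R * (Y2 - Y1) * W) := by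
      linear_combination (norm := noncomm_ring) U * e2 + U * e4 * H + z2 * H +
        U * (e12 - e11) * H + e1 * (Y2 - Y1) * H + R * W * (e14 - e13) * H -
        R * W * (Y2 - Y1) * e15 - R * (e12 - e11) * H * G + R * (Y2 - Y1) * e5 * G +
        R * (Y2 - Y1) * W * e6
    linear_combination (norm := noncomm_ring) U * V * e1 + U * V * e3 * G + k1 * R * G +
      R * (Y2 - Y1) * e3 * G - e7 * R * W * G - Y2 * e8 * G + R * e9 * G + R * R * e10 * G +
      e8 * Y * G - e1
  have z1 := h.UB_zero (q := q) (χ := χ) hA (r := s) (i := sw r i)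
    (by rw [sw_hi_next hs, lo_eq_hi hs, sw_hi]; grind)
  by_cases h1 : i (hi r) = i (lo r) + 1
  · have e1 := h.UB_succ (q := q) (χ := χ) hA h1
    have e2 := h.UB_eq (q := q) (χ := χ) (r := s) (i := i) (by rw [lo_eq_hi hs]; grind)
    have e4 := h.psie s i
    rw [sw_eq_self (i := i) (by rw [lo_eq_hi hs]; grind)] at e4
    have e5 := h.psie r (sw r i)
    rw [sw_sw] at e5
    have e6 := h.word_rsr hA hχ hs (i := sw r i) (by simp; grind)
      (by rw [sw_hi_next hs, sw_lo]; grind) (by simp; grind)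
    have e7 := h.aff_E (ch q) (lo r) i
    have e8 := h.aff_E (cg q) (lo s) i
    generalize aff (cg q) (y (lo s)) = G at *
    generalize aff (ch q) (y (lo r)) = H at *
    generalize UB q χ E y p r = U at *
    generalize UB q χ E y p s = V at *
    generalize p r = R at *
    generalize p s = S at *
    generalize E (sw r i) = F at *
    generalize E i = W at *
    linear_combination (norm := noncomm_ring) U * V * e1 + U * V * (e3 + R * e3 + e5 * R) * H +
      U * (z1 * R + e2 * R * R + e4 * G * R * R) * H + e1 * S * G * R * R * H -
      (R + 1) * R * (e7 * S * G * R + H * e4 * G * R + H * S * e8 * R + H * S * G * e5) * R * H +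
      (R + 1) * e6 * R * H - (R + 1) * e3 * H - e1
  · have e1 := h.UB_split (q := q) (χ := χ) hA h0
    have e2 := h.UB_diag (q := q) (χ := χ) h0 h1 rfl
    have e4 := h.UB_gen (q := q) (χ := χ) (r := s) (i := i)
      (d := -(i (hi r) - i (lo r) - 1)) (by rw [lo_eq_hi hs]; grind) (by rw [lo_eq_hi hs]; grind)
      (by rw [lo_eq_hi hs]; grind)
    have z2 := h.UB_p_zero (q := q) (χ := χ) (s := s) (r := r) (i := i) hA
      (by rw [sw_lo_prev hs, sw_hi_prev hs]; grind)
    have e7 := h.E_aff_hi hA (cD q χ (-(i (hi r) - i (lo r) - 1))) h1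
    have e8 := hχ.cD_mul (A := A) (d := i (hi r) - i (lo r) - 1) (h.y_sq hA (lo r)) (by grind)
      (by grind)
    rw [lo_eq_hi hs] at e4
    rw [sub_add_cancel] at e8
    linear_combination (norm := noncomm_ring) UB q χ E y p r * UB q χ E y p s * e1 +
      UB q χ E y p r * (z1 * UB q χ E y p r * E i + UB q χ E y p s * e2 +
        e4 * aff (cD q χ (i (hi r) - i (lo r))) (y (lo r))) +
      (z2 * aff (cD q χ (-(i (hi r) - i (lo r) - 1))) (y (hi r)) + UB q χ E y p r * e7) *
        aff (cD q χ (i (hi r) - i (lo r))) (y (lo r)) + UB q χ E y p r * E i * e8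

end IsKLR

namespace IsKLR

variable {A : Type*} [Ring A] [Algebra ℂ A]
variable {l n : ℕ} [NeZero l] {κ : ZMod l} {E : Res l n → A} {y : Fin n → A}
  {p : Fin (n - 1) → A} {q : ℂ} {χ : AddChar (ZMod l) ℂ}

variable (h : IsKLR κ E y p) {r s : Fin (n - 1)} {i : Res l n}
include h

lemma UB_srs (hA : IsAdm κ) (hχ : IsChar q χ) (hs : s.val = r.val + 1) :
    UB q χ E y p s * UB q χ E y p r * UB q χ E y p s * E i = UB q χ E y p s * E i := by
  obtain ⟨u, v, w, hu, hv, hw, hu', hv', hw'⟩ := hA.consts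
  have hsr : (s.val : ZMod l) = r.val + 1 := by rw [hs, Nat.cast_succ]
  by_cases hbc : i (hi r) + i (hi s) = (s.val : ZMod l)
  swap
  · rw [mul_assoc, h.UB_zero hA (by rwa [lo_eq_hi hs]), mul_zero]
  by_cases hE : i (hi r) ≠ i (lo r) + 1 ∧ i (lo r) + i (hi r) ≠ (r.val : ZMod l)
  · rw [h.idem_zero hA hE.1 hE.2, mul_zero, mul_zero]
  have e3 := h.psie s i
  by_cases hb : i (hi r) = i (lo r) + 1
  swap
  · have hc : i (hi s) = i (lo r) + 1 := by grind
    have z2 := h.UB_p_zero (q := q) (χ := χ) (s := s) (r := r) (i := i) hA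
      (by rw [sw_lo_prev hs, sw_hi_prev hs]; grind)
    by_cases h0 : i (hi r) = i (lo r)
    · have e1 := h.UB_succ (q := q) (χ := χ) (r := s) (i := i) hA (by rw [lo_eq_hi hs]; grind)
      have e2 := h.UB_eq (q := q) (χ := χ) h0
      have e4 := h.psie r i
      rw [sw_eq_self h0] at e4
      have e5 := h.psie s (sw s i)
      rw [sw_sw] at e5
      have e6 := h.word_srs hA hχ hs (i := sw s i)
        (by rw [sw_lo_prev hs, sw_hi_prev hs]; grind)
        (by rw [sw_hi, sw_lo_prev hs, lo_eq_hi hs]; grind) (by rw [sw_lo_prev hs]; grind)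
      have e7 := h.aff_E (ch q) (lo s) i
      have e8 := h.aff_E (cg q) (lo r) i
      generalize aff (cg q) (y (lo r)) = G at *
      generalize aff (ch q) (y (lo s)) = H at *
      generalize UB q χ E y p r = U at *
      generalize UB q χ E y p s = V at *
      generalize p r = R at *
      generalize p s = S at *
      generalize E (sw s i) = F at *
      generalize E i = W at *
      linear_combination (norm := noncomm_ring) V * U * e1 + V * z2 * H +
        V * U * (S * e3 + e5 * S) * H + V * e2 * S * S * H + V * e4 * G * S * S * H +
        e1 * R * G * S * S * H - (S + 1) * S * e7 * R * G * S * S * H -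
        (S + 1) * S * H * (e4 * G * S + R * e8 * S + R * G * e5) * S * H + (S + 1) * e6 * S * H -
        (S + 1) * e3 * H - e1
    · have e1 := h.UB_gen (q := q) (χ := χ) (r := s) (i := i)
        (d := i (lo r) - i (hi r) + 1) (by rw [lo_eq_hi hs]; grind)
        (by rw [lo_eq_hi hs]; grind) (by rw [lo_eq_hi hs]; grind)
      have e2 := h.UB_split (q := q) (χ := χ) hA h0
      have e4 := h.UB_diag (q := q) (χ := χ) (d := -(i (lo r) - i (hi r))) h0 hb (by grind)
      have z1 := h.UB_zero (q := q) (χ := χ) hA (r := s) (i := sw r i)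
        (by rw [sw_hi_next hs, lo_eq_hi hs, sw_hi]; grind)
      have e7 := h.E_aff_hi hA (cD q χ (i (lo r) - i (hi r) + 1)) hb
      have e8 := hχ.cD_mul (A := A) (d := i (lo r) - i (hi r)) (t := -y (lo r))
        (by rw [neg_mul_neg, h.y_sq hA]) (by grind) (by grind)
      rw [neg_neg] at e8
      rw [lo_eq_hi hs] at e1
      generalize i (lo r) - i (hi r) = d at *
      generalize aff (cD q χ (-d)) (y (lo r)) = D at *
      generalize aff (cD q χ (d + 1)) (y (hi r)) = D1 at *
      generalize aff (cD q χ (d + 1)) (-y (lo r)) = D2 at *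
      generalize UB q χ E y p r = U at *
      generalize UB q χ E y p s = V at *
      generalize p r = R at *
      generalize p s = S at *
      generalize E (sw r i) = F at *
      generalize E i = W at *
      linear_combination (norm := noncomm_ring) V * U * e1 + V * z2 * D1 + V * U * e7 +
        V * e2 * D2 + z1 * U * W * D2 + V * e4 * D2 + V * W * e8
  by_cases hab : i (lo r) + i (hi r) = (r.val : ZMod l)
  · have hc : i (hi s) = i (hi r) := by grind
    have e1 := h.UB_eq (q := q) (χ := χ) (r := s) (i := i) (by rw [lo_eq_hi hs, hc])
    rw [sw_eq_self (by rw [lo_eq_hi hs, hc])] at e3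
    have e2 := h.UB_succ (q := q) (χ := χ) hA hb
    have z2 := h.UB_p_zero (q := q) (χ := χ) (s := r) (r := s) (i := i) hA
      (by rw [sw_hi_next hs, lo_eq_hi hs, sw_hi]; grind)
    have e4 := h.pp_succ hA hb
    have e6 := hχ.ch_mul_cg hA.one (h.y_sq hA (hi r))
    have e8 := h.pp_eq (r := s) (i := i) (by rw [lo_eq_hi hs, hc])
    have e9 := h.y_lo_p_eq (r := s) (i := i) (by rw [lo_eq_hi hs, hc])
    have e10 := h.ye (lo r) i
    have e11 := h.ye (hi r) i
    have e12 := h.psiy_prev hs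
    have e13 := h.ye (hi s) i
    have eA : (y (hi r) - y (lo r)) * aff (ch q) (y (lo r)) =
        aff (ch q) (-y (hi r)) * (y (hi r) - y (lo r)) := by
      have c1 := Algebra.commutes (ch q).1 (y (hi r) - y (lo r))
      have c2 := Algebra.commutes (ch q).2 (y (hi r) - y (lo r))
      have y1 := h.y_sq hA (lo r)
      have y2 := h.y_sq hA (hi r)
      unfold aff
      linear_combination (norm := noncomm_ring) -c1 - c2 * y (lo r) -
        algebraMap ℂ A (ch q).2 * (y1 - y2)
    have eB : aff (cg q) (y (hi r)) * aff (ch q) (-y (hi r)) = -1 := by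
      rw [← e6]
      exact aff_mul_of_comm _ (aff_mul_of_comm _ (by noncomm_ring)).symm
    rw [lo_eq_hi hs] at e1 e9
    generalize aff (cg q) (y (hi r)) = G at *
    generalize aff (ch q) (y (lo r)) = H at *
    generalize aff (ch q) (-y (hi r)) = H' at *
    generalize UB q χ E y p r = U at *
    generalize UB q χ E y p s = V at *
    generalize p r = R at *
    generalize p s = S at *
    generalize E i = W at *
    generalize y (lo r) = Y at *
    generalize y (hi r) = Y1 at *
    generalize y (hi s) = Y2 at *
    have k1 : V * U * W = -(S * W * (Y1 - Y)) := by
      linear_combination (norm := noncomm_ring) V * e2 + V * e4 * H + z2 * H +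
        V * (e11 - e10) * H + e1 * (Y1 - Y) * H + S * W * G * eA + S * W * eB * (Y1 - Y)
    linear_combination (norm := noncomm_ring) V * U * e1 + V * U * e3 * G + k1 * S * G +
      S * (e11 - e10) * S * G + S * (Y1 - Y) * e3 * G - S * e9 * G - S * S * e13 * G -
      e8 * Y2 * G - S * e12 * W * G + S * S * e10 * G + e8 * Y * G - e1
  have z1 := h.UB_zero (q := q) (χ := χ) hA hab
  by_cases h0 : i (hi s) = i (lo r)
  · have e1 := h.UB_gen (q := q) (χ := χ) (r := s) (i := i) (d := -1) (by rw [lo_eq_hi hs]; grind)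
      (by rw [lo_eq_hi hs]; grind) (by rw [lo_eq_hi hs]; grind)
    have e2 := h.UB_eq (q := q) (χ := χ) (r := r) (i := sw s i)
      (by rw [sw_lo_prev hs, sw_hi_prev hs]; grind)
    have e4 := h.psie r (sw s i)
    rw [sw_eq_self (i := sw s i) (by rw [sw_lo_prev hs, sw_hi_prev hs]; grind)] at e4
    have e5 := h.UB_succ (q := q) (χ := χ) (r := s) (i := sw s i) hA
      (by rw [sw_hi, sw_lo, lo_eq_hi hs]; grind)
    have e6 := h.word_srs hA hχ hs hb h0 (by grind)
    have e7 := h.aff_E (ch q) (lo s) (sw s i)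
    have e8 := h.aff_E (cg q) (lo r) (sw s i)
    generalize aff (cg q) (y (lo r)) = G at *
    generalize aff (ch q) (y (lo s)) = H at *
    generalize aff (cD q χ (-1)) (y (lo s)) = D at *
    generalize UB q χ E y p r = U at *
    generalize UB q χ E y p s = V at *
    generalize p r = R at *
    generalize p s = S at *
    generalize E (sw s i) = F at *
    generalize E i = W at *
    linear_combination (norm := noncomm_ring) V * U * e1 + V * z1 * D + V * U * e3 * D +
      V * e2 * S * D + V * e4 * G * S * D + e5 * R * G * S * D - (S + 1) * S * e7 * R * G * S * D -
      (S + 1) * S * H * (e4 * G * S + R * e8 * S + R * G * e3) * D + (S + 1) * e6 * D - e1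
  · have hbc' : i (hi s) ≠ i (lo s) := by rw [lo_eq_hi hs]; grind
    have e1 := h.UB_split (q := q) (χ := χ) (r := s) hA hbc'
    have e2 := h.UB_gen (q := q) (χ := χ) (r := r) (i := sw s i)
      (d := i (hi s) - i (lo r) - 1 + 1)
      (by rw [sw_lo_prev hs, sw_hi_prev hs]; grind)
      (by rw [sw_lo_prev hs, sw_hi_prev hs]; grind)
      (by rw [sw_lo_prev hs, sw_hi_prev hs]; grind)
    have z2 := h.UB_p_zero (q := q) (χ := χ) (s := r) (r := s) (i := sw s i) hA
      (by rw [sw_hi_next hs, lo_eq_hi hs, sw_hi, sw_hi, sw_lo_prev hs, lo_eq_hi hs]; grind)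
    have e4 := h.UB_gen (q := q) (χ := χ) (r := s) (i := sw s i)
      (d := -(i (hi s) - i (lo r) - 1))
      (by rw [sw_hi, sw_lo, lo_eq_hi hs]; grind) (by rw [sw_hi, sw_lo, lo_eq_hi hs]; grind)
      (by rw [sw_hi, sw_lo, lo_eq_hi hs]; grind)
    have e7 := h.E_aff_hi hA (cD q χ (-(i (hi s) - i (lo r) - 1))) (r := r) (i := sw s i)
      (by rw [sw_lo_prev hs, sw_hi_prev hs]; grind)
    have e8 := hχ.cD_mul (A := A) (d := i (hi s) - i (lo r) - 1) (h.y_sq hA (lo r)) (by grind)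
      (by grind)
    have e5 := h.sw_UB (q := q) (χ := χ) hA hbc' (by rw [lo_eq_hi hs]; grind)
    rw [lo_eq_hi hs] at e4
    generalize i (hi s) - i (lo r) - 1 = d at *
    generalize aff (cD q χ (d + 1)) (y (lo r)) = D at *
    generalize aff (cD q χ (-d)) (y (hi r)) = D1 at *
    generalize aff (cD q χ (-d)) (-y (lo r)) = D2 at *
    generalize UB q χ E y p r = U at *
    generalize UB q χ E y p s = V at *
    generalize p r = R at *
    generalize p s = S at *
    generalize E (sw s i) = F at *
    generalize E i = W at *
    linear_combination (norm := noncomm_ring) V * U * e1 + V * z1 * V * W + V * e2 * V * W +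
      z2 * D * V * W + e4 * D * V * W + (S + 1) * e7 * D * V * W + (S + 1) * F * e8 * V * W + e5

end IsKLR

section

variable {A : Type*} [Ring A] [Algebra ℂ A]

lemma Commute.aff {t x : A} (c : ℂ × ℂ) (h : Commute t x) : Commute (aff c t) x :=
  aff_mul_of_comm c h

lemma Commute.uC {l : ℕ} {t t' x : A} (q : ℂ) (χ : AddChar (ZMod l) ℂ) (d : ZMod l)
    (h : Commute t x) (h' : Commute t' x) : Commute (uC q χ d t t') x := by
  unfold Statement0.uC
  split_ifs
  · exact Commute.zero_left x
  · exact (h'.sub_left h).mul_left (Commute.aff _ h)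
  · exact Commute.aff _ h

/-- The image of the Jucys–Murphy element at position `r`. -/
def XB {l n : ℕ} [NeZero l] (χ : AddChar (ZMod l) ℂ) (E : Res l n → A) (y : Fin n → A)
    (r : Fin n) : A :=
  ∑ i : Res l n, (algebraMap ℂ A (χ (i r)) * (1 + y r)) * E i

end

namespace IsKLR

variable {A : Type*} [Ring A] [Algebra ℂ A]
variable {l n : ℕ} [NeZero l] {κ : ZMod l} {E : Res l n → A} {y : Fin n → A}
  {p : Fin (n - 1) → A} {q : ℂ} {χ : AddChar (ZMod l) ℂ}

variable (h : IsKLR κ E y p) {r s : Fin (n - 1)} {i : Res l n}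
include h

lemma UB_UB_E (ht : r.val + 1 < s.val ∨ s.val + 1 < r.val) (i : Res l n) :
    UB q χ E y p r * UB q χ E y p s * E i =
      (p r * aff (cG q χ (i (hi r) - i (lo r))) (y (lo r)) +
        uC q χ (i (hi r) - i (lo r)) (y (lo r)) (y (hi r))) *
      (p s * aff (cG q χ (i (hi s) - i (lo s))) (y (lo s)) +
        uC q χ (i (hi s) - i (lo s)) (y (lo s)) (y (hi s))) * E i := by
  have e1 := h.UB_E (q := q) (χ := χ) s i
  have e2 := h.UB_E (q := q) (χ := χ) r i
  have e3 := h.UB_E (q := q) (χ := χ) r (sw s i)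
  rw [sw_lo_of_far ht, sw_hi_of_far ht] at e3
  have c1 : Commute (aff (cG q χ (i (hi s) - i (lo s))) (y (lo s))) (E i) :=
    Commute.aff _ (h.ye _ _)
  have c2 : Commute (uC q χ (i (hi s) - i (lo s)) (y (lo s)) (y (hi s))) (E i) :=
    Commute.uC _ _ _ (h.ye _ _) (h.ye _ _)
  have c3 := h.psie s i
  have c1 := c1.eq
  have c2 := c2.eq
  generalize aff (cG q χ (i (hi s) - i (lo s))) (y (lo s)) = G at *
  generalize uC q χ (i (hi s) - i (lo s)) (y (lo s)) (y (hi s)) = C at *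
  generalize p r * aff (cG q χ (i (hi r) - i (lo r))) (y (lo r)) +
        uC q χ (i (hi r) - i (lo r)) (y (lo r)) (y (hi r)) = M at *
  generalize UB q χ E y p r = U at *
  generalize UB q χ E y p s = V at *
  linear_combination (norm := noncomm_ring) U * e1 + U * p s * c1 + U * c2 + U * c3 * G +
    e3 * p s * G + e2 * C - M * c3 * G - M * p s * c1 - M * c2

lemma UB_comm (ht : r.val + 1 < s.val ∨ s.val + 1 < r.val) :
    UB q χ E y p r * UB q χ E y p s = UB q χ E y p s * UB q χ E y p r := by
  refine h.ext_E fun i => ?_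
  rw [h.UB_UB_E ht, h.UB_UB_E ht.symm]
  congr 1
  have c1 : Commute (p r) (p s) := h.pp r s ht
  have hy : ∀ a b, Commute (y a) (y b) := h.yy
  have c3 : Commute (y (lo r)) (p s) :=
    (h.psiy s (lo r) (by simp [lo]; omega) (by simp [lo]; omega)).symm
  have c4 : Commute (y (hi r)) (p s) :=
    (h.psiy s (hi r) (by simp [hi]; omega) (by simp [hi]; omega)).symm
  have c5 : Commute (y (lo s)) (p r) :=
    (h.psiy r (lo s) (by simp [lo]; omega) (by simp [lo]; omega)).symm
  have c6 : Commute (y (hi s)) (p r) :=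
    (h.psiy r (hi s) (by simp [hi]; omega) (by simp [hi]; omega)).symm
  have c7 : ∀ c a b, Commute (aff c (y a)) (y b) := fun c a b => Commute.aff c (hy a b)
  have c8 : ∀ d a a' b, Commute (uC q χ d (y a) (y a')) (y b) := fun d a a' b =>
    Commute.uC _ _ _ (hy a b) (hy a' b)
  have k1 := Commute.aff (cG q χ (i (hi r) - i (lo r))) c3
  have k2 := Commute.aff (cG q χ (i (hi s) - i (lo s))) c5
  have k3 := Commute.uC q χ (i (hi r) - i (lo r)) c3 c4
  have k4 := Commute.uC q χ (i (hi s) - i (lo s)) c5 c6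
  refine Commute.add_left (Commute.add_right ?_ ?_) (Commute.add_right ?_ ?_)
  · exact Commute.mul_left (Commute.mul_right c1 k2.symm)
      (Commute.mul_right k1 (Commute.aff _ (c7 _ _ _).symm))
  · exact Commute.mul_left k4.symm (Commute.aff _ (c8 _ _ _ _).symm)
  · exact Commute.mul_right k3 (Commute.uC _ _ _ (c7 _ _ _).symm (c7 _ _ _).symm)
  · exact Commute.uC _ _ _ (c8 _ _ _ _).symm (c8 _ _ _ _).symm

lemma XB_E (r : Fin n) (i : Res l n) :
    XB χ E y r * E i = algebraMap ℂ A (χ (i r)) * (1 + y r) * E i :=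
  h.sum_mul_E (fun i => algebraMap ℂ A (χ (i r)) * (1 + y r)) i

lemma UB_XB (hA : IsAdm κ) (hχ : IsChar q χ) (r : Fin (n - 1)) :
    (UB q χ E y p r + algebraMap ℂ A q) * XB χ E y (lo r) =
      XB χ E y (hi r) * (UB q χ E y p r + algebraMap ℂ A q⁻¹) := by
  refine h.ext_E fun i => ?_
  have k1 := h.XB_E (χ := χ) (lo r) i
  have k2 := h.XB_E (χ := χ) (hi r) i
  have k3 := h.XB_E (χ := χ) (hi r) (sw r i)
  rw [mul_assoc, Algebra.commutes] at k1 k2 k3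
  rw [sw_hi] at k3
  have hx := Algebra.commutes (A := A) (χ (i (lo r)))
  have hQ := Algebra.commutes (A := A) q
  have hq := Algebra.commutes (A := A) q⁻¹
  have e3 := h.psie r i
  have y1 := h.ye (lo r) i
  have y2 := h.ye (hi r) i
  have hzx : algebraMap ℂ A (χ (i (hi r))) = algebraMap ℂ A (χ (i (hi r) - i (lo r))) *
      algebraMap ℂ A (χ (i (lo r))) := by
    rw [← map_mul, ← AddChar.map_add_eq_mul, sub_add_cancel]
  by_cases h0 : i (hi r) = i (lo r)
  · have e1 := h.UB_eq (q := q) (χ := χ) h0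
    have e4 := h.y_hi_p_eq h0
    have e5 := h.y_neg hA (i := i) (r := r) (by have := hA.one; grind)
    have eG := (Commute.aff (cg q) (Commute.refl (y (lo r)))).eq
    have e6 : aff (cg q) (y (lo r)) = algebraMap ℂ A q * (1 + y (lo r)) -
        algebraMap ℂ A q⁻¹ * (1 - y (lo r)) := by
      simp only [aff, cg, map_sub, map_add]
      noncomm_ring
    rw [h0] at k2
    rw [sw_eq_self h0] at e3
    generalize aff (cg q) (y (lo r)) = G at *
    generalize algebraMap ℂ A q = Q at *
    generalize algebraMap ℂ A q⁻¹ = Q' at *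
    generalize algebraMap ℂ A (χ (i (lo r))) = x at *
    generalize UB q χ E y p r = U at *
    generalize XB χ E y (lo r) = X at *
    generalize XB χ E y (hi r) = X' at *
    generalize p r = P at *
    generalize E i = W at *
    generalize y (lo r) = Y at *
    generalize y (hi r) = Y' at *
    linear_combination (norm := noncomm_ring) (U + Q) * k1 + (U + Q) * y1 * x + e1 * (1 + Y) * x -
      X' * e1 - X' * e3 * G - k2 * P * G - (1 + Y') * W * hx (P * G) + (1 + Y') * e3 * G * x -
      e4 * G * x - P * y1 * G * x + P * W * eG * x + hq X' * W - Q' * k2 - Q' * e5 * x - W * e6 * x + hQ W * (1 + Y) * x - hq W * (1 - Y) * x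
      + Q' * y1 * x
  by_cases h1 : i (hi r) = i (lo r) + 1
  · have e1 := h.UB_succ (q := q) (χ := χ) hA h1
    have e4 := h.y_hi_p h0
    have e5 := h.pp_succ hA h1
    have eG := (Commute.aff (ch q) (Commute.refl (y (lo r)))).eq
    have hy := h.y_sq hA (lo r)
    have hy' := h.y_sq hA (hi r)
    have q0 := hχ.q0
    have hδ := hχ.delta_ne hA.one
    have eK : (y (hi r) - y (lo r)) * aff (ch q) (y (lo r)) * (1 + y (lo r)) +
        algebraMap ℂ A q * (1 + y (lo r)) =
        (1 + y (hi r)) * algebraMap ℂ A (q ^ 2) * (y (hi r) - y (lo r)) * aff (ch q) (y (lo r)) +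
        algebraMap ℂ A q⁻¹ * (1 + y (hi r)) * algebraMap ℂ A (q ^ 2) := by
      simp only [aff, ch, Algebra.algebraMap_eq_smul_one, mul_add, add_mul, mul_sub, sub_mul,
        smul_mul_assoc, mul_smul_comm, one_mul, mul_one, mul_assoc, hy, hy', mul_zero, smul_zero, add_zero, sub_zero]
      match_scalars <;> (generalize hδ' : q - q⁻¹ = δ at *; field_simp at hδ'; field_simp; try first | linear_combination hδ' | linear_combination -hδ' | linear_combination (1 + q ^ 2) * hδ')
    rw [hzx, h1, add_sub_cancel_left, hχ.one] at k2
    generalize aff (ch q) (y (lo r)) = H at *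
    generalize algebraMap ℂ A q = Q at *
    generalize algebraMap ℂ A q⁻¹ = Q' at *
    generalize algebraMap ℂ A (q ^ 2) = g at *
    generalize algebraMap ℂ A (χ (i (lo r))) = x at *
    generalize UB q χ E y p r = U at *
    generalize XB χ E y (lo r) = X at *
    generalize XB χ E y (hi r) = X' at *
    generalize p r = P at *
    generalize E (sw r i) = F at *
    generalize E i = W at *
    generalize y (lo r) = Y at *
    generalize y (hi r) = Y' at *
    linear_combination (norm := noncomm_ring) (U + Q) * k1 + (U + Q) * y1 * x + e1 * (1 + Y) * x +
      e5 * H * (1 + Y) * x + (y2 - y1) * H * (1 + Y) * x + hQ W * (1 + Y) * x + W * eK * x -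
      X' * e1 - X' * e5 * H - X' * (y2 - y1) * H - k2 * (Y' - Y) * H - (1 + Y') * W * g * hx ((Y' - Y) * H) - y2 * g * (Y' - Y) * H * x - X' * e3 * H - k3 * P * H -
      (1 + Y') * F * hx (P * H) + (1 + Y') * e3 * H * x - e4 * H * x - P * y1 * H * x + P * W * eG * x +
      hq X' * W - Q' * k2 - Q' * y2 * g * x - hq W * (1 + Y') * g * x
  · have e1 := h.UB_gen (q := q) (χ := χ) h0 h1 rfl
    have hd := hχ.ne_one (sub_ne_zero.2 h0)
    have e4 := h.y_hi_p h0
    have e5 := h.y_neg hA h1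
    have hy := h.y_sq hA (lo r)
    have eG := (Commute.aff (cD q χ (i (hi r) - i (lo r))) (Commute.refl (y (lo r)))).eq
    rw [hzx] at k2
    generalize i (hi r) - i (lo r) = d at *
    have eK : (aff (cD q χ d) (y (lo r)) + algebraMap ℂ A q) * (1 + y (lo r)) =
        (1 - y (lo r)) * algebraMap ℂ A (χ d) * aff (cD q χ d) (y (lo r)) +
        algebraMap ℂ A q⁻¹ * (1 - y (lo r)) * algebraMap ℂ A (χ d) := by
      simp only [aff, cD, Algebra.algebraMap_eq_smul_one, mul_add, add_mul, mul_sub, sub_mul,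
        smul_mul_assoc, mul_smul_comm, one_mul, mul_one, mul_assoc, hy, smul_zero, add_zero, sub_zero]
      have q0 := hχ.q0
      generalize χ d = z at *
      match_scalars <;> (field_simp; try ring)
    generalize aff (cD q χ d) (y (lo r)) = D at *
    generalize algebraMap ℂ A q = Q at *
    generalize algebraMap ℂ A q⁻¹ = Q' at *
    generalize algebraMap ℂ A (χ d) = g at *
    generalize algebraMap ℂ A (χ (i (lo r))) = x at *
    generalize UB q χ E y p r = U at *
    generalize XB χ E y (lo r) = X at *
    generalize XB χ E y (hi r) = X' at *
    generalize p r = P at *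
    generalize E (sw r i) = F at *
    generalize E i = W at *
    generalize y (lo r) = Y at *
    generalize y (hi r) = Y' at *
    linear_combination (norm := noncomm_ring) (U + Q) * k1 + (U + Q) * y1 * x + e1 * (1 + Y) * x +
      hQ W * (1 + Y) * x + W * eK * x - X' * e1 - X' * e3 * D - k3 * P * D - (1 + Y') * F * hx (P * D) + (1 + Y') * e3 * D * x - e4 * D * x - P * y1 * D * x + P * W * eG * x - k2 * D - (1 + Y') * W * g * hx D -
      e5 * g * D * x + y1 * g * D * x + hq X' * W - Q' * k2 - Q' * e5 * g * x + Q' * y1 * g * x - hq W * (1 - Y) * g * x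

end IsKLR

/-- The Jucys–Murphy elements of the blob algebra; `α` and `β` are the eigenvalues of the first
one. -/
def XJ {A : Type*} [Ring A] [Algebra ℂ A] {n : ℕ} (q α β : ℂ) (e : A) (U : Fin (n - 1) → A) :
    ℕ → A
  | 0 => algebraMap ℂ A α * e + algebraMap ℂ A β * (1 - e)
  | r + 1 => if hr : r < n - 1 then
      (U ⟨r, hr⟩ + algebraMap ℂ A q) * XJ q α β e U r * (U ⟨r, hr⟩ + algebraMap ℂ A q) else 0

namespace IsKLR

variable {A : Type*} [Ring A] [Algebra ℂ A]
variable {l n : ℕ} [NeZero l] {κ : ZMod l} {E : Res l n → A} {y : Fin n → A}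
  {p : Fin (n - 1) → A} {q : ℂ} {χ : AddChar (ZMod l) ℂ} {m : ℤ}

variable (h : IsKLR κ E y p) {r s : Fin (n - 1)} {i : Res l n}
include h

omit [Algebra ℂ A] in
lemma eB_E (hn : 0 < n) (i : Res l n) :
    eB κ hn E * E i = if i ⟨0, hn⟩ = -κ then E i else 0 := by
  have := h.sum_mul_E (fun i => if i ⟨0, hn⟩ = -κ then (1 : A) else 0) i
  simpa [eB] using this

omit [Algebra ℂ A] in
lemma eB_sq (hn : 0 < n) : eB κ hn E * eB κ hn E = eB κ hn E := by
  refine h.ext_E fun i => ?_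
  rw [mul_assoc, h.eB_E]
  split_ifs with h0
  · rw [h.eB_E, if_pos h0]
  · rw [mul_zero]

lemma UB_E_expand (r : Fin (n - 1)) (i : Res l n) : UB q χ E y p r * E i =
    E (sw r i) * p r * aff (cG q χ (i (hi r) - i (lo r))) (y (lo r)) +
      E i * uC q χ (i (hi r) - i (lo r)) (y (lo r)) (y (hi r)) := by
  have c1 : Commute (aff (cG q χ (i (hi r) - i (lo r))) (y (lo r))) (E i) :=
    Commute.aff _ (h.ye _ _)
  have c2 : Commute (uC q χ (i (hi r) - i (lo r)) (y (lo r)) (y (hi r))) (E i) :=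
    Commute.uC _ _ _ (h.ye _ _) (h.ye _ _)
  rw [h.UB_E, ← h.psie, add_mul, mul_assoc, c1.eq, c2.eq, mul_assoc (p r) (E i)]

lemma UB_eB (hn : 0 < n) (hr : 1 ≤ r.val) :
    UB q χ E y p r * eB κ hn E = eB κ hn E * UB q χ E y p r := by
  refine h.ext_E fun i => ?_
  have e1 := h.UB_E_expand (q := q) (χ := χ) r i
  have e2 := h.eB_E hn i
  have e3 := h.eB_E hn (sw r i)
  rw [sw_of_ne i (by simp [lo, Fin.ext_iff]; omega) (by simp [hi, Fin.ext_iff])] at e3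
  rw [mul_assoc, mul_assoc, e2, e1]
  split_ifs at e2 e3 ⊢
  · rw [mul_add, ← mul_assoc, ← mul_assoc, ← mul_assoc, e2, e3, e1, mul_assoc]
  · rw [mul_add, ← mul_assoc, ← mul_assoc, ← mul_assoc, e2, e3]
    simp

lemma UB_eB_UB (hA : IsAdm κ) (hχ : IsChar q χ) (hm : χ κ = q ^ m) (hn : 0 < n)
    (hr : r.val = 0) :
    UB q χ E y p r * eB κ hn E * UB q χ E y p r =
      (-(gauss q (m - 1) / gauss q m)) • UB q χ E y p r := by
  obtain ⟨u, v, w, hu, hv, hw, hu', hv', hw'⟩ := hA.consts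
  refine h.ext_E fun i => ?_
  have hlo : (⟨0, hn⟩ : Fin n) = lo r := by simp [lo, hr]
  have m0 := hA.m0
  have m1 := hA.m1
  have mm1 := hA.mm1
  by_cases hab : i (lo r) + i (hi r) = (r.val : ZMod l)
  swap
  · rw [smul_mul_assoc, mul_assoc, h.UB_zero hA hab, mul_zero, smul_zero]
  rw [hr, Nat.cast_zero] at hab
  by_cases ha : i (lo r) ≠ κ ∧ i (lo r) ≠ -κ
  · rw [h.cyc1 i (lo r) hr ha.1 ha.2, mul_zero, mul_zero]
  have h0 : i (hi r) ≠ i (lo r) := by grind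
  have h1 : i (hi r) ≠ i (lo r) + 1 := by grind
  have h2 : i (hi r) ≠ i (lo r) - 1 := by grind
  have y0 : y (lo r) = 0 := h.y_zero hr
  have e1 := h.UB_gen (q := q) (χ := χ) h0 h1 rfl
  have e2 := h.UB_gen (q := q) (χ := χ) (r := r) (i := sw r i) (d := i (lo r) - i (hi r))
    (by simpa using h0.symm) (by simp; grind) (by simp)
  have e3 := h.psie r i
  have e4 := h.pp_far h0 h1 h2
  have e5 := h.eB_E hn i
  have e6 := h.eB_E hn (sw r i)
  rw [y0, aff_zero] at e1 e2
  have hc : (cD q χ (2 * κ)).1 = -(gauss q (m - 1) / gauss q m) := by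
    have q0 := hχ.q0
    have hd := hχ.ne_one m0
    have hδ := hχ.delta_ne hA.one
    simp only [cD, gauss, two_mul, AddChar.map_add_eq_mul, hm] at hd ⊢
    rw [div_div_div_cancel_right₀ hδ, zpow_neg, zpow_neg, zpow_sub_one₀ q0]
    have hz := zpow_ne_zero m q0
    generalize q ^ m = z at *
    have hd' : z ^ 2 - 1 ≠ 0 := fun H => hd (by linear_combination -H)
    have hd2 : 1 - z ^ 2 ≠ 0 := fun H => hd (by linear_combination H)
    have : z - z⁻¹ ≠ 0 := by
      intro H; field_simp at H; exact hd' (by linear_combination H)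
    field_simp
    ring
  rw [← hc, smul_mul_assoc, Algebra.smul_def, hlo] at *
  rw [sw_lo] at e6
  have hs := Algebra.commutes (A := A) (cD q χ (2 * κ)).1
  by_cases hk : i (lo r) = -κ
  · have hd : i (hi r) - i (lo r) = 2 * κ := by grind
    rw [if_pos hk] at e5
    rw [if_neg (by grind)] at e6
    rw [hd] at e1
    generalize algebraMap ℂ A (cD q χ (2 * κ)).1 = x at *
    generalize UB q χ E y p r = U at *
    linear_combination (norm := noncomm_ring) U * eB κ hn E * e1 + U * eB κ hn E * e3 * x +
      U * e6 * p r * x + U * e5 * x - hs (U * E i)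
  · have hd : i (lo r) - i (hi r) = 2 * κ := by grind
    rw [if_neg hk] at e5
    rw [if_pos (by grind)] at e6
    rw [hd] at e2
    have hs' := Algebra.commutes (A := A) (cD q χ (i (hi r) - i (lo r))).1
    generalize algebraMap ℂ A (cD q χ (2 * κ)).1 = x at *
    generalize algebraMap ℂ A (cD q χ (i (hi r) - i (lo r))).1 = x' at *
    generalize UB q χ E y p r = U at *
    linear_combination (norm := noncomm_ring) U * eB κ hn E * e1 + U * eB κ hn E * e3 * x' +
      U * e6 * p r * x' + U * e5 * x' + e2 * p r * x' + (p r + 1) * (E (sw r i) * hs (p r * x')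
      - e3 * x' * x) + e4 * x' * x - hs (U * E i) - e1 * x

lemma isBlob (hA : IsAdm κ) (hχ : IsChar q χ) (hm : χ κ = q ^ m) (hn : 0 < n) :
    IsBlob q m (eB κ hn E) (UB q χ E y p) where
  Usq := h.UB_sq hA hχ
  UUU r s hrs := by
    refine h.ext_E fun i => ?_
    rcases hrs with hrs | hrs
    · exact h.UB_rsr hA hχ hrs.symm
    · exact h.UB_srs hA hχ hrs.symm
  Ucomm r s hrs := h.UB_comm hrs
  UeU r hr := h.UB_eB_UB hA hχ hm hn hr
  ee := h.eB_sq hn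
  Ue r hr := h.UB_eB hn hr

lemma XJ_eq_XB (hA : IsAdm κ) (hχ : IsChar q χ) (hm : χ κ = q ^ m) (hn : 0 < n) (r : Fin n) :
    XJ q (q ^ (-m)) (q ^ m) (eB κ hn E) (UB q χ E y p) r = XB χ E y r := by
  obtain ⟨r, hr⟩ := r
  induction r with
  | zero =>
    refine h.ext_E fun i => ?_
    rw [h.XB_E, h.y_zero rfl, add_zero, mul_one, XJ]
    have e1 := h.eB_E hn i
    by_cases h0 : i ⟨0, hn⟩ = -κ
    · rw [if_pos h0] at e1
      rw [h0, IsChar.neg_eq, hm, ← zpow_neg, add_mul, mul_assoc, mul_assoc, sub_mul, e1]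
      simp
    · rw [if_neg h0] at e1
      by_cases h1 : i ⟨0, hn⟩ = κ
      · rw [h1, hm, add_mul, mul_assoc, mul_assoc, sub_mul, e1]
        simp
      · rw [h.cyc1 i ⟨0, hn⟩ rfl h1 h0, mul_zero, mul_zero]
  | succ r ih =>
    have hr' : r < n - 1 := by omega
    have e1 := h.UB_XB hA hχ ⟨r, hr'⟩
    have e2 := h.UB_sq hA hχ ⟨r, hr'⟩
    have e3 : XJ q (q ^ (-m)) (q ^ m) (eB κ hn E) (UB q χ E y p) r = XB χ E y (lo ⟨r, hr'⟩) :=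
      ih (by omega)
    rw [XJ, dif_pos hr', e3]
    change _ = XB χ E y (hi ⟨r, hr'⟩)
    rw [neg_smul, Algebra.smul_def, map_add] at e2
    have e4 : algebraMap ℂ A q⁻¹ * algebraMap ℂ A q = 1 := by
      rw [← map_mul, inv_mul_cancel₀ hχ.q0, map_one]
    have e5 := Algebra.commutes (A := A) q
    linear_combination (norm := noncomm_ring) e1 * (UB q χ E y p ⟨r, hr'⟩ + algebraMap ℂ A q) +
      XB χ E y (hi ⟨r, hr'⟩) * (e2 + e4 - e5 (UB q χ E y p ⟨r, hr'⟩))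

end IsKLR

section Words

variable {A : Type*} [Ring A]

lemma word_YZ {S T X : A} (h1 : T * S * T = S * T * S) (h2 : S * X = X * S) :
    T * X * T * (S * (T * X * T) * S) = T * S * (X * (T * X * T)) * (S * T) := by
  linear_combination (norm := noncomm_ring) T * X * h1 * X * T * S - T * h2 * T * S * X * T * S +
    T * S * X * T * h2 * T * S - T * S * X * T * X * h1

lemma word_ZY {S T X : A} (h1 : T * S * T = S * T * S) (h2 : S * X = X * S) :
    S * (T * X * T) * S * (T * X * T) = T * S * (T * X * T * X) * (S * T) := by
  linear_combination (norm := noncomm_ring) S * T * X * h1 * X * T - S * T * h2 * T * S * X * T +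
    S * T * S * X * T * h2 * T - h1 * X * T * X * S * T

variable {U V x x' : A} (hU : U * U = -(x + x') * U) (hV : V * V = -(x + x') * V)
  (hUV : U * V * U = U) (hVU : V * U * V = V) (hx : ∀ a, x * a = a * x) (hxx : x * x' = 1)
include hU hV hUV hVU hx hxx

omit hV hVU in
lemma hecke_UST : U * (V + x) * (U + x) = x * U * V := by
  linear_combination (norm := noncomm_ring) hUV - hx U * U + x * hU - hx (U * V) - hx (U * x) -
    x * hx U - hxx * U

lemma hecke_braid : (U + x) * (V + x) * (U + x) = (V + x) * (U + x) * (V + x) := by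
  have e1 := hecke_UST hU hUV hx hxx
  have e2 := hecke_UST hV hVU hx hxx
  linear_combination (norm := noncomm_ring) e1 - e2 + x * hx U - x * hx V

lemma hecke_intertwine : V * (U + x) * (V + x) = (U + x) * (V + x) * U := by
  have e2 := hecke_UST hV hVU hx hxx
  linear_combination (norm := noncomm_ring) e2 - hUV + hx U * U - x * hU + hxx * U

lemma hecke_VTSST : V * (U + x) * (V + x) * ((V + x) * (U + x)) = x * x * V := by
  have e1 := hecke_UST hU hUV hx hxx
  have e2 := hecke_UST hV hVU hx hxx
  linear_combination (norm := noncomm_ring) e2 * (V + x) * (U + x) + x * V * e1 - x * hx V * U * V +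
    x * x * hVU

lemma hecke_TSSTV : (U + x) * (V + x) * ((V + x) * (U + x)) * V = x * x * V := by
  have e0 := hecke_VTSST hU hV hUV hVU hx hxx
  have e1 := hecke_intertwine hU hV hUV hVU hx hxx
  have e2 := hecke_intertwine hV hU hVU hUV hx hxx
  linear_combination (norm := noncomm_ring) e0 - (U + x) * (V + x) * e2 - e1 * (V + x) * (U + x)

end Words

lemma qq_inv {A : Type*} [Ring A] [Algebra ℂ A] {q : ℂ} (hq : q ≠ 0) : algebraMap ℂ A q * algebraMap ℂ A q⁻¹ = 1 := by
  rw [← map_mul, mul_inv_cancel₀ hq, map_one]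

namespace IsBlob

variable {A : Type*} [Ring A] [Algebra ℂ A] {n : ℕ} {q : ℂ} {m : ℤ} {e : A} {U : Fin (n - 1) → A}

section

variable (h : IsBlob q m e U) (hq : q ≠ 0)
include h

lemma Usq' (r : Fin (n - 1)) :
    U r * U r = -(algebraMap ℂ A q + algebraMap ℂ A q⁻¹) * U r := by
  rw [h.Usq, Algebra.smul_def, map_neg, map_add]

omit h in
lemma XJ_succ {α β : ℂ} (r : Fin (n - 1)) : XJ q α β e U (r.val + 1) =
    (U r + algebraMap ℂ A q) * XJ q α β e U r.val * (U r + algebraMap ℂ A q) := by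
  rw [XJ, dif_pos r.2]

lemma commute_XJ_of_lt {α β : ℂ} (t : Fin (n - 1)) :
    ∀ v < t.val, Commute (U t) (XJ q α β e U v)
  | 0, hv => by
    have h0 : Commute (U t) e := h.Ue t hv
    exact ((Algebra.commute_algebraMap_right α (U t)).mul_right h0).add_right
      ((Algebra.commute_algebraMap_right β (U t)).mul_right
        ((Commute.one_right _).sub_right h0))
  | v + 1, hv => by
    have h0 := commute_XJ_of_lt (α := α) (β := β) t v (by omega)
    have h1 : Commute (U t) (U ⟨v, by omega⟩ + algebraMap ℂ A q) :=
      Commute.add_right (h.Ucomm t ⟨v, by omega⟩ (.inr hv))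
        (Algebra.commute_algebraMap_right _ _)
    rw [XJ, dif_pos (by omega)]
    exact (h1.mul_right h0).mul_right h1

include hq

lemma commute_XJ_of_add_two {α β : ℂ} (t : Fin (n - 1)) (v : ℕ) (hv : t.val + 2 ≤ v) (hvn : v < n) :
    Commute (U t) (XJ q α β e U v) := by
  induction v, hv using Nat.le_induction with
  | base =>
    let s : Fin (n - 1) := ⟨t.val + 1, by omega⟩
    have h1 := hecke_intertwine (h.Usq' s) (h.Usq' t) (h.UUU s t (.inr rfl)) (h.UUU t s (.inl rfl))
      (Algebra.commutes q) (qq_inv hq)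
    have h2 := hecke_intertwine (h.Usq' t) (h.Usq' s) (h.UUU t s (.inl rfl)) (h.UUU s t (.inr rfl))
      (Algebra.commutes q) (qq_inv hq)
    have h3 : U s * _ = _ * U s :=
      h.commute_XJ_of_lt (α := α) (β := β) s t.val (Nat.lt_succ_self _)
    change U t * XJ q α β e U (s.val + 1) = XJ q α β e U (s.val + 1) * U t
    rw [XJ_succ, show s.val = t.val + 1 from rfl, XJ_succ]
    generalize XJ q α β e U t.val = X at *
    generalize algebraMap ℂ A q = x at *
    linear_combination (norm := noncomm_ring) h1 * X * (U t + x) * (U s + x) +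
      (U s + x) * (U t + x) * h3 * (U t + x) * (U s + x) + (U s + x) * (U t + x) * X * h2
  | succ v hv ih =>
    have h0 := ih (by omega)
    have h1 : Commute (U t) (U ⟨v, by omega⟩ + algebraMap ℂ A q) :=
      Commute.add_right (h.Ucomm t ⟨v, by omega⟩ (.inl hv))
        (Algebra.commute_algebraMap_right _ _)
    rw [XJ, dif_pos (by omega)]
    exact (h1.mul_right h0).mul_right h1


lemma XJ_base (hd : q - q⁻¹ ≠ 0) (hm : q ^ m - q ^ (-m) ≠ 0) (r : Fin (n - 1)) (hr : r.val = 0) :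
    U r * XJ q (q ^ (-m)) (q ^ m) e U 0 * U r =
      algebraMap ℂ A (-q * (q ^ m + q ^ (-m))) * U r := by
  have h1 := h.UeU r hr
  have h2 := h.Usq r
  have c1 := Algebra.commutes (A := A) (q ^ (-m)) (U r)
  have c2 := Algebra.commutes (A := A) (q ^ m) (U r)
  have h3 : U r * XJ q (q ^ (-m)) (q ^ m) e U 0 * U r =
      (q ^ (-m) - q ^ m) • (U r * e * U r) + q ^ m • (U r * U r) := by
    rw [XJ, sub_smul, Algebra.smul_def, Algebra.smul_def, Algebra.smul_def]
    linear_combination (norm := noncomm_ring) -c1 * e * U r - c2 * (1 - e) * U r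
  rw [h3, h1, h2, smul_smul, smul_smul, ← add_smul, Algebra.smul_def]
  congr 2
  have e1 : q ^ (m - 1) = q ^ m * q⁻¹ := by rw [zpow_sub₀ hq, zpow_one]; rfl
  have e2 : q ^ (-(m - 1)) = q * q ^ (-m) := by rw [neg_sub, sub_eq_add_neg, zpow_add₀ hq, zpow_one]
  have e3 : q ^ m * q ^ (-m) = 1 := by rw [← zpow_add₀ hq]; simp
  rw [gauss, gauss, e1, e2, div_div_div_cancel_right₀ hd]
  generalize q ^ m = β at *
  generalize q ^ (-m) = α at *
  field_simp
  ring

lemma XJ_zero_sq : XJ q (q ^ (-m)) (q ^ m) e U 0 * XJ q (q ^ (-m)) (q ^ m) e U 0 =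
    algebraMap ℂ A (q ^ m + q ^ (-m)) * XJ q (q ^ (-m)) (q ^ m) e U 0 - 1 := by
  have h1 := h.ee
  have c1 := Algebra.commutes (A := A) (q ^ (-m)) e
  have c2 := Algebra.commutes (A := A) (q ^ m) e
  have e3 : algebraMap ℂ A (q ^ m) * algebraMap ℂ A (q ^ (-m)) = 1 := by
    rw [← map_mul, ← zpow_add₀ hq]; simp
  have e4 : algebraMap ℂ A (q ^ (-m)) * algebraMap ℂ A (q ^ m) = 1 := by
    rw [← map_mul, ← zpow_add₀ hq]; simp
  rw [XJ, map_add]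
  generalize algebraMap ℂ A (q ^ m) = β at *
  generalize algebraMap ℂ A (q ^ (-m)) = α at *
  linear_combination (norm := noncomm_ring) (α - β) * (α - β) * h1 - (α - β) * (c1 - c2) * e
    - (α - β) * c2 + (e4 - e3) * e - e4

lemma XJ_lo_hi {α β : ℂ} (r : Fin (n - 1)) :
    (U r + algebraMap ℂ A q) * XJ q α β e U r.val =
        XJ q α β e U (r.val + 1) * (U r + algebraMap ℂ A q⁻¹) ∧
      XJ q α β e U r.val * (U r + algebraMap ℂ A q) =
        (U r + algebraMap ℂ A q⁻¹) * XJ q α β e U (r.val + 1) := by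
  have h3 := h.Usq' r
  have hx := Algebra.commutes (A := A) q (U r)
  have hx' := Algebra.commutes (A := A) q⁻¹ (U r)
  have hxx := qq_inv (A := A) hq
  have hxx' := qq_inv (A := A) (inv_ne_zero hq)
  rw [inv_inv] at hxx'
  rw [XJ_succ]
  generalize XJ q α β e U r.val = X at *
  generalize U r = T at *
  generalize algebraMap ℂ A q⁻¹ = x' at *
  generalize algebraMap ℂ A q = x at *
  constructor
  · linear_combination (norm := noncomm_ring) -(T + x) * X * (h3 - hx' + hxx)
  · linear_combination (norm := noncomm_ring) -(h3 - hx + hxx') * X * (T + x)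

/-- The relations between `U_r` and the adjacent Jucys–Murphy elements. -/
lemma XJ_rel (hd : q - q⁻¹ ≠ 0) (hm : q ^ m - q ^ (-m) ≠ 0) (r : Fin (n - 1)) :
    Commute (XJ q (q ^ (-m)) (q ^ m) e U r) (XJ q (q ^ (-m)) (q ^ m) e U (r.val + 1)) ∧
    U r * (XJ q (q ^ (-m)) (q ^ m) e U r * XJ q (q ^ (-m)) (q ^ m) e U (r.val + 1)) =
      algebraMap ℂ A (q ^ 2) ^ r.val * U r ∧
    XJ q (q ^ (-m)) (q ^ m) e U r * XJ q (q ^ (-m)) (q ^ m) e U (r.val + 1) * U r =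
      algebraMap ℂ A (q ^ 2) ^ r.val * U r := by
  obtain ⟨r, hr⟩ := r
  induction r with
  | zero =>
    have h1 := h.XJ_base hq hd hm ⟨0, hr⟩ rfl
    have h2 := h.XJ_zero_sq hq
    have h3 := h.Usq' ⟨0, hr⟩
    have hx := Algebra.commutes (A := A) q
    have hz := Algebra.commutes (A := A) (q ^ m + q ^ (-m))
    have hxx := qq_inv (A := A) hq
    have hx' := Algebra.commutes (A := A) q⁻¹
    have e0 := XJ_succ (q := q) (α := q ^ (-m)) (β := q ^ m) (e := e) (U := U) ⟨0, hr⟩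
    obtain ⟨r1, r2⟩ := h.XJ_lo_hi hq (α := q ^ (-m)) (β := q ^ m) ⟨0, hr⟩
    simp only at e0 r1 r2 ⊢
    rw [pow_zero, one_mul]
    rw [map_mul, map_neg] at h1
    generalize XJ q (q ^ (-m)) (q ^ m) e U (0 + 1) = Y at *
    generalize XJ q (q ^ (-m)) (q ^ m) e U 0 = X at *
    generalize U ⟨0, hr⟩ = T at *
    generalize algebraMap ℂ A (q ^ m + q ^ (-m)) = z at *
    generalize algebraMap ℂ A q⁻¹ = x' at *
    generalize algebraMap ℂ A q = x at *
    have hY : X * Y = Y * X := by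
      rw [e0]
      linear_combination (norm := noncomm_ring) X * h1 - h1 * X + hx X * z * T + x * hz X * T -
        hx (X * T * X) + x * h2 * T - hx X * X * T - x * T * h2 + x * hz T * X + hx (T * X) * X -
        hx X * X * x - x * hx (X * X) + x * hx X * X
    have hT : T * (X * Y) = T := by
      rw [e0]
      linear_combination (norm := noncomm_ring) h1 * X * T + h1 * X * x - hx (T * X) * X * T +
        x * T * h2 * T - x * hz T * X * T - x * h3 - hx (T * X) * X * x + x * T * h2 * x -
        x * hz T * X * x + x * hx T + hxx * T
    refine ⟨hY, hT, ?_⟩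
    linear_combination (norm := noncomm_ring) -X * r1 + r2 * X - (T + x') * hY + hT + hx' (X * Y)
  | succ r ih =>
    let s : Fin (n - 1) := ⟨r + 1, hr⟩
    let t : Fin (n - 1) := ⟨r, by omega⟩
    obtain ⟨h1, h2, h3⟩ := ih (by omega)
    have a1 := h.UUU s t (.inr rfl)
    have a2 := h.UUU t s (.inl rfl)
    have hx := Algebra.commutes (A := A) q
    have hxx := qq_inv (A := A) hq
    have b1 := hecke_VTSST (h.Usq' t) (h.Usq' s) a2 a1 hx hxx
    have b2 := hecke_TSSTV (h.Usq' t) (h.Usq' s) a2 a1 hx hxx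
    have b3 := hecke_intertwine (h.Usq' t) (h.Usq' s) a2 a1 hx hxx
    have b4 := hecke_intertwine (h.Usq' s) (h.Usq' t) a1 a2 hx hxx
    have b5 := hecke_braid (h.Usq' t) (h.Usq' s) a2 a1 hx hxx
    have b6 : Commute (U s) _ :=
      h.commute_XJ_of_lt (α := q ^ (-m)) (β := q ^ m) s r (Nat.lt_succ_self _)
    have b7 : (U s + algebraMap ℂ A q) * _ = _ * _ :=
      b6.add_left (Algebra.commute_algebraMap_left q _)
    have c1 := word_YZ b5 b7
    have c2 := word_ZY b5 b7
    have e0 := XJ_succ (q := q) (α := q ^ (-m)) (β := q ^ m) (e := e) (U := U) s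
    have e1 := XJ_succ (q := q) (α := q ^ (-m)) (β := q ^ m) (e := e) (U := U) t
    change _ = (_ + _) * XJ q (q ^ (-m)) (q ^ m) e U (r + 1) * _ at e0
    change XJ q (q ^ (-m)) (q ^ m) e U (r + 1) = (_ + _) * XJ q (q ^ (-m)) (q ^ m) e U r * _ at e1
    rw [← e1, ← e0] at c1 c2
    have hc := (Commute.pow_left (Algebra.commute_algebraMap_left (A := A) (q ^ 2) 1) r)
    have hc : ∀ a : A, algebraMap ℂ A (q ^ 2) ^ r * a = a * algebraMap ℂ A (q ^ 2) ^ r := fun a =>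
      Commute.pow_left (Algebra.commute_algebraMap_left _ _) _
    have hs : algebraMap ℂ A (q ^ 2) ^ (r + 1) =
      algebraMap ℂ A (q ^ 2) ^ r * (algebraMap ℂ A q * algebraMap ℂ A q) := by
      rw [pow_succ, ← map_mul, ← pow_two]
    change Commute (XJ q (q ^ (-m)) (q ^ m) e U (r + 1)) (XJ q (q ^ (-m)) (q ^ m) e U (s.val + 1)) ∧
      U s * (XJ q (q ^ (-m)) (q ^ m) e U (r + 1) * XJ q (q ^ (-m)) (q ^ m) e U (s.val + 1)) =
        algebraMap ℂ A (q ^ 2) ^ (r + 1) * U s ∧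
      XJ q (q ^ (-m)) (q ^ m) e U (r + 1) * XJ q (q ^ (-m)) (q ^ m) e U (s.val + 1) * U s =
        algebraMap ℂ A (q ^ 2) ^ (r + 1) * U s
    change Commute (XJ q (q ^ (-m)) (q ^ m) e U r) (XJ q (q ^ (-m)) (q ^ m) e U (r + 1)) at h1
    change U t * (XJ q (q ^ (-m)) (q ^ m) e U r * XJ q (q ^ (-m)) (q ^ m) e U (r + 1)) = _ at h2
    change XJ q (q ^ (-m)) (q ^ m) e U r * XJ q (q ^ (-m)) (q ^ m) e U (r + 1) * U t = _ at h3
    change _ = _ * U t at h2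
    change _ = _ * U t at h3
    rw [hs]
    refine ⟨?_, ?_, ?_⟩
    · change _ * _ = _ * _
      rw [c1, c2, h1.eq]
    all_goals
      rw [c1]
      generalize XJ q (q ^ (-m)) (q ^ m) e U r * XJ q (q ^ (-m)) (q ^ m) e U (r + 1) = W at *
      generalize algebraMap ℂ A (q ^ 2) ^ r = c at *
      generalize algebraMap ℂ A q = x at *
      generalize U s = V at *
      generalize U t = T at *
    · linear_combination (norm := noncomm_ring) b3 * W * (V + x) * (T + x) +
        (T + x) * (V + x) * h2 * (V + x) * (T + x) - hc ((T + x) * (V + x)) * T * (V + x) * (T + x)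
        - c * b3 * (V + x) * (T + x) + c * b1
    · linear_combination (norm := noncomm_ring) -(T + x) * (V + x) * W * b4 +
        (T + x) * (V + x) * h3 * (V + x) * (T + x) - hc ((T + x) * (V + x)) * T * (V + x) * (T + x)
        + c * (T + x) * (V + x) * b4 + c * b2

end

end IsBlob

section Comm

universe u

open scoped IsMulCommutative in
lemma exists_comm_of_commute {A : Type u} [Ring A] [Algebra ℂ A] {ι : Type*} (X : ι → A)
    (hX : ∀ r s, Commute (X r) (X s)) : ∃ (B : Type u) (_ : CommRing B) (_ : Algebra ℂ B)
      (f : B →ₐ[ℂ] A) (x : ι → B), Function.Injective f ∧ ∀ r, f (x r) = X r := by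
  have : IsMulCommutative (Algebra.adjoin ℂ (Set.range X)) :=
    Algebra.isMulCommutative_adjoin ℂ (by rintro _ ⟨r, rfl⟩ _ ⟨s, rfl⟩; exact hX r s)
  exact ⟨Algebra.adjoin ℂ (Set.range X), inferInstance, inferInstance,
    (Algebra.adjoin ℂ (Set.range X)).val,
    fun r => ⟨X r, Algebra.subset_adjoin ⟨r, rfl⟩⟩, Subtype.val_injective, fun r => rfl⟩

lemma sq_zero_step {B : Type*} [CommRing B] {X Y c d : B} {l : ℕ}
    (h : (Y - d * X) * (X * Y - c) = 0) (hc : c ^ l = 1) (hd : d ^ l = 1)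
    (hX : (X ^ l - 1) ^ 2 = 0) : (Y ^ l - 1) ^ 2 = 0 := by
  obtain ⟨u, hu⟩ := sub_dvd_pow_sub_pow Y (d * X) l
  obtain ⟨v, hv⟩ := sub_dvd_pow_sub_pow (X * Y) c l
  rw [mul_pow, hd, one_mul] at hu
  rw [mul_pow, hc] at hv
  have h1 : (Y ^ l - X ^ l) * (X ^ l * Y ^ l - 1) = 0 := by
    rw [hu, hv]; linear_combination u * v * h
  generalize X ^ l = M at *
  generalize Y ^ l = N at *
  linear_combination (2 - M) * h1 + ((2 - M) * N + (N - 1) ^ 2) * hX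

lemma one_sub_pow_of_sq {B : Type*} [CommRing B] {y : B} (hy : y ^ 2 = 0) (l : ℕ) :
    (1 - y) ^ l = 1 - l * y := by
  induction l with
  | zero => simp
  | succ l ih => rw [pow_succ, ih, Nat.cast_succ]; linear_combination (l : B) * hy

section Weight

variable {B : Type*} [CommRing B] [Algebra ℂ B] {l : ℕ} [NeZero l]

/-- The spectral projections of an element `w` with `w ^ l = 1`. -/
def wtProj (χ : AddChar (ZMod l) ℂ) (w : B) (j : ZMod l) : B :=
  algebraMap ℂ B (l : ℂ)⁻¹ * ∑ t : ZMod l, algebraMap ℂ B (χ (-(j * t))) * w ^ t.val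

variable {q : ℂ} {χ : AddChar (ZMod l) ℂ} (hχ : IsChar q χ) {w : B} (hw : w ^ l = 1)
include hw

lemma mul_wtProj (j : ZMod l) : w * wtProj χ w j = algebraMap ℂ B (χ j) * wtProj χ w j := by
  have h1 : ∀ t : ZMod l, w ^ (t + 1).val = w * w ^ t.val := by
    intro t
    have := AddChar.map_add_eq_mul (AddChar.zmodChar l hw) t 1
    rw [AddChar.zmodChar_apply, AddChar.zmodChar_apply] at this
    rw [this, mul_comm]
    congr 1
    have h2 := AddChar.zmodChar_apply' hw 1
    simpa using h2
  unfold wtProj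
  rw [mul_left_comm, mul_left_comm (algebraMap ℂ B (χ j))]
  congr 1
  rw [Finset.mul_sum, Finset.mul_sum, ← Equiv.sum_comp (Equiv.addRight (1 : ZMod l))
    fun t => algebraMap ℂ B (χ j) * _]
  refine Finset.sum_congr rfl fun t _ => ?_
  rw [Equiv.coe_addRight, h1, ← mul_assoc (algebraMap ℂ B (χ j)), ← map_mul,
    ← AddChar.map_add_eq_mul, show j + -(j * (t + 1)) = -(j * t) by ring]
  ring

include hχ

lemma wtProj_orth {j j' : ZMod l} (hj : j ≠ j') : wtProj χ w j * wtProj χ w j' = 0 := by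
  have h1 := mul_wtProj (χ := χ) hw j
  have h2 := mul_wtProj (χ := χ) hw j'
  have h3 : χ j - χ j' ≠ 0 := by
    intro h
    refine hj (sub_eq_zero.1 (hχ.inj _ ?_))
    rw [AddChar.map_sub_eq_div, div_eq_one_iff_eq (IsChar.ne_zero _)]
    linear_combination h
  have h4 : algebraMap ℂ B (χ j - χ j') * (wtProj χ w j * wtProj χ w j') = 0 := by
    rw [map_sub]
    linear_combination wtProj χ w j * h2 - wtProj χ w j' * h1
  rw [← Algebra.smul_def] at h4
  exact (smul_eq_zero_iff_right h3).1 h4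

omit hw in
lemma sum_wtProj : ∑ j, wtProj χ w j = 1 := by
  unfold wtProj
  rw [← Finset.mul_sum, Finset.sum_comm]
  simp_rw [← Finset.sum_mul, ← map_sum]
  rw [Finset.sum_eq_single 0]
  · simp only [mul_zero, neg_zero, AddChar.map_zero_eq_one, ZMod.val_zero, pow_zero, mul_one,
      Finset.sum_const, Finset.card_univ, ZMod.card, nsmul_eq_mul]
    rw [← map_mul, inv_mul_cancel₀ (by simp [NeZero.ne]), map_one]
  · intro t _ ht
    have h1 := AddChar.sum_eq_zero_of_ne_one (ψ := χ.mulShift (-t)) (by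
      intro h
      have h2 : χ (-t * 1) = 1 := by rw [← AddChar.mulShift_apply, h, AddChar.one_apply]
      have := hχ.inj _ h2
      exact ht (by simpa using this))
    have h3 : ∑ j, χ (-(j * t)) = 0 := by
      rw [← h1]
      refine Finset.sum_congr rfl fun j _ => ?_
      rw [AddChar.mulShift_apply]; ring_nf
    rw [h3, map_zero, zero_mul]
  · simp

lemma wtProj_idem (j : ZMod l) : wtProj χ w j * wtProj χ w j = wtProj χ w j := by
  conv_rhs => rw [← mul_one (wtProj χ w j), ← sum_wtProj (w := w) hχ, Finset.mul_sum]
  rw [Finset.sum_eq_single j]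
  · intro j' _ hj
    exact wtProj_orth hχ hw hj.symm
  · simp

end Weight

/-- Simultaneous generalised eigenspaces of commuting elements. -/
theorem exists_weight_system {A : Type u} [Ring A] [Algebra ℂ A] {l n : ℕ} [NeZero l] {q : ℂ}
    {χ : AddChar (ZMod l) ℂ} (hχ : IsChar q χ) (X : Fin n → A) (hX : ∀ r s, Commute (X r) (X s))
    (hsq : ∀ r, (X r ^ l - 1) ^ 2 = 0) :
    ∃ (E : Res l n → A), (∀ i j, i ≠ j → E i * E j = 0) ∧ (∀ i, E i * E i = E i) ∧
      ∑ i, E i = 1 ∧ (∀ r i, Commute (X r) (E i)) ∧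
      ∀ r i, X r * E i =
        algebraMap ℂ A (χ (i r)) * (1 + algebraMap ℂ A (l : ℂ)⁻¹ * (X r ^ l - 1)) * E i := by
  obtain ⟨B, _, _, f, x, hf, hfx⟩ := exists_comm_of_commute X hX
  have hx : ∀ r, (x r ^ l - 1) ^ 2 = 0 := fun r => hf (by
    rw [map_pow, map_sub, map_pow, hfx, map_one, hsq, map_zero])
  have hl : algebraMap ℂ B (l : ℂ)⁻¹ * (l : B) = 1 := by
    rw [← map_natCast (algebraMap ℂ B), ← map_mul, inv_mul_cancel₀ (by simp [NeZero.ne]), map_one]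
  let y : Fin n → B := fun r => algebraMap ℂ B (l : ℂ)⁻¹ * (x r ^ l - 1)
  have hy : ∀ r, y r ^ 2 = 0 := fun r => by rw [mul_pow, hx, mul_zero]
  have hxy : ∀ r, x r ^ l = 1 + l * y r := fun r => by
    linear_combination -(x r ^ l - 1) * hl
  let w : Fin n → B := fun r => x r * (1 - y r)
  have hw : ∀ r, w r ^ l = 1 := by
    intro r
    have h1 : (1 - y r) ^ l = 1 - l * y r := one_sub_pow_of_sq (hy r) l
    rw [mul_pow, hxy, h1]
    linear_combination -(l : B) ^ 2 * hy r
  let E : Res l n → B := fun i => ∏ r, wtProj χ (w r) (i r)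
  have hE : ∀ i r, w r * E i = algebraMap ℂ B (χ (i r)) * E i := by
    intro i r
    change w r * ∏ r, _ = _ * ∏ r, _
    rw [← Finset.mul_prod_erase _ _ (Finset.mem_univ r), ← mul_assoc, mul_wtProj (hw r), mul_assoc]
  refine ⟨fun i => f (E i), ?_, ?_, ?_, ?_, ?_⟩
  · intro i j hij
    obtain ⟨r, hr⟩ := Function.ne_iff.1 hij
    rw [← map_mul, ← Finset.prod_mul_distrib, Finset.prod_eq_zero (Finset.mem_univ r)
      (wtProj_orth hχ (hw r) hr), map_zero]
  · intro i
    rw [← map_mul, ← Finset.prod_mul_distrib]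
    simp_rw [wtProj_idem hχ (hw _)]
    rfl
  · rw [← map_sum, ← map_one f]
    congr 1
    have := Finset.prod_univ_sum (fun _ : Fin n => (Finset.univ : Finset (ZMod l)))
      (fun r j => wtProj χ (w r) j)
    simp_rw [sum_wtProj hχ] at this
    rw [Fintype.piFinset_univ, Finset.prod_const_one] at this
    exact this.symm
  · intro r i
    rw [← hfx]
    exact (Commute.all _ _).map f
  · intro r i
    have h1 := hE i r
    have h2 : x r * E i = algebraMap ℂ B (χ (i r)) * (1 + y r) * E i := by
      linear_combination (1 + y r) * h1 + x r * E i * hy r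
    have h3 := congrArg f h2
    simpa [y, hfx] using h3

end Comm

/-- A simultaneous generalised eigenspace decomposition for the Jucys–Murphy elements `X_r`, where
`y_r` is the nilpotent part of `X_r`. -/
structure IsJM {A : Type*} [Ring A] [Algebra ℂ A] {l n : ℕ} [NeZero l] (q : ℂ)
    (χ : AddChar (ZMod l) ℂ) (U : Fin (n - 1) → A) (E : Res l n → A) (y X : Fin n → A) : Prop where
  orth : ∀ i j : Res l n, i ≠ j → E i * E j = 0
  idem : ∀ i : Res l n, E i * E i = E i
  sum1 : ∑ i : Res l n, E i = 1
  XcE : ∀ (r : Fin n) (i : Res l n), X r * E i = E i * X r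
  ye : ∀ (r : Fin n) (i : Res l n), y r * E i = E i * y r
  yy : ∀ r s : Fin n, y r * y s = y s * y r
  y_sq : ∀ r : Fin n, y r * y r = 0
  XE : ∀ (r : Fin n) (i : Res l n), X r * E i = algebraMap ℂ A (χ (i r)) * (1 + y r) * E i
  UX : ∀ (r : Fin (n - 1)) (s : Fin n), s.val ≠ r.val → s.val ≠ r.val + 1 → U r * X s = X s * U r
  Uy : ∀ (r : Fin (n - 1)) (s : Fin n), s.val ≠ r.val → s.val ≠ r.val + 1 → U r * y s = y s * U r
  lo_hi : ∀ r : Fin (n - 1),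
    (U r + algebraMap ℂ A q) * X (lo r) = X (hi r) * (U r + algebraMap ℂ A q⁻¹)
  lo_hi' : ∀ r : Fin (n - 1),
    X (lo r) * (U r + algebraMap ℂ A q) = (U r + algebraMap ℂ A q⁻¹) * X (hi r)
  XX : ∀ r s : Fin n, X r * X s = X s * X r
  U_XX : ∀ r : Fin (n - 1), U r * (X (lo r) * X (hi r)) = algebraMap ℂ A (χ r.val) * U r
  XX_U : ∀ r : Fin (n - 1), X (lo r) * X (hi r) * U r = algebraMap ℂ A (χ r.val) * U r
  yU : ∀ r : Fin (n - 1), y (lo r) * U r = -(y (hi r) * U r)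
  Uy' : ∀ r : Fin (n - 1), U r * y (lo r) = -(U r * y (hi r))

lemma hecke_quadratic {A : Type*} [Ring A] [Algebra ℂ A] {q : ℂ} (hq : q ≠ 0) {T X Y c : A}
    (hc : ∀ a, c * a = a * c) (h1 : X * Y = Y * X) (h2 : T * (X * Y) = c * T)
    (h4 : (T + algebraMap ℂ A q) * X = Y * (T + algebraMap ℂ A q⁻¹)) :
    (Y - algebraMap ℂ A (q ^ 2) * X) * (X * Y - c) = 0 := by
  have hx := Algebra.commutes (A := A) q
  have hxx := qq_inv (A := A) hq
  have hs : algebraMap ℂ A (q ^ 2) = algebraMap ℂ A q * algebraMap ℂ A q := by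
    rw [← map_mul, ← pow_two]
  rw [hs]
  generalize algebraMap ℂ A q⁻¹ = x' at *
  generalize algebraMap ℂ A q = x at *
  linear_combination (norm := noncomm_ring) -x * h4 * (X * Y - c) - hx Y * x' * (X * Y - c) -
    Y * hxx * (X * Y - c) - x * Y * h2 - x * Y * hc T + x * T * X * h1 + x * h2 * X +
    x * hc (T * X)

lemma IsChar.injective {l : ℕ} {q : ℂ} {χ : AddChar (ZMod l) ℂ} (hχ : IsChar q χ) {a b : ZMod l}
    (hab : χ a = χ b) : a = b := by
  refine sub_eq_zero.1 (hχ.inj _ ?_)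
  rw [AddChar.map_sub_eq_div, hab, div_self (IsChar.ne_zero _)]

namespace IsBlob

variable {A : Type*} [Ring A] [Algebra ℂ A] {n : ℕ} {q : ℂ} {m : ℤ} {e : A} {U : Fin (n - 1) → A}

variable (h : IsBlob q m e U) (hq : q ≠ 0) (hd : q - q⁻¹ ≠ 0) (hm : q ^ m - q ^ (-m) ≠ 0)
include h hq hd hm

lemma commute_XJ_XJ (v : ℕ) : ∀ u ≤ v, v < n →
    Commute (XJ q (q ^ (-m)) (q ^ m) e U u) (XJ q (q ^ (-m)) (q ^ m) e U v) := by
  induction v with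
  | zero => intro u hu _; rw [Nat.le_zero.1 hu]
  | succ v ih =>
    intro u hu hv
    rcases Nat.lt_or_ge v u with h1 | h1
    · rw [le_antisymm hu h1]
    · rcases h1.lt_or_eq with h2 | h2
      · have h3 : Commute (U ⟨v, by omega⟩ + algebraMap ℂ A q) (XJ q (q ^ (-m)) (q ^ m) e U u) :=
          (h.commute_XJ_of_lt ⟨v, by omega⟩ u h2).add_left (Algebra.commute_algebraMap_left _ _)
        rw [XJ, dif_pos (by omega)]
        exact (h3.symm.mul_right (ih u h1 (by omega))).mul_right h3.symm
      · rw [h2]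
        exact (h.XJ_rel hq hd hm ⟨v, by omega⟩).1

lemma XJ_quadratic (r : Fin (n - 1)) :
    (XJ q (q ^ (-m)) (q ^ m) e U (r.val + 1) -
        algebraMap ℂ A (q ^ 2) * XJ q (q ^ (-m)) (q ^ m) e U r.val) *
      (XJ q (q ^ (-m)) (q ^ m) e U r.val * XJ q (q ^ (-m)) (q ^ m) e U (r.val + 1) -
        algebraMap ℂ A (q ^ 2) ^ r.val) = 0 := by
  obtain ⟨h1, h2, h3⟩ := h.XJ_rel hq hd hm r
  obtain ⟨h4, h5⟩ := h.XJ_lo_hi hq (α := q ^ (-m)) (β := q ^ m) r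
  exact hecke_quadratic hq (fun a => (Algebra.commute_algebraMap_left _ a).pow_left _) h1.eq h2 h4

omit hd hm hq in
lemma XJ_zero_pow {l : ℕ} (hl : q ^ l = 1) : XJ q (q ^ (-m)) (q ^ m) e U 0 ^ l = 1 := by
  have h1 : ∀ (a b : ℂ) (k : ℕ), (algebraMap ℂ A a * e + algebraMap ℂ A b * (1 - e)) ^ k =
      algebraMap ℂ A (a ^ k) * e + algebraMap ℂ A (b ^ k) * (1 - e) := by
    intro a b k
    induction k with
    | zero => simp
    | succ k ih =>
      have h2 := Algebra.commutes (A := A) a e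
      have h3 := Algebra.commutes (A := A) b e
      have h4 := h.ee
      rw [pow_succ, ih, pow_succ, pow_succ, map_mul, map_mul]
      generalize algebraMap ℂ A (a ^ k) = a' at *
      generalize algebraMap ℂ A (b ^ k) = b' at *
      generalize algebraMap ℂ A a = a at *
      generalize algebraMap ℂ A b = b at *
      linear_combination (norm := noncomm_ring) -(a' - b') * h2 * e - (a' - b') * h3 * (1 - e) +
        (a' - b') * (a - b) * h4
  rw [XJ, h1, ← zpow_natCast, ← zpow_natCast, ← zpow_mul, ← zpow_mul, mul_comm m, mul_comm (-m),
    zpow_mul, zpow_mul, zpow_natCast, hl, one_zpow, one_zpow]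
  simp

lemma XJ_pow_sub_one_sq {l : ℕ} (hl : q ^ l = 1) (v : ℕ) (hv : v < n) :
    (XJ q (q ^ (-m)) (q ^ m) e U v ^ l - 1) ^ 2 = 0 := by
  induction v with
  | zero =>
    rw [h.XJ_zero_pow hl]; simp
  | succ v ih =>
    have h0 := ih (by omega)
    have h1 := h.XJ_quadratic hq hd hm ⟨v, by omega⟩
    have h2 := h.commute_XJ_XJ hq hd hm (v + 1) v (by omega) hv
    obtain ⟨B, _, _, f, x, hf, hfx⟩ := exists_comm_of_commute
      ![XJ q (q ^ (-m)) (q ^ m) e U v, XJ q (q ^ (-m)) (q ^ m) e U (v + 1)] (by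
        intro r s
        fin_cases r <;> fin_cases s
        exacts [Commute.refl _, h2, h2.symm, Commute.refl _])
    have hx0 := hfx 0
    have hx1 := hfx 1
    simp only [Matrix.cons_val_zero, Matrix.cons_val_one] at hx0 hx1
    have h3 : (x 1 - algebraMap ℂ B (q ^ 2) * x 0) * (x 0 * x 1 - algebraMap ℂ B (q ^ 2) ^ v) = 0 :=
      hf (by simpa [hx0, hx1] using h1)
    have h4 : (x 0 ^ l - 1) ^ 2 = 0 := hf (by simpa [hx0] using h0)
    have h5 : algebraMap ℂ B (q ^ 2) ^ l = 1 := by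
      rw [← map_pow, ← pow_mul, mul_comm, pow_mul, hl, one_pow, map_one]
    have h6 := congrArg f (sq_zero_step h3 (by rw [← pow_mul, mul_comm, pow_mul, h5, one_pow]) h5 h4)
    simpa [hx1] using h6

theorem exists_isJM {l : ℕ} [NeZero l] {χ : AddChar (ZMod l) ℂ} (hχ : IsChar q χ) (hl : q ^ l = 1)
    {κ : ZMod l} (hκ : χ κ = q ^ m) (hn : 0 < n) :
    ∃ (E : Res l n → A) (y X : Fin n → A), IsJM q χ U E y X ∧
      (∀ r, X r = XJ q (q ^ (-m)) (q ^ m) e U r) ∧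
      (∀ r, y r = algebraMap ℂ A (l : ℂ)⁻¹ * (X r ^ l - 1)) ∧
      y ⟨0, hn⟩ = 0 ∧
      (∀ i, i ⟨0, hn⟩ ≠ κ → i ⟨0, hn⟩ ≠ -κ → E i = 0) ∧
      ∀ i, e * E i = if i ⟨0, hn⟩ = -κ then E i else 0 := by
  let X : Fin n → A := fun r => XJ q (q ^ (-m)) (q ^ m) e U r
  have hX : ∀ r s, Commute (X r) (X s) := by
    intro r s
    rcases le_total r.val s.val with h1 | h1
    · exact h.commute_XJ_XJ hq hd hm s r h1 s.2
    · exact (h.commute_XJ_XJ hq hd hm r s h1 r.2).symm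
  have hsq : ∀ r, (X r ^ l - 1) ^ 2 = 0 := fun r => h.XJ_pow_sub_one_sq hq hd hm hl r r.2
  obtain ⟨E, h1, h2, h3, h4, h5⟩ := exists_weight_system hχ X hX hsq
  let y : Fin n → A := fun r => algebraMap ℂ A (l : ℂ)⁻¹ * (X r ^ l - 1)
  have hly : ∀ r, X r ^ l = 1 + algebraMap ℂ A l * y r := by
    intro r
    change _ = 1 + _ * (_ * _)
    rw [← mul_assoc, ← map_mul, mul_inv_cancel₀ (by simp [NeZero.ne])]
    simp
  have hcy : ∀ (a : A) (r : Fin n), Commute a (X r) → Commute a (y r) := fun a r ha =>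
    (Algebra.commute_algebraMap_right _ _).mul_right ((ha.pow_right l).sub_right
      (Commute.one_right _))
  have hUX : ∀ (r : Fin (n - 1)) (s : Fin n), s.val ≠ r.val → s.val ≠ r.val + 1 →
      Commute (U r) (X s) := by
    intro r s hs1 hs2
    rcases Nat.lt_or_ge s.val r.val with h6 | h6
    · exact h.commute_XJ_of_lt r s h6
    · exact h.commute_XJ_of_add_two hq r s (by omega) s.2
  have hysq : ∀ r, y r * y r = 0 := by
    intro r
    have h6 := (Algebra.commute_algebraMap_left (l : ℂ)⁻¹ (X r ^ l - 1)).mul_pow 2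
    rw [hsq, mul_zero] at h6
    rw [← pow_two]
    exact h6
  have hyy : ∀ r s, Commute (y r) (y s) := fun r s => hcy _ _ (hcy _ _ (hX s r)).symm
  have hχr : ∀ r : ℕ, χ r = (q ^ 2) ^ r := by
    intro r
    rw [← hχ.one, ← AddChar.map_nsmul_eq_pow, nsmul_one]
  have hrel : ∀ r : Fin (n - 1), U r * (X (lo r) * X (hi r)) = algebraMap ℂ A (χ r.val) * U r ∧
      X (lo r) * X (hi r) * U r = algebraMap ℂ A (χ r.val) * U r := by
    intro r
    rw [hχr, map_pow]
    exact (h.XJ_rel hq hd hm r).2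
  have hl2 : ∀ r : ℕ, χ r ^ l = 1 := by
    intro r
    rw [hχr, ← pow_mul, ← pow_mul, mul_comm r l, mul_left_comm, pow_mul, hl, one_pow]
  have hl0 : (l : ℂ) ≠ 0 := by simp [NeZero.ne]
  have hann : ∀ a b z : A, a * b = b * a → a * a = 0 → b * b = 0 →
      (1 + algebraMap ℂ A l * a) * (1 + algebraMap ℂ A l * b) * z = z → a * z = -(b * z) := by
    intro a b z hab ha hb hz
    have ha1 := Algebra.commutes (l : ℂ) a
    have h6 : algebraMap ℂ A l * (a * z + b * z + algebraMap ℂ A l * (a * b * z)) = 0 := by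
      linear_combination (norm := noncomm_ring) hz + algebraMap ℂ A l * ha1 * b * z
    rw [← Algebra.smul_def, smul_eq_zero_iff_right hl0] at h6
    have h7 : a * b * z = 0 := by
      linear_combination (norm := noncomm_ring) a * h6 - ha * z + ha1 * a * b * z -
        algebraMap ℂ A l * ha * b * z
    rw [h7, mul_zero, add_zero] at h6
    exact eq_neg_of_add_eq_zero_left h6
  have hann' : ∀ a b z : A, a * b = b * a → a * a = 0 → b * b = 0 →
      z * ((1 + algebraMap ℂ A l * a) * (1 + algebraMap ℂ A l * b)) = z → z * a = -(z * b) := by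
    intro a b z hab ha hb hz
    have ha1 := Algebra.commutes (A := A) (l : ℂ)
    have h6 : algebraMap ℂ A l * (z * a + z * b + algebraMap ℂ A l * (z * b * a)) = 0 := by
      linear_combination (norm := noncomm_ring) hz + ha1 z * a + ha1 z * b +
        algebraMap ℂ A l * ha1 (z * b) * a + ha1 (z * b) * algebraMap ℂ A l * a -
        z * algebraMap ℂ A l * ha1 b * a - z * ha1 b * algebraMap ℂ A l * a -
        z * algebraMap ℂ A l * algebraMap ℂ A l * hab + z * algebraMap ℂ A l * ha1 a * b
    rw [← Algebra.smul_def, smul_eq_zero_iff_right hl0] at h6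
    have h7 : z * b * a = 0 := by
      linear_combination (norm := noncomm_ring) h6 * a - z * ha - algebraMap ℂ A l * z * b * ha
    rw [h7, mul_zero, add_zero] at h6
    exact eq_neg_of_add_eq_zero_left h6
  have hpow : ∀ r : Fin (n - 1), (1 + algebraMap ℂ A l * y (lo r)) *
      (1 + algebraMap ℂ A l * y (hi r)) = (X (lo r) * X (hi r)) ^ l := by
    intro r
    rw [(hX _ _).mul_pow, hly, hly]
  have hpowU : ∀ (r : Fin (n - 1)) (k : ℕ), (X (lo r) * X (hi r)) ^ k * U r =
      algebraMap ℂ A (χ r.val ^ k) * U r := by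
    intro r k
    induction k with
    | zero => simp
    | succ k ih =>
      rw [pow_succ, mul_assoc, (hrel r).2, ← mul_assoc, ← Algebra.commutes, mul_assoc, ih,
        ← mul_assoc, ← map_mul, pow_succ']
  have hUpow : ∀ (r : Fin (n - 1)) (k : ℕ), U r * (X (lo r) * X (hi r)) ^ k =
      algebraMap ℂ A (χ r.val ^ k) * U r := by
    intro r k
    induction k with
    | zero => simp
    | succ k ih =>
      rw [pow_succ, ← mul_assoc, ih, mul_assoc, (hrel r).1, ← mul_assoc, ← map_mul, pow_succ]
  have hXc : Commute e (X ⟨0, hn⟩) := by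
    change Commute e (XJ _ _ _ _ _ 0)
    rw [XJ]
    exact (((Algebra.commute_algebraMap_right _ _).mul_right (Commute.refl e)).add_right
      ((Algebra.commute_algebraMap_right _ _).mul_right
        ((Commute.one_right _).sub_right (Commute.refl e))))
  have hy0 : y ⟨0, hn⟩ = 0 := by
    change _ * (XJ _ _ _ _ _ 0 ^ l - 1) = 0
    rw [h.XJ_zero_pow hl, sub_self, mul_zero]
  have hX0 : ∀ i, X ⟨0, hn⟩ * E i = algebraMap ℂ A (χ (i ⟨0, hn⟩)) * E i := by
    intro i
    rw [h5]
    change _ * (1 + y _) * _ = _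
    rw [hy0, add_zero, mul_one]
  have hαβ : q ^ (-m) - q ^ m ≠ 0 := by
    rw [← neg_sub]
    exact neg_ne_zero.2 hm
  have he : ∀ i, e * E i = ((χ (i ⟨0, hn⟩) - q ^ m) / (q ^ (-m) - q ^ m)) • E i := by
    intro i
    have h6 := hX0 i
    change XJ _ _ _ _ _ 0 * _ = _ at h6
    rw [XJ, ← Algebra.smul_def, ← Algebra.smul_def, ← Algebra.smul_def] at h6
    refine smul_right_injective A hαβ ?_
    simp only
    rw [smul_smul, mul_div_cancel₀ _ hαβ, sub_smul, sub_smul, ← h6]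
    simp only [add_mul, smul_mul_assoc, sub_mul, smul_sub, one_mul]
    abel
  have he2 : ∀ i, E i = 0 ∨ i ⟨0, hn⟩ = κ ∨ i ⟨0, hn⟩ = -κ := by
    intro i
    have h6 : e * (e * E i) = e * E i := by rw [← mul_assoc, h.ee]
    rw [he, mul_smul_comm, he, smul_smul, ← sub_eq_zero, ← sub_smul, smul_eq_zero] at h6
    rcases h6 with h6 | h6
    · right
      have h7 : (χ (i ⟨0, hn⟩) - q ^ m) * (χ (i ⟨0, hn⟩) - q ^ (-m)) = 0 := by
        field_simp at h6
        linear_combination h6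
      rcases mul_eq_zero.1 h7 with h8 | h8
      · exact .inl (hχ.injective (by rw [hκ]; linear_combination h8))
      · exact .inr (hχ.injective (by rw [IsChar.neg_eq, hκ, ← zpow_neg]; linear_combination h8))
    · exact .inl h6
  refine ⟨E, y, X, ⟨h1, h2, h3, h4, fun r i => ((hcy _ _ (h4 r i).symm)).symm,
    fun r s => hyy r s, hysq, h5, fun r s h6 h7 => hUX r s h6 h7,
    fun r s h6 h7 => hcy _ _ (hUX r s h6 h7), fun r => (h.XJ_lo_hi hq r).1,
    fun r => (h.XJ_lo_hi hq r).2, fun r s => hX r s, fun r => (hrel r).1, fun r => (hrel r).2,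
    fun r => hann _ _ _ (hyy _ _) (hysq _) (hysq _) ?_,
    fun r => hann' _ _ _ (hyy _ _) (hysq _) (hysq _) ?_⟩, fun r => rfl, fun r => rfl, hy0, ?_, ?_⟩
  · rw [hpow, hpowU, hl2, map_one, one_mul]
  · rw [hpow, hUpow, hl2, map_one, one_mul]
  · intro i h6 h7
    exact (he2 i).resolve_right (by tauto)
  · intro i
    rw [he]
    split_ifs with h6
    · rw [h6, IsChar.neg_eq, hκ, ← zpow_neg, div_self hαβ, one_smul]
    · rcases he2 i with h7 | h7 | h7
      · rw [h7, smul_zero]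
      · rw [h7, hκ, sub_self, zero_div, zero_smul]
      · exact absurd h7 h6

end IsBlob

section Cancel

variable {A : Type*} [Ring A] [Algebra ℂ A]

lemma eq_zero_of_aff_mul {c : ℂ × ℂ} (hc : c.1 ≠ 0) {t z : A} (ht : t * t = 0)
    (hz : aff c t * z = 0) : z = 0 := by
  rw [← one_mul z, ← affInv_mul_aff hc ht, mul_assoc, hz, mul_zero]

lemma eq_zero_of_nil {σ u v : ℂ} (hσ : σ ≠ 0) {a b z : A} (hab : a * b = b * a) (ha : a * a = 0)
    (hb : b * b = 0) (hz : σ • z + u • (a * z) + v • (b * z) = 0) : z = 0 := by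
  have ha' : ∀ w, a * (a * w) = 0 := fun w => by rw [← mul_assoc, ha, zero_mul]
  have hb' : ∀ w, b * (b * w) = 0 := fun w => by rw [← mul_assoc, hb, zero_mul]
  have hab' : ∀ w, b * (a * w) = a * (b * w) := fun w => by rw [← mul_assoc, ← mul_assoc, hab]
  have h1 : a * (b * z) = 0 := by
    have := congrArg (fun w => a * (b * w)) hz
    simpa [mul_add, ha', hb', hab', hσ] using this
  have h2 : a * z = 0 := by
    have := congrArg (fun w => a * w) hz
    simpa [mul_add, ha', h1, hσ] using this
  have h3 : b * z = 0 := by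
    have := congrArg (fun w => b * w) hz
    simpa [mul_add, hb', hab', h1, hσ] using this
  simpa [h2, h3, hσ] using hz

end Cancel

namespace IsJM

variable {A : Type*} [Ring A] [Algebra ℂ A] {l n : ℕ} [NeZero l] {q : ℂ} {χ : AddChar (ZMod l) ℂ}
  {U : Fin (n - 1) → A} {E : Res l n → A} {y X : Fin n → A}

variable (h : IsJM q χ U E y X)
include h

lemma ext_E {a b : A} (H : ∀ i, a * E i = b * E i) : a = b := by
  rw [← mul_one a, ← mul_one b, ← h.sum1, Finset.mul_sum, Finset.mul_sum]
  exact Finset.sum_congr rfl fun i _ => H i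

lemma EE (i : Res l n) (a : A) : E i * (E i * a) = E i * a := by rw [← mul_assoc, h.idem]

lemma EE_ne {i j : Res l n} (hij : i ≠ j) (a : A) : E i * (E j * a) = 0 := by
  rw [← mul_assoc, h.orth i j hij, zero_mul]

lemma yyz (r : Fin n) (a : A) : y r * (y r * a) = 0 := by rw [← mul_assoc, h.y_sq, zero_mul]

lemma yEa (r : Fin n) (i : Res l n) (a : A) : y r * (E i * a) = E i * (y r * a) := by
  rw [← mul_assoc, h.ye, mul_assoc]

lemma XE' (r : Fin n) (i : Res l n) : X r * E i = χ (i r) • E i + χ (i r) • (y r * E i) := by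
  rw [h.XE, Algebra.smul_def, Algebra.smul_def]
  noncomm_ring

lemma XEa (r : Fin n) (i : Res l n) (a : A) :
    X r * (E i * a) = χ (i r) • (E i * a) + χ (i r) • (y r * (E i * a)) := by
  rw [← mul_assoc, h.XE', add_mul, smul_mul_assoc, smul_mul_assoc, mul_assoc]

lemma EX' (r : Fin n) (i : Res l n) : E i * X r = χ (i r) • E i + χ (i r) • (E i * y r) := by
  rw [← h.XcE, h.XE', h.ye]

variable (r : Fin (n - 1)) {i j : Res l n}

lemma E_U_E_far {s : Fin n} (h1 : s.val ≠ r.val) (h2 : s.val ≠ r.val + 1) (hij : j s ≠ i s)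
    (hχ : IsChar q χ) : E j * (U r * E i) = 0 := by
  have h3 : χ (j s) • (E j * (U r * E i)) + χ (j s) • (y s * (E j * (U r * E i))) =
      χ (i s) • (E j * (U r * E i)) + χ (i s) • (y s * (E j * (U r * E i))) := by
    rw [← h.XEa, ← mul_assoc (X s), h.XcE, mul_assoc, ← mul_assoc (X s), ← h.UX r s h1 h2,
      mul_assoc, h.XE', h.yEa, ← mul_assoc (y s), ← h.Uy r s h1 h2]
    simp only [mul_add, mul_smul_comm, mul_assoc]
  refine eq_zero_of_nil (σ := χ (j s) - χ (i s)) (u := χ (j s) - χ (i s)) (v := 0) (a := y s)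
    (b := y s) ?_ rfl (h.y_sq s) (h.y_sq s) ?_
  · exact sub_ne_zero.2 fun h' => hij (hχ.injective h')
  · rw [sub_smul, sub_smul, zero_smul, add_zero]
    rw [← sub_eq_zero] at h3
    rw [← h3]
    abel

lemma yyU : y (lo r) * (y (hi r) * U r) = 0 := by
  rw [← neg_eq_zero, ← mul_neg, ← h.yU, h.yyz]

lemma Uyy : U r * y (lo r) * y (hi r) = 0 := by
  rw [h.Uy', neg_mul, mul_assoc, h.y_sq, mul_zero, neg_zero]

lemma XXE (i : Res l n) : X (lo r) * X (hi r) * E i = χ (i (lo r) + i (hi r)) •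
    ((1 + y (lo r) + y (hi r) + y (lo r) * y (hi r)) * E i) := by
  rw [mul_assoc, h.XE', mul_add, mul_smul_comm, mul_smul_comm, h.ye, h.XEa, h.XE', ← h.ye,
    AddChar.map_add_eq_mul]
  simp only [add_mul, one_mul, mul_assoc]
  module

lemma E_U_zero (hχ : IsChar q χ) (hi : i (lo r) + i (Statement0.hi r) ≠ (r.val : ZMod l)) :
    E i * U r = 0 := by
  have h1 : E i * (X (lo r) * X (Statement0.hi r) * U r) = χ r.val • (E i * U r) := by
    rw [h.XX_U, ← Algebra.smul_def, mul_smul_comm]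
  have h2 : (1 + y (lo r) + y (Statement0.hi r) + y (lo r) * y (Statement0.hi r)) * U r = U r := by
    rw [add_mul, add_mul, add_mul, mul_assoc, h.yyU, h.yU]
    noncomm_ring
  have h3 : ∀ s, Commute (y s) (E i) := fun s => h.ye s i
  have h4 := (((Commute.one_left (E i)).add_left (h3 (lo r))).add_left
    (h3 (Statement0.hi r))).add_left ((h3 (lo r)).mul_left (h3 (Statement0.hi r)))
  rw [← mul_assoc, ← mul_assoc, ← h.XcE, mul_assoc (X _), ← h.XcE, ← mul_assoc, h.XXE, h4.eq,
    smul_mul_assoc, mul_assoc, h2, ← sub_eq_zero, ← sub_smul, smul_eq_zero, sub_eq_zero] at h1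
  exact h1.resolve_left fun h' => hi (hχ.injective h')

lemma U_E_zero (hχ : IsChar q χ) (hi : i (lo r) + i (Statement0.hi r) ≠ (r.val : ZMod l)) :
    U r * E i = 0 := by
  have h1 : U r * (X (lo r) * X (Statement0.hi r)) * E i = χ r.val • (U r * E i) := by
    rw [h.U_XX, ← Algebra.smul_def, smul_mul_assoc]
  have h2 : U r * (1 + y (lo r) + y (Statement0.hi r) + y (lo r) * y (Statement0.hi r)) = U r := by
    rw [mul_add, mul_add, mul_add, ← mul_assoc, h.Uyy, h.Uy']
    noncomm_ring
  rw [mul_assoc, h.XXE, mul_smul_comm, ← mul_assoc, h2, ← sub_eq_zero, ← sub_smul, smul_eq_zero,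
    sub_eq_zero] at h1
  exact h1.resolve_left fun h' => hi (hχ.injective h')

lemma U_add (r : Fin (n - 1)) :
    U r * X (lo r) + U r * X (hi r) = X (lo r) * U r + X (hi r) * U r := by
  have h1 := h.lo_hi r
  have h2 := h.lo_hi' r
  have h3 := Algebra.commutes (A := A) q (X (lo r))
  have h4 := Algebra.commutes (A := A) q⁻¹ (X (hi r))
  linear_combination (norm := noncomm_ring) h1 - h2 - h3 - h4

lemma E_U_E_zero (hχ : IsChar q χ) (h1 : j ≠ i) (h2 : j ≠ sw r i) : E j * (U r * E i) = 0 := by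
  by_contra h0
  have h3 : j (lo r) + j (hi r) = (r.val : ZMod l) := by
    by_contra h3
    rw [← mul_assoc, h.E_U_zero r hχ h3, zero_mul] at h0
    exact h0 rfl
  have h4 : i (lo r) + i (hi r) = (r.val : ZMod l) := by
    by_contra h4
    rw [h.U_E_zero r hχ h4, mul_zero] at h0
    exact h0 rfl
  have h5 : ∀ s : Fin n, s ≠ lo r → s ≠ hi r → j s = i s := by
    intro s h5 h6
    by_contra h7
    exact h0 (h.E_U_E_far r (s := s) (by simpa [lo, Fin.ext_iff] using h5)
      (by simpa [hi, Fin.ext_iff] using h6) h7 hχ)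
  have h6 : (χ (j (lo r)) - χ (i (lo r))) * (χ (j (lo r)) - χ (i (hi r))) ≠ 0 := by
    intro h6
    rcases mul_eq_zero.1 h6 with h6 | h6
    · have h7 := hχ.injective (sub_eq_zero.1 h6)
      apply h1
      funext s
      by_cases h8 : s = lo r
      · rw [h8, h7]
      by_cases h9 : s = hi r
      · rw [h9]
        linear_combination h3 - h4 - h7
      · exact h5 s h8 h9
    · have h7 := hχ.injective (sub_eq_zero.1 h6)
      apply h2
      funext s
      by_cases h8 : s = lo r
      · rw [h8, h7, sw_lo]
      by_cases h9 : s = hi r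
      · rw [h9, sw_hi]
        linear_combination h3 - h4 - h7
      · rw [h5 s h8 h9, sw_of_ne i h8 h9]
  have h7 : (χ (j (lo r)) - χ (i (lo r))) * (χ (j (lo r)) - χ (i (hi r))) = χ (j (lo r)) *
      (χ (j (lo r)) + χ (j (hi r)) - χ (i (lo r)) - χ (i (hi r))) := by
    have h8 := AddChar.map_add_eq_mul χ (i (lo r)) (i (hi r))
    rw [h4, ← h3, AddChar.map_add_eq_mul] at h8
    linear_combination -h8
  rw [h7] at h6
  have hσ := right_ne_zero_of_mul h6
  have h8 := congrArg (fun w => E j * (w * E i)) (h.U_add r)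
  have e1 : E j * (U r * X (lo r) * E i) = χ (i (lo r)) • (E j * (U r * E i)) -
      χ (i (lo r)) • (E j * (U r * E i) * y (hi r)) := by
    rw [mul_assoc, h.XE', mul_add, mul_smul_comm, mul_smul_comm, ← mul_assoc (U r), h.Uy', neg_mul,
      mul_assoc (U r), h.ye]
    simp only [mul_add, mul_smul_comm, mul_assoc, mul_neg, smul_neg, sub_eq_add_neg]
  have e2 : E j * (U r * X (hi r) * E i) = χ (i (hi r)) • (E j * (U r * E i)) +
      χ (i (hi r)) • (E j * (U r * E i) * y (hi r)) := by
    rw [mul_assoc, h.XE', h.ye]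
    simp only [mul_add, mul_smul_comm, mul_assoc]
  have e3 : E j * (X (lo r) * U r * E i) = χ (j (lo r)) • (E j * (U r * E i)) -
      χ (j (lo r)) • (y (hi r) * (E j * (U r * E i))) := by
    rw [mul_assoc, ← mul_assoc, h.EX', h.yEa, add_mul, smul_mul_assoc, smul_mul_assoc, mul_assoc,
      ← mul_assoc (y _), h.yU]
    simp only [mul_assoc, neg_mul, mul_neg, smul_neg, sub_eq_add_neg]
  have e4 : E j * (X (hi r) * U r * E i) = χ (j (hi r)) • (E j * (U r * E i)) +
      χ (j (hi r)) • (y (hi r) * (E j * (U r * E i))) := by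
    rw [mul_assoc, ← mul_assoc, h.EX', h.yEa, add_mul, smul_mul_assoc, smul_mul_assoc, mul_assoc]
  simp only [add_mul, mul_add] at h8
  rw [e1, e2, e3, e4] at h8
  generalize E j * (U r * E i) = Z at *
  have hy := h.y_sq (hi r)
  generalize y (hi r) = t at *
  have h9 : (χ (j (lo r)) + χ (j (hi r)) - χ (i (lo r)) - χ (i (hi r))) • Z +
      (χ (j (hi r)) - χ (j (lo r))) • (t * Z) - (χ (i (hi r)) - χ (i (lo r))) • (Z * t) = 0 := by
    linear_combination (norm := module) -h8
  have hty : ∀ w, t * (t * w) = 0 := fun w => by rw [← mul_assoc, hy, zero_mul]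
  have h10 : t * (Z * t) = 0 := by
    have := congrArg (fun w => t * w * t) h9
    simp only [mul_add, mul_sub, sub_mul, mul_smul_comm, smul_mul_assoc, mul_assoc, hy,
      hty, mul_zero, smul_zero, add_zero, sub_zero, zero_mul] at this
    exact (smul_eq_zero.1 this).resolve_left hσ
  have h11 : t * Z = 0 := by
    have := congrArg (fun w => t * w) h9
    simp only [mul_add, mul_sub, mul_smul_comm, hty, h10, mul_zero, smul_zero, add_zero,
      sub_zero] at this
    exact (smul_eq_zero.1 this).resolve_left hσ
  have h12 : Z * t = 0 := by
    have := congrArg (fun w => w * t) h9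
    simp only [add_mul, sub_mul, smul_mul_assoc, mul_assoc, hy, h10, zero_mul, mul_zero, smul_zero,
      add_zero, sub_zero] at this
    exact (smul_eq_zero.1 this).resolve_left hσ
  rw [h11, h12, smul_zero, smul_zero, add_zero, sub_zero] at h9
  exact h0 ((smul_eq_zero.1 h9).resolve_left hσ)

/-- `e(i)` vanishes unless `i_{r+1} = i_r + 1` or `i_r + i_{r+1} = r`. -/
lemma idem_zero (hχ : IsChar q χ) (h1 : i (hi r) ≠ i (lo r) + 1)
    (h2 : i (lo r) + i (hi r) ≠ (r.val : ZMod l)) : E i = 0 := by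
  have h3 := congrArg (fun w => w * E i) (h.lo_hi r)
  simp only [add_mul, mul_add] at h3
  rw [mul_assoc, h.XcE, ← mul_assoc, h.U_E_zero r hχ h2, zero_mul, mul_assoc (X _),
    h.U_E_zero r hχ h2, mul_zero, zero_add, zero_add, ← Algebra.smul_def, ← Algebra.commutes,
    ← Algebra.smul_def, smul_mul_assoc, smul_mul_assoc, h.XE', h.XE'] at h3
  refine eq_zero_of_nil (σ := q * χ (i (lo r)) - q⁻¹ * χ (i (hi r))) (u := q * χ (i (lo r)))
    (v := -(q⁻¹ * χ (i (hi r)))) ?_ (h.yy (lo r) (hi r)) (h.y_sq _) (h.y_sq _) ?_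
  · intro h4
    have hq := hχ.q0
    refine h1 (hχ.injective ?_)
    rw [hχ.add_one]
    field_simp at h4
    linear_combination -h4
  · linear_combination (norm := module) h3

/-- The nilpotent parts cancel unless `i_{r+1} = i_r + 1`. -/
lemma y_neg (hχ : IsChar q χ) (h1 : i (hi r) ≠ i (lo r) + 1) :
    y (hi r) * E i = -(y (lo r) * E i) := by
  by_cases h2 : i (lo r) + i (hi r) = (r.val : ZMod l)
  swap
  · rw [h.idem_zero r hχ h1 h2]; simp
  have h3 := congrArg (fun w => w * E i) (hecke_quadratic hχ.q0 (Algebra.commutes (χ r.val))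
    (h.XX (lo r) (hi r)) (h.U_XX r) (h.lo_hi r))
  simp only [zero_mul] at h3
  rw [mul_assoc, sub_mul (X _ * X _), ← Algebra.smul_def, h.XXE, h2, ← Algebra.smul_def, ← smul_sub, mul_smul_comm,
    smul_eq_zero] at h3
  replace h3 := h3.resolve_left (IsChar.ne_zero _)
  have h5 : (1 + y (lo r) + y (hi r) + y (lo r) * y (hi r)) * E i - E i =
      E i * (y (lo r) + y (hi r) + y (lo r) * y (hi r)) := by
    have h6 : ∀ s, Commute (E i) (y s) := fun s => (h.ye s i).symm
    rw [(((h6 (lo r)).add_right (h6 (hi r))).add_right ((h6 (lo r)).mul_right (h6 (hi r)))).eq]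
    noncomm_ring
  rw [h5, sub_mul, h.XEa, smul_mul_assoc, h.XEa] at h3
  have h6 : E i * (y (lo r) + y (hi r) + y (lo r) * y (hi r)) = 0 := by
    refine eq_zero_of_nil (σ := χ (i (hi r)) - q ^ 2 * χ (i (lo r))) (v := χ (i (hi r)))
      (u := -(q ^ 2 * χ (i (lo r)))) ?_ (h.yy (lo r) (hi r)) (h.y_sq _) (h.y_sq _) ?_
    · intro h7
      refine h1 (hχ.injective ?_)
      rw [hχ.add_one]
      linear_combination h7
    · linear_combination (norm := module) h3
  rw [← h5] at h6
  have h7 : y (lo r) * (y (hi r) * E i) = 0 := by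
    have := congrArg (fun w => y (lo r) * w) h6
    simp only [mul_zero] at this
    rw [← this]
    have hy := h.y_sq (lo r)
    linear_combination (norm := noncomm_ring) -hy * E i - hy * y (hi r) * E i
  linear_combination (norm := noncomm_ring) h6 - h7

end IsJM

namespace IsJM

variable {A : Type*} [Ring A] [Algebra ℂ A] {l n : ℕ} [NeZero l] {q : ℂ} {χ : AddChar (ZMod l) ℂ}
  {U : Fin (n - 1) → A} {E : Res l n → A} {y X : Fin n → A}

variable (h : IsJM q χ U E y X)
include h

variable (r : Fin (n - 1)) {i : Res l n}

lemma U_E_eq (hχ : IsChar q χ) (h0 : i (hi r) = i (lo r)) :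
    U r * E i = E i * (U r * E i) := by
  rw [← one_mul (U r * E i), ← h.sum1, Finset.sum_mul, Finset.mul_sum]
  refine Finset.sum_congr rfl fun j _ => ?_
  by_cases h1 : j = i
  · rw [h1, h.EE]
  · rw [h.E_U_E_zero r hχ h1 (by rwa [sw_eq_self h0]), mul_zero]

lemma U_E_ne (hχ : IsChar q χ) (h0 : i (hi r) ≠ i (lo r)) :
    U r * E i = E (sw r i) * (U r * E i) + E i * (U r * E i) := by
  have h2 := sw_ne_self h0
  conv_lhs => rw [← one_mul (U r * E i), ← h.sum1, Finset.sum_mul]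
  rw [Finset.sum_eq_add (sw r i) i h2]
  · intro j _ h3
    exact h.E_U_E_zero r hχ h3.2 h3.1
  · simp
  · simp

lemma diag_lo : y (hi r) * (E i * (U r * E i)) = -(y (lo r) * (E i * (U r * E i))) := by
  rw [h.yEa, ← mul_assoc (y _), ← neg_eq_iff_eq_neg.2 (h.yU r), h.yEa]
  simp only [mul_assoc, neg_mul, mul_neg]

lemma diag_hi : E i * (U r * E i) * y (hi r) = -(E i * (U r * E i) * y (lo r)) := by
  rw [mul_assoc, mul_assoc, ← h.ye, ← mul_assoc (U r), ← neg_eq_iff_eq_neg.2 (h.Uy' r), mul_assoc,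
    mul_assoc, ← h.ye (lo r)]
  simp only [mul_assoc, neg_mul, mul_neg]

lemma diag_X (s : Fin n) : E i * (U r * X s * E i) =
    χ (i s) • (E i * (U r * E i)) + χ (i s) • (E i * (U r * E i) * y s) := by
  rw [mul_assoc, h.XE', h.ye]
  simp only [mul_add, mul_smul_comm, mul_assoc]

lemma X_diag (s : Fin n) : E i * (X s * U r * E i) =
    χ (i s) • (E i * (U r * E i)) + χ (i s) • (y s * (E i * (U r * E i))) := by
  rw [mul_assoc, ← mul_assoc, h.EX', h.yEa, add_mul, smul_mul_assoc, smul_mul_assoc, mul_assoc]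

lemma EXE (s : Fin n) : E i * (X s * E i) = χ (i s) • E i + χ (i s) • (y s * E i) := by
  rw [h.XE', mul_add, mul_smul_comm, mul_smul_comm, h.idem, ← h.yEa, h.idem]

lemma diag_rel : χ (i (lo r)) • (E i * (U r * E i)) +
      χ (i (lo r)) • (E i * (U r * E i) * y (lo r)) - χ (i (hi r)) • (E i * (U r * E i)) +
      χ (i (hi r)) • (y (lo r) * (E i * (U r * E i))) =
    (q⁻¹ * χ (i (hi r)) - q * χ (i (lo r))) • E i + (q⁻¹ * χ (i (hi r))) • (y (hi r) * E i) -
      (q * χ (i (lo r))) • (y (lo r) * E i) := by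
  have h1 := congrArg (fun w => E i * (w * E i)) (h.lo_hi r)
  simp only [add_mul, mul_add] at h1
  rw [h.diag_X, h.X_diag, ← Algebra.commutes, ← Algebra.smul_def, ← Algebra.smul_def,
    smul_mul_assoc, smul_mul_assoc, mul_smul_comm, mul_smul_comm, h.EXE, h.EXE, h.diag_lo] at h1
  linear_combination (norm := module) h1

lemma diag_rel' : χ (i (lo r)) • (E i * (U r * E i)) +
      χ (i (lo r)) • (y (lo r) * (E i * (U r * E i))) - χ (i (hi r)) • (E i * (U r * E i)) +
      χ (i (hi r)) • (E i * (U r * E i) * y (lo r)) =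
    (q⁻¹ * χ (i (hi r)) - q * χ (i (lo r))) • E i + (q⁻¹ * χ (i (hi r))) • (y (hi r) * E i) -
      (q * χ (i (lo r))) • (y (lo r) * E i) := by
  have h1 := congrArg (fun w => E i * (w * E i)) (h.lo_hi' r)
  simp only [add_mul, mul_add] at h1
  rw [h.diag_X, h.X_diag, ← Algebra.commutes, ← Algebra.smul_def, ← Algebra.smul_def,
    smul_mul_assoc, smul_mul_assoc, mul_smul_comm, mul_smul_comm, h.EXE, h.EXE, h.diag_hi] at h1
  linear_combination (norm := module) h1

lemma diag_comm (hχ : IsChar q χ) (h0 : i (hi r) ≠ i (lo r)) :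
    E i * (U r * E i) * y (lo r) = y (lo r) * (E i * (U r * E i)) := by
  have h1 := h.diag_rel r (i := i)
  rw [← h.diag_rel' r, ← sub_eq_zero] at h1
  have h2 : (χ (i (lo r)) - χ (i (hi r))) •
      (E i * (U r * E i) * y (lo r) - y (lo r) * (E i * (U r * E i))) = 0 := by
    linear_combination (norm := module) h1
  rw [smul_eq_zero, sub_eq_zero, sub_eq_zero] at h2
  exact h2.resolve_left fun h3 => h0 (hχ.injective h3).symm

/-- The component of `U_r` commuting with `e(i)`, for `i_r ≠ i_{r+1}`. -/
lemma diag_eq_uC (hχ : IsChar q χ) (h1 : (1 : ZMod l) ≠ 0) (h0 : i (hi r) ≠ i (lo r)) :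
    E i * (U r * E i) = uC q χ (i (hi r) - i (lo r)) (y (lo r)) (y (hi r)) * E i := by
  have h2 := h.diag_rel r (i := i)
  rw [h.diag_comm r hχ h0] at h2
  have hd := sub_ne_zero.2 h0
  have hχd : χ (i (hi r)) = χ (i (lo r)) * χ (i (hi r) - i (lo r)) := by
    rw [← AddChar.map_add_eq_mul, add_sub_cancel]
  have ha := IsChar.ne_zero (χ := χ) (i (lo r))
  have hq := hχ.q0
  rw [uC, if_neg hd]
  split_ifs with hd1
  · have hδ := hχ.delta_ne h1
    rw [hd1, hχ.one] at hχd
    rw [hχd] at h2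
    have h3 : aff (-(q - q⁻¹), q + q⁻¹) (y (lo r)) * (E i * (U r * E i)) =
        (y (hi r) - y (lo r)) * E i := by
      refine smul_right_injective A (mul_ne_zero hq ha) ?_
      simp only [aff, add_mul, sub_mul, ← Algebra.smul_def, smul_mul_assoc]
      have e1 : q⁻¹ * (χ (i (lo r)) * q ^ 2) = q * χ (i (lo r)) := by field_simp
      have e2 : χ (i (lo r)) * q ^ 2 = (q * χ (i (lo r))) * q := by ring
      have e3 : χ (i (lo r)) = (q * χ (i (lo r))) * q⁻¹ := by field_simp
      rw [e1, e2] at h2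
      nth_rewrite 1 2 [e3] at h2
      linear_combination (norm := module) h2
    have h4 : aff (ch q) (y (lo r)) * aff (-(q - q⁻¹), q + q⁻¹) (y (lo r)) = 1 := by
      rw [aff_mul_eq (h.y_sq _) (x := 1), map_one] <;> simp only [ch] <;> (
        generalize q - q⁻¹ = z at *; field_simp; try ring)
    rw [← one_mul (E i * (U r * E i)), ← h4, mul_assoc, h3, ← mul_assoc]
    congr 1
    exact aff_mul_of_comm _ (by rw [mul_sub, sub_mul, h.yy])
  · have h3 : i (hi r) ≠ i (lo r) + 1 := fun h4 => hd1 (by rw [h4, add_sub_cancel_left])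
    rw [h.y_neg r hχ h3, hχd] at h2
    generalize i (hi r) - i (lo r) = d at *
    have hd' := hχ.ne_one hd
    have h4 : aff (1 - χ d, 1 + χ d) (y (lo r)) * (E i * (U r * E i)) =
        aff (q⁻¹ * χ d - q, -(q⁻¹ * χ d + q)) (y (lo r)) * E i := by
      refine smul_right_injective A ha ?_
      simp only [aff, add_mul, ← Algebra.smul_def, smul_mul_assoc]
      linear_combination (norm := module) h2
    have h5 : aff (affInv (1 - χ d, 1 + χ d)) (y (lo r)) *
        aff (q⁻¹ * χ d - q, -(q⁻¹ * χ d + q)) (y (lo r)) = aff (cD q χ d) (y (lo r)) := by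
      rw [aff_mul_aff (h.y_sq _)]
      congr 1
      simp only [affInv, cD]
      ext
      · simp only
        field_simp
      · simp only
        field_simp
        ring
    rw [← one_mul (E i * (U r * E i)), ← affInv_mul_aff (c := (1 - χ d, 1 + χ d)) hd' (h.y_sq (lo r)),
      mul_assoc, h4, ← mul_assoc, h5]

lemma diag_eq_anticomm (h0 : i (hi r) = i (lo r)) (hχ : IsChar q χ) (h1 : (1 : ZMod l) ≠ 0) :
    E i * (U r * E i) * y (lo r) = -(y (lo r) * (E i * (U r * E i))) -
      aff (cg q) (y (lo r)) * E i := by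
  have h2 := h.diag_rel r (i := i)
  rw [h.y_neg r hχ (by rw [h0]; simpa using h1), h0] at h2
  refine smul_right_injective A (IsChar.ne_zero (χ := χ) (i (lo r))) ?_
  simp only [aff, add_mul, ← Algebra.smul_def, smul_mul_assoc, cg]
  linear_combination (norm := module) h2

lemma off_lo (h0 : i (hi r) ≠ i (lo r)) :
    E (sw r i) * (U r * E i) * y (lo r) = y (hi r) * (E (sw r i) * (U r * E i)) := by
  have h1 := congrArg (fun w => E (sw r i) * (w * E i)) (h.lo_hi r)
  simp only [add_mul, mul_add] at h1
  rw [← Algebra.commutes, ← Algebra.smul_def, ← Algebra.smul_def, smul_mul_assoc, smul_mul_assoc,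
    mul_smul_comm, mul_smul_comm, h.XcE, h.XcE, h.EE_ne (sw_ne_self h0), h.EE_ne (sw_ne_self h0),
    smul_zero, smul_zero, add_zero, add_zero, mul_assoc, h.XE', mul_assoc, ← mul_assoc _ (X _), h.EX',
    sw_hi, h.ye, add_mul, smul_mul_assoc, smul_mul_assoc, mul_add, mul_smul_comm, mul_smul_comm,
    mul_add, mul_smul_comm, mul_smul_comm, add_left_cancel_iff] at h1
  have h2 := smul_right_injective A (IsChar.ne_zero (χ := χ) (i (lo r))) h1
  rw [h.yEa, ← mul_assoc (y _) (U r), mul_assoc, mul_assoc, h2]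
  simp only [mul_assoc]

lemma off_hi (h0 : i (hi r) ≠ i (lo r)) :
    E (sw r i) * (U r * E i) * y (hi r) = y (lo r) * (E (sw r i) * (U r * E i)) := by
  have h1 := h.off_lo r h0
  have h2 : E (sw r i) * (U r * E i) * (y (lo r) + y (hi r)) = 0 := by
    rw [mul_assoc, mul_assoc, mul_add, ← h.ye, ← h.ye, ← add_mul, ← mul_assoc (U r),
      mul_add (U r), h.Uy', neg_add_cancel, zero_mul, mul_zero]
  have h3 : (y (lo r) + y (hi r)) * (E (sw r i) * (U r * E i)) = 0 := by
    rw [add_mul, h.yEa, h.yEa, ← mul_add, ← mul_assoc (y _), ← mul_assoc (y _), h.yU, neg_mul,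
      neg_add_cancel, mul_zero]
  rw [mul_add, h1] at h2
  rw [add_mul] at h3
  linear_combination (norm := abel) h2 - h3

variable {m : ℤ} {e : A} (hb : IsBlob q m e U)
include hb

lemma diag_sq (hχ : IsChar q χ) (h0 : i (hi r) = i (lo r)) :
    E i * (U r * E i) * (E i * (U r * E i)) = -(q + q⁻¹) • (E i * (U r * E i)) := by
  rw [← h.U_E_eq r hχ h0, mul_assoc, h.U_E_eq r hχ h0, h.EE, ← h.U_E_eq r hχ h0, ← mul_assoc,
    hb.Usq, smul_mul_assoc]

lemma diag_y_diag (h0 : i (hi r) = i (lo r)) (hχ : IsChar q χ) (h1 : (1 : ZMod l) ≠ 0) :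
    E i * (U r * E i) * (y (lo r) * (E i * (U r * E i))) = -(q - q⁻¹) • (E i * (U r * E i)) := by
  have h2 := h.diag_sq r hb hχ h0
  have h3 := h.diag_eq_anticomm r h0 hχ h1
  rw [← mul_assoc, h3, sub_mul, neg_mul, mul_assoc (y _), h2, mul_assoc (aff _ _), h.EE]
  simp only [aff, cg, add_mul, ← Algebra.smul_def, smul_mul_assoc, mul_smul_comm]
  module

lemma off_off (hχ : IsChar q χ) (h0 : i (hi r) ≠ i (lo r)) :
    E i * (U r * E (sw r i)) * (E (sw r i) * (U r * E i)) = -(q + q⁻¹) • (E i * (U r * E i)) -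
      E i * (U r * E i) * (E i * (U r * E i)) := by
  have h1 : E i * U r * (U r * E i) = -(q + q⁻¹) • (E i * (U r * E i)) := by
    rw [mul_assoc, ← mul_assoc (U r), hb.Usq, smul_mul_assoc, mul_smul_comm]
  nth_rw 1 [h.U_E_ne r hχ h0] at h1
  rw [mul_add] at h1
  rw [← h1]
  have h2 := h.idem
  have h3 := h2 i
  have h4 := h2 (sw r i)
  linear_combination (norm := noncomm_ring) E i * U r * h4 * U r * E i + E i * U r * h3 * U r * E i

end IsJM

/-- The images of the generators `ψ_r` in the blob algebra. -/
def pJ {A : Type*} [Ring A] [Algebra ℂ A] {l n : ℕ} [NeZero l] (q : ℂ) (χ : AddChar (ZMod l) ℂ)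
    (U : Fin (n - 1) → A) (E : Res l n → A) (y : Fin n → A) (r : Fin (n - 1)) : A :=
  ∑ i : Res l n, E (sw r i) * (U r * E i) *
    aff (affInv (cG q χ (i (hi r) - i (lo r)))) (y (lo r))

namespace IsJM

variable {A : Type*} [Ring A] [Algebra ℂ A] {l n : ℕ} [NeZero l] {q : ℂ} {χ : AddChar (ZMod l) ℂ}
  {U : Fin (n - 1) → A} {E : Res l n → A} {y X : Fin n → A}

variable (h : IsJM q χ U E y X)
include h

lemma aff_E (c : ℂ × ℂ) (r : Fin n) (i : Res l n) : aff c (y r) * E i = E i * aff c (y r) :=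
  aff_mul_of_comm c (h.ye r i)

lemma aff_y (c : ℂ × ℂ) (r s : Fin n) : aff c (y r) * y s = y s * aff c (y r) :=
  aff_mul_of_comm c (h.yy r s)

variable (r : Fin (n - 1)) (i : Res l n)

lemma pJ_E : pJ q χ U E y r * E i = E (sw r i) * (U r * E i) *
    aff (affInv (cG q χ (i (hi r) - i (lo r)))) (y (lo r)) := by
  rw [pJ, Finset.sum_mul, Finset.sum_eq_single i]
  · rw [mul_assoc, h.aff_E, mul_assoc, mul_assoc, h.EE, mul_assoc, mul_assoc]
  · intro j _ hj
    rw [mul_assoc, h.aff_E, mul_assoc, mul_assoc, h.EE_ne hj, mul_zero, mul_zero]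
  · simp

lemma psie : pJ q χ U E y r * E i = E (sw r i) * pJ q χ U E y r := by
  rw [h.pJ_E, pJ, Finset.mul_sum, Finset.sum_eq_single i]
  · rw [← mul_assoc (E _) (_ * _), h.EE]
  · intro j _ hj
    rw [← mul_assoc (E _) (_ * _), h.EE_ne, zero_mul]
    exact fun h' => hj (by rw [← sw_sw r j, ← h', sw_sw])
  · simp

lemma pJ_y (s : Fin n) (h1 : s.val ≠ r.val) (h2 : s.val ≠ r.val + 1) :
    pJ q χ U E y r * y s = y s * pJ q χ U E y r := by
  refine h.ext_E fun i => ?_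
  rw [mul_assoc, h.ye, ← mul_assoc, mul_assoc (y s), h.pJ_E, mul_assoc, h.aff_y, ← mul_assoc,
    mul_assoc _ _ (y s), mul_assoc _ _ (y s), ← h.ye, ← mul_assoc (U r), h.Uy r s h1 h2,
    ← mul_assoc (y s), h.yEa, mul_assoc (y s)]

variable {i} (hχ : IsChar q χ) (h1 : (1 : ZMod l) ≠ 0)
include hχ h1

lemma pJ_aff : pJ q χ U E y r * aff (cG q χ (i (hi r) - i (lo r))) (y (lo r)) * E i =
    E (sw r i) * (U r * E i) := by
  rw [mul_assoc, h.aff_E, ← mul_assoc, h.pJ_E, mul_assoc,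
    affInv_mul_aff (hχ.cG_fst_ne h1 _) (h.y_sq _), mul_one]

lemma py : pJ q χ U E y r * (y (hi r) * E i) =
    (y (lo r) * pJ q χ U E y r + if i (lo r) = i (hi r) then 1 else 0) * E i := by
  rw [h.ye, ← mul_assoc, add_mul, mul_assoc (y _), h.pJ_E, mul_assoc, h.aff_y, ← mul_assoc]
  split_ifs with h0
  · rw [sw_eq_self h0.symm, h.diag_hi, h.diag_eq_anticomm r h0.symm hχ h1, one_mul, ← h0, sub_self]
    rw [neg_sub, sub_neg_eq_add, add_mul, mul_assoc (y _), add_comm, mul_assoc (aff _ _), ← h.aff_E,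
      ← mul_assoc (aff _ _), cG, if_pos rfl,
      aff_mul_affInv (by simpa [cG] using hχ.cG_fst_ne h1 0) (h.y_sq _), one_mul]
  · rw [h.off_hi r (Ne.symm h0), zero_mul, add_zero, mul_assoc]

lemma yp : y (hi r) * (pJ q χ U E y r * E i) =
    (pJ q χ U E y r * y (lo r) + if i (lo r) = i (hi r) then 1 else 0) * E i := by
  rw [add_mul, mul_assoc _ (y _), h.ye, ← mul_assoc _ (E i), h.pJ_E, mul_assoc _ _ (y _), h.aff_y,
    ← mul_assoc (y _), ← mul_assoc _ (y _)]
  split_ifs with h0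
  · rw [sw_eq_self h0.symm, h.diag_lo, h.diag_eq_anticomm r h0.symm hχ h1, one_mul, ← h0, sub_self]
    rw [sub_mul, mul_assoc _ (E i), ← h.aff_E, ← mul_assoc (aff _ _), cG, if_pos rfl,
      aff_mul_affInv (by simpa [cG] using hχ.cG_fst_ne h1 0) (h.y_sq _), one_mul, sub_add_cancel]
  · rw [h.off_lo r (Ne.symm h0), zero_mul, add_zero]

lemma UB_pJ : UB q χ E y (pJ q χ U E y) r = U r := by
  refine h.ext_E fun i => ?_
  have h2 : UB q χ E y (pJ q χ U E y) r * E i =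
      (pJ q χ U E y r * aff (cG q χ (i (hi r) - i (lo r))) (y (lo r)) +
        uC q χ (i (hi r) - i (lo r)) (y (lo r)) (y (hi r))) * E i := by
    rw [UB, Finset.sum_mul, Finset.sum_eq_single i]
    · rw [mul_assoc, h.idem]
    · intro j _ hj
      rw [mul_assoc, h.orth j i hj, mul_zero]
    · simp
  rw [h2, add_mul, h.pJ_aff r hχ h1]
  by_cases h0 : i (hi r) = i (lo r)
  · rw [sw_eq_self h0, ← h.U_E_eq r hχ h0, uC, if_pos (by rw [h0, sub_self]), zero_mul, add_zero]
  · rw [← h.diag_eq_uC r hχ h1 h0, ← h.U_E_ne r hχ h0]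

end IsJM

lemma sub_mul_sub_of_sq_zero {A : Type*} [Ring A] {a b α β D τ : A} (hab : a * b = b * a)
    (ha : a * a = 0) (hb : b * b = 0) (h1 : α * a = a * α) (h2 : α * b = b * α)
    (h3 : β * a = a * β) (h4 : β * b = b * β) (h5 : D * a = a * D) (h6 : D * b = b * D)
    (h7 : D + 2 * b * (α + β * -b) = τ) :
    (τ - (b - a) * (α + β * a)) * (b - a) = (b - a) * D := by
  linear_combination (norm := noncomm_ring) -h7 * (b - a) + h6 - h5 + b * h2 + hb * α - b * h1 +
    a * h2 + hab * α - a * h1 - ha * α - 2 * b * β * hb + 2 * b * h4 * a + 2 * hb * β * a -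
    b * h3 * b - b * a * h4 - b * hab * β - hb * a * β + b * β * ha + a * h3 * b + ha * β * b -
    a * β * ha

namespace IsJM

variable {A : Type*} [Ring A] [Algebra ℂ A] {l n : ℕ} [NeZero l] {q : ℂ} {χ : AddChar (ZMod l) ℂ}
  {U : Fin (n - 1) → A} {E : Res l n → A} {y X : Fin n → A}

variable (h : IsJM q χ U E y X)
include h

variable {m : ℤ} {e : A} (hb : IsBlob q m e U) (r : Fin (n - 1)) {i : Res l n}
include hb

lemma pJ_pJ_ne (hχ : IsChar q χ) (h1 : (1 : ZMod l) ≠ 0) (h0 : i (hi r) ≠ i (lo r)) :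
    pJ q χ U E y r * pJ q χ U E y r * E i =
      (-algebraMap ℂ A (q + q⁻¹) - uC q χ (i (hi r) - i (lo r)) (y (lo r)) (y (hi r))) *
        uC q χ (i (hi r) - i (lo r)) (y (lo r)) (y (hi r)) *
        (aff (affInv (cG q χ (i (hi r) - i (lo r)))) (y (lo r)) *
          (aff (affInv (cG q χ (-(i (hi r) - i (lo r))))) (y (hi r)) * E i)) := by
  have e1 := h.pJ_E r (sw r i)
  rw [sw_sw, sw_hi, sw_lo] at e1
  have e2 := h.pJ_E r i
  have e3 := h.off_off r hb hχ h0
  have e4 : ∀ c, aff c (y (lo r)) * (E (sw r i) * (U r * E i)) =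
      (E (sw r i) * (U r * E i)) * aff c (y (hi r)) := fun c =>
    aff_mul_of_comm c (h.off_hi r h0).symm
  have e5 := h.diag_eq_uC r hχ h1 h0
  have c1 : Commute (E i) (uC q χ (i (hi r) - i (lo r)) (y (lo r)) (y (hi r))) :=
    (Commute.uC _ _ _ (h.ye _ _) (h.ye _ _)).symm
  have c2 : ∀ c r, Commute (E i) (aff c (y r)) := fun c r => (h.aff_E c r i).symm
  have c3 : ∀ c c' r s, Commute (aff c (y r)) (aff c' (y s)) := fun c c' r s =>
    Commute.aff c (Commute.aff c' (h.yy s r)).symm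
  rw [mul_assoc, e2, ← h.EE, mul_assoc, ← mul_assoc (pJ q χ U E y r), e1, neg_sub, mul_assoc,
    ← mul_assoc (aff _ _), e4, ← mul_assoc, ← mul_assoc, e3, e5, mul_assoc _ (aff _ _), (c3 _ _ _ _).eq,
    neg_smul, Algebra.smul_def]
  generalize uC q χ (i (hi r) - i (lo r)) (y (lo r)) (y (hi r)) = u at *
  rw [mul_assoc u (E i), ← mul_assoc (E i) u, c1.eq, mul_assoc u (E i), h.idem, ← mul_assoc u u,
    ← neg_mul, ← mul_assoc _ u (E i), ← sub_mul, ← sub_mul, mul_assoc _ (E i), ((c2 _ _).mul_right (c2 _ _)).eq,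
    mul_assoc (aff _ _)]

lemma pJ_sq (hχ : IsChar q χ) (h1 : (1 : ZMod l) ≠ 0) (h2 : (2 : ZMod l) ≠ 0) :
    pJ q χ U E y r * pJ q χ U E y r * E i =
    (if i (hi r) = i (lo r) then 0
      else if i (hi r) = i (lo r) + 1 then y (hi r) - y (lo r)
      else if i (hi r) = i (lo r) - 1 then y (lo r) - y (hi r)
      else 1) * E i := by
  by_cases h0 : i (hi r) = i (lo r)
  · rw [if_pos h0, zero_mul, mul_assoc, h.pJ_E, sw_eq_self h0, ← h.EE, ← mul_assoc, ← mul_assoc, h.pJ_E,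
      sw_eq_self h0, h0, sub_self, cG, if_pos rfl]
    have e1 := h.diag_sq r hb hχ h0
    have e2 := h.diag_y_diag r hb h0 hχ h1
    have hδ := hχ.delta_ne h1
    have e3 : E i * (U r * E i) * (aff (affInv (cg q)) (y (lo r)) * (E i * (U r * E i))) = 0 := by
      rw [aff, add_mul, mul_assoc (algebraMap _ _ _) (y _), ← Algebra.smul_def, ← Algebra.smul_def, mul_add, mul_smul_comm,
        mul_smul_comm, e1, e2, smul_smul, smul_smul, ← add_smul]
      convert zero_smul ℂ _
      simp only [affInv, cg]
      generalize q - q⁻¹ = z at *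
      field_simp
      ring
    rw [mul_assoc _ (aff _ _), e3, zero_mul]
  rw [if_neg h0, h.pJ_pJ_ne hb r hχ h1 h0]
  have hg : ∀ d c, cG q χ d = c → c.1 ≠ 0 := fun d c hc => hc ▸ hχ.cG_fst_ne h1 d
  have c1 := h.yy (lo r) (hi r)
  split_ifs with hd1 hd2
  · have ed : i (hi r) - i (lo r) = 1 := by rw [hd1, add_sub_cancel_left]
    have g1 : cG q χ 1 = ch q := by rw [cG, if_neg h1, if_pos rfl]
    have g2 : cG q χ (-1) = cD q χ (-1) := by
      rw [cG, if_neg (neg_ne_zero.2 h1), if_neg]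
      intro h'; apply h2; linear_combination -h'
    rw [ed, g1, g2, uC, if_neg h1, if_pos rfl]
    have k1 := hχ.cD_neg_one h1 (h.y_sq (hi r))
    have k2 := aff_mul_affInv (hg _ _ g1) (h.y_sq (lo r))
    have k3 := aff_mul_affInv (hg _ _ g2) (h.y_sq (hi r))
    have k4 : (-algebraMap ℂ A (q + q⁻¹) - (y (hi r) - y (lo r)) * aff (ch q) (y (lo r))) *
        (y (hi r) - y (lo r)) = (y (hi r) - y (lo r)) * aff (cD q χ (-1)) (y (hi r)) := by
      exact sub_mul_sub_of_sq_zero c1 (h.y_sq _) (h.y_sq _) (Algebra.commutes _ _)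
        (Algebra.commutes _ _) (Algebra.commutes _ _) (Algebra.commutes _ _) (h.aff_y _ _ _)
        (h.aff_y _ _ _) k1
    rw [← mul_assoc (_ - _), k4, mul_assoc, ← mul_assoc (aff (ch q) _), k2, one_mul, mul_assoc,
      ← mul_assoc (aff _ _), k3, one_mul]
  · have ed : i (hi r) - i (lo r) = -1 := by rw [hd2]; ring
    have g1 : cG q χ 1 = ch q := by rw [cG, if_neg h1, if_pos rfl]
    have d1 : (-1 : ZMod l) ≠ 1 := fun h' => h2 (by linear_combination -h')
    have d0 : (-1 : ZMod l) ≠ 0 := neg_ne_zero.2 h1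
    have g2 : cG q χ (-1) = cD q χ (-1) := by rw [cG, if_neg d0, if_neg d1]
    have k1 := hχ.cD_neg_one h1 (h.y_sq (lo r))
    have k2 := aff_mul_affInv (hg _ _ g2) (h.y_sq (lo r))
    have k3 := aff_mul_affInv (t := -y (lo r)) (hg _ _ g1) (by rw [neg_mul_neg, h.y_sq])
    have k4 := h.y_neg r hχ hd1
    have k5 : ∀ c, aff c (y (hi r)) * E i = aff c (-y (lo r)) * E i := fun c =>
      aff_mul_congr c (by rw [k4, neg_mul])
    rw [ed, neg_neg, g1, g2, uC, if_neg d0, if_neg d1, ← k1, add_sub_cancel_left,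
      k5, mul_assoc, ← mul_assoc (aff (cD _ _ _) _),
      k2, one_mul, mul_assoc, ← mul_assoc (aff _ _), k3, one_mul, sub_mul, k4]
    noncomm_ring
  · have d0 : i (hi r) - i (lo r) ≠ 0 := sub_ne_zero.2 h0
    have d1 : i (hi r) - i (lo r) ≠ 1 := fun h' => hd1 (by linear_combination h')
    have d2 : -(i (hi r) - i (lo r)) ≠ 0 := neg_ne_zero.2 d0
    have d3 : -(i (hi r) - i (lo r)) ≠ 1 := fun h' => hd2 (by linear_combination -h')
    have g1 : cG q χ (i (hi r) - i (lo r)) = cD q χ (i (hi r) - i (lo r)) := by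
      rw [cG, if_neg d0, if_neg d1]
    have g2 : cG q χ (-(i (hi r) - i (lo r))) = cD q χ (-(i (hi r) - i (lo r))) := by
      rw [cG, if_neg d2, if_neg d3]
    have k1 := IsChar.cD_add hχ (t := y (lo r)) d0
    have k2 := aff_mul_affInv (hg _ _ g1) (h.y_sq (lo r))
    have k3 := aff_mul_affInv (t := -y (lo r)) (hg _ _ g2) (by rw [neg_mul_neg, h.y_sq])
    have k4 := h.y_neg r hχ hd1
    have k5 : ∀ c, aff c (y (hi r)) * E i = aff c (-y (lo r)) * E i := fun c =>
      aff_mul_congr c (by rw [k4, neg_mul])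
    rw [g1, g2, uC, if_neg d0, if_neg d1, ← k1, add_sub_cancel_left,
      k5, mul_assoc,
      ← mul_assoc (aff _ _) (aff (affInv _) _), k2, one_mul, ← mul_assoc, k3]

end IsJM

namespace IsJM

variable {A : Type*} [Ring A] [Algebra ℂ A] {l n : ℕ} [NeZero l] {q : ℂ} {χ : AddChar (ZMod l) ℂ}
  {U : Fin (n - 1) → A} {E : Res l n → A} {y X : Fin n → A}

variable (h : IsJM q χ U E y X)
include h

lemma affEa (c : ℂ × ℂ) (r : Fin n) (i : Res l n) (a : A) :
    aff c (y r) * (E i * a) = E i * (aff c (y r) * a) := by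
  rw [← mul_assoc, h.aff_E, mul_assoc]

lemma affUa (c : ℂ × ℂ) {r : Fin n} {s : Fin (n - 1)} (h1 : r.val ≠ s.val)
    (h2 : r.val ≠ s.val + 1) (a : A) : aff c (y r) * (U s * a) = U s * (aff c (y r) * a) := by
  rw [← mul_assoc, aff_mul_of_comm c (h.Uy s r h1 h2).symm, mul_assoc]

section Far

variable {r s : Fin (n - 1)} (ht : r.val + 1 < s.val ∨ s.val + 1 < r.val) (hχ : IsChar q χ)
include ht hχ

lemma off_U_U (i : Res l n) : E (sw r (sw s i)) * (U r * (E (sw s i) * (U s * E i))) =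
    E (sw r (sw s i)) * (U r * (U s * E i)) := by
  by_cases h0 : i (hi s) = i (lo s)
  · rw [sw_eq_self h0, ← h.U_E_eq s hχ h0]
  · rw [h.U_E_ne s hχ h0, mul_add, h.EE, h.EE_ne (sw_ne_self h0), add_zero, mul_add, mul_add,
      ← mul_assoc (U r) (E i), ← mul_assoc _ (U r * E i), h.E_U_E_far r (s := lo s) ?_ ?_ ?_ hχ,
      zero_mul, add_zero]
    · simp only [lo]; omega
    · simp only [lo]; omega
    · rwa [sw_of_ne, sw_lo]
      · simp only [lo, ne_eq, Fin.mk.injEq]; omega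
      · simp only [lo, hi, ne_eq, Fin.mk.injEq]; omega

lemma pJ_pJ_far (i : Res l n) : pJ q χ U E y r * pJ q χ U E y s * E i =
    E (sw r (sw s i)) * (U r * (U s * E i)) * (aff (affInv (cG q χ (i (hi r) - i (lo r)))) (y (lo r)) *
      aff (affInv (cG q χ (i (hi s) - i (lo s)))) (y (lo s))) := by
  have e1 := h.pJ_E (χ := χ) r (sw s i)
  rw [sw_hi_of_far ht, sw_lo_of_far ht] at e1
  rw [mul_assoc, h.pJ_E, ← h.EE, mul_assoc, ← mul_assoc (pJ _ _ _ _ _ _) (E _), e1,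
    ← h.off_U_U ht hχ]
  simp only [mul_assoc]
  rw [h.affEa, h.EE, h.affUa _ (by simp only [lo]; omega) (by simp only [lo]; omega), h.affEa]

end Far

lemma pp {m : ℤ} {e : A} (hb : IsBlob q m e U) (hχ : IsChar q χ) {r s : Fin (n - 1)}
    (ht : r.val + 1 < s.val ∨ s.val + 1 < r.val) :
    pJ q χ U E y r * pJ q χ U E y s = pJ q χ U E y s * pJ q χ U E y r := by
  refine h.ext_E fun i => ?_
  have hc : ∀ c c' r s, Commute (aff c (y r)) (aff c' (y s)) := fun c c' r s =>
    Commute.aff c (Commute.aff c' (h.yy s r)).symm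
  rw [h.pJ_pJ_far ht hχ, h.pJ_pJ_far ht.symm hχ, sw_comm ht, (hc _ _ _ _).eq, ← mul_assoc (U r),
    hb.Ucomm r s ht, mul_assoc (U s)]

end IsJM

lemma IsChar.affInv_ch_mul_cg {A : Type*} [Ring A] [Algebra ℂ A] {l : ℕ} {q : ℂ}
    {χ : AddChar (ZMod l) ℂ} (hχ : IsChar q χ) (h1 : (1 : ZMod l) ≠ 0) {t : A} (ht : t * t = 0) :
    aff (affInv (ch q)) (-t) * aff (affInv (cg q)) t = -1 := by
  have hδ := hχ.delta_ne h1
  have e1 := affInv_mul_aff (c := ch q) (t := -t) (neg_ne_zero.2 (inv_ne_zero hδ))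
    (by rw [neg_mul_neg, ht])
  have e2 := aff_mul_affInv (c := cg q) hδ ht
  have e3 := hχ.ch_mul_cg h1 ht
  generalize aff (ch q) (-t) = x at *
  generalize aff (cg q) t = z at *
  generalize aff (affInv (ch q)) (-t) = x' at *
  generalize aff (affInv (cg q)) t = z' at *
  linear_combination (norm := noncomm_ring) x' * e3 * z' - e1 * z * z' - e2

namespace IsJM

variable {A : Type*} [Ring A] [Algebra ℂ A] {l n : ℕ} [NeZero l] {q : ℂ} {χ : AddChar (ZMod l) ℂ}
  {U : Fin (n - 1) → A} {E : Res l n → A} {y X : Fin n → A}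

variable (h : IsJM q χ U E y X)
include h

lemma pJ_E_zero (hχ : IsChar q χ) (r : Fin (n - 1)) {i : Res l n}
    (hi : i (lo r) + i (Statement0.hi r) ≠ (r.val : ZMod l)) : pJ q χ U E y r * E i = 0 := by
  rw [h.pJ_E, h.U_E_zero r hχ hi, mul_zero, zero_mul]

lemma yc (c c' : ℂ × ℂ) (r s : Fin n) (a : A) :
    aff c (y r) * (aff c' (y s) * a) = aff c' (y s) * (aff c (y r) * a) := by
  rw [← mul_assoc, (Commute.aff c (Commute.aff c' (h.yy s r)).symm).eq, mul_assoc]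

variable {m : ℤ} {e : A} (hb : IsBlob q m e U) {r s : Fin (n - 1)} (hs : s.val = r.val + 1)
  (hχ : IsChar q χ) (h1 : (1 : ZMod l) ≠ 0) (h2 : (2 : ZMod l) ≠ 0) {i : Res l n}
include hs hχ h1

omit h1 in
lemma pJ_rsr_zero (h0 : ¬(i (hi s) = i (lo r) ∧ i (lo s) = i (lo r) - 1 ∧
    2 * i (lo r) = r.val + 1)) :
    pJ q χ U E y r * pJ q χ U E y s * pJ q χ U E y r * E i = 0 := by
  have hsr : (s.val : ZMod l) = r.val + 1 := by rw [hs, Nat.cast_succ]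
  by_contra hne
  have e1 : i (lo r) + i (hi r) = (r.val : ZMod l) := by
    by_contra hx
    exact hne (by rw [mul_assoc, h.pJ_E_zero hχ r hx, mul_zero])
  have e2 : i (lo r) + i (hi s) = (s.val : ZMod l) := by
    by_contra hx
    refine hne ?_
    rw [mul_assoc, h.psie, ← mul_assoc, mul_assoc _ _ (E _), h.pJ_E_zero hχ s, mul_zero, zero_mul]
    rwa [sw_hi_next hs, lo_eq_hi hs, sw_hi]
  have e3 : i (hi r) + i (hi s) = (r.val : ZMod l) := by
    by_contra hx
    refine hne ?_
    rw [mul_assoc, h.psie, ← mul_assoc, mul_assoc _ _ (E _), h.psie, ← mul_assoc,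
      h.pJ_E_zero hχ r, zero_mul, zero_mul]
    rwa [sw_lo_prev hs, sw_hi_prev hs, sw_lo, sw_hi_next hs]
  rw [lo_eq_hi hs] at h0
  refine h0 ⟨?_, ?_, ?_⟩
  · linear_combination e3 - e1
  · linear_combination e3 - e2 - hsr
  · linear_combination e1 + e2 - e3 + hsr

omit h1 in
lemma pJ_srs_zero (h0 : ¬(i (hi s) = i (lo r) ∧ i (lo s) = i (lo r) + 1 ∧
    2 * i (lo r) = r.val)) :
    pJ q χ U E y s * pJ q χ U E y r * pJ q χ U E y s * E i = 0 := by
  have hsr : (s.val : ZMod l) = r.val + 1 := by rw [hs, Nat.cast_succ]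
  by_contra hne
  have e1 : i (lo s) + i (hi s) = (s.val : ZMod l) := by
    by_contra hx
    exact hne (by rw [mul_assoc, h.pJ_E_zero hχ s hx, mul_zero])
  have e2 : i (lo r) + i (hi s) = (r.val : ZMod l) := by
    by_contra hx
    refine hne ?_
    rw [mul_assoc, h.psie, ← mul_assoc, mul_assoc _ _ (E _), h.pJ_E_zero hχ r, mul_zero, zero_mul]
    rwa [sw_lo_prev hs, sw_hi_prev hs]
  have e3 : i (lo r) + i (lo s) = (s.val : ZMod l) := by
    by_contra hx
    refine hne ?_
    rw [mul_assoc, h.psie, ← mul_assoc, mul_assoc _ _ (E _), h.psie, ← mul_assoc,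
      h.pJ_E_zero hχ s, zero_mul, zero_mul]
    rwa [sw_hi_next hs, lo_eq_hi hs, sw_hi, sw_lo_prev hs, sw_hi]
  refine h0 ⟨?_, ?_, ?_⟩
  · linear_combination e1 - e3
  · linear_combination e3 - e2 + hsr + e1 - e3
  · linear_combination e2 + e3 - e1

include hb h2

lemma pJ_rsr (hc : i (hi s) = i (lo r)) (hd : i (lo s) = i (lo r) - 1)
    (ha : 2 * i (lo r) = r.val + 1) :
    pJ q χ U E y r * pJ q χ U E y s * pJ q χ U E y r * E i = -E i := by
  have hsr : (s.val : ZMod l) = r.val + 1 := by rw [hs, Nat.cast_succ]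
  have hd' : i (hi r) = i (lo r) - 1 := by rw [← lo_eq_hi hs, hd]
  have d0 : (-1 : ZMod l) ≠ 0 := neg_ne_zero.2 h1
  have d1 : (-1 : ZMod l) ≠ 1 := fun h' => h2 (by linear_combination -h')
  have hne : i (hi r) ≠ i (lo r) := fun h' => d0 (by linear_combination h' - hd')
  have hne1 : i (hi r) ≠ i (lo r) + 1 := fun h' => d1 (by linear_combination h' - hd')
  have hs0 : sw s (sw r i) = sw r i := sw_eq_self (by rw [sw_hi_next hs, lo_eq_hi hs, sw_hi, hc])
  have e1 := h.pJ_E (χ := χ) r i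
  have e2 := h.pJ_E (χ := χ) s (sw r i)
  have e3 := h.pJ_E (χ := χ) r (sw r i)
  rw [show i (hi r) - i (lo r) = -1 by rw [hd']; ring, cG, if_neg d0, if_neg d1] at e1
  rw [hs0, sw_hi_next hs, lo_eq_hi hs, sw_hi, hc, sub_self, cG, if_pos rfl] at e2
  rw [sw_sw, sw_hi, sw_lo, show i (lo r) - i (hi r) = 1 by rw [hd']; ring, cG, if_neg h1,
    if_pos rfl] at e3
  have e4 : U s * E i = 0 := h.U_E_zero s hχ fun h' => h1 (by linear_combination hc + hd - h' + ha - hsr)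
  have e5 := h.U_E_ne r hχ hne
  have e6 := h.U_E_eq s hχ (i := sw r i) (by rw [sw_hi_next hs, lo_eq_hi hs, sw_hi, hc])
  have e7 := h.diag_eq_uC r hχ h1 hne
  rw [show i (hi r) - i (lo r) = -1 by rw [hd']; ring, uC, if_neg d0, if_neg d1] at e7
  have e8 : E i * (U r * (E (sw r i) * (U s * (E (sw r i) * (U r * E i))))) =
      aff (cD q χ (-1)) (y (lo r)) * E i := by
    have e5' : E (sw r i) * (U r * E i) = U r * E i - E i * (U r * E i) := eq_sub_of_add_eq e5.symm
    rw [← mul_assoc (U s), ← mul_assoc (E (sw r i)) (U s * _), ← e6, mul_assoc, e5', mul_sub,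
      ← mul_assoc (U s) (E i), e4, zero_mul, sub_zero, ← mul_assoc (U s), ← mul_assoc (U r),
      ← mul_assoc (U r), hb.UUU r s (Or.inl hs.symm), e7]
  have e9 := aff_mul_of_comm (affInv (cg q)) (h.off_lo r hne).symm
  have e10 := aff_mul_of_comm (affInv (ch q)) (h.off_hi r hne).symm
  have e11 : aff (affInv (ch q)) (y (lo r)) * (E (sw r i) * (U s * E (sw r i))) =
      E (sw r i) * (U s * E (sw r i)) * aff (affInv (ch q)) (y (lo r)) := by
    rw [h.affEa, h.affUa _ (by simp only [lo]; omega) (by simp only [lo]; omega), h.aff_E]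
    simp only [mul_assoc]
  have e12 : aff (cD q χ (-1)) (y (lo r)) * E i * aff (affInv (ch q)) (y (hi r)) *
      aff (affInv (cg q)) (y (lo r)) * aff (affInv (cD q χ (-1))) (y (lo r)) = -E i := by
    have f1 : E i * aff (affInv (ch q)) (y (hi r)) = aff (affInv (ch q)) (-y (lo r)) * E i := by
      rw [← h.aff_E]
      exact aff_mul_congr _ (by rw [h.y_neg r hχ hne1, neg_mul])
    have f2 := hχ.affInv_ch_mul_cg h1 (h.y_sq (lo r))
    have f3 := aff_mul_affInv (c := cD q χ (-1)) (by simpa [cG, h1, d1] using hχ.cG_fst_ne h1 (-1))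
      (h.y_sq (lo r))
    have f4 := h.aff_E (affInv (cg q)) (lo r) i
    have f5 := h.aff_E (affInv (cD q χ (-1))) (lo r) i
    generalize aff (cD q χ (-1)) (y (lo r)) = x at *
    generalize aff (affInv (cD q χ (-1))) (y (lo r)) = x' at *
    generalize aff (affInv (cg q)) (y (lo r)) = z at *
    generalize aff (affInv (ch q)) (-y (lo r)) = z' at *
    generalize aff (affInv (ch q)) (y (hi r)) = z'' at *
    generalize E i = w at *
    linear_combination (norm := noncomm_ring) x * f1 * z * x' - x * z' * f4 * x' - x * z' * z * f5 +
      x * f2 * x' * w - f3 * w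
  have e13 : E (sw r i) * (E (sw r i) * (U r * E i)) = E (sw r i) * (U r * E i) := h.EE _ _
  have e14 : E (sw r i) * (E (sw r i) * (U s * E (sw r i))) = E (sw r i) * (U s * E (sw r i)) :=
    h.EE _ _
  rw [← e12, ← e8]
  have e15 := h.EE (sw r i)
  generalize aff (affInv (ch q)) (y (hi r)) = G3 at *
  generalize aff (affInv (ch q)) (y (lo r)) = g3 at *
  generalize aff (affInv (cg q)) (y (hi r)) = g2 at *
  generalize aff (affInv (cg q)) (y (lo r)) = G2 at *
  generalize aff (affInv (cD q χ (-1))) (y (lo r)) = g1 at *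
  generalize pJ q χ U E y r = a at *
  generalize pJ q χ U E y s = b at *
  generalize E (sw r i) = E' at *
  generalize E i = E at *
  generalize U r = u at *
  generalize U s = v at *
  linear_combination (norm := noncomm_ring) a * b * e1 - a * b * e13 * g1 +
    a * e2 * (E' * (u * E)) * g1 + a * (E' * (v * E')) * e9 * g1 -
    a * e14 * (E' * (u * E)) * G2 * g1 + e3 * (E' * (v * E')) * (E' * (u * E)) * G2 * g1 +
    E * (u * E') * e11 * (E' * (u * E)) * G2 * g1 +
    E * (u * E') * (E' * (v * E')) * e10 * G2 * g1 + E * u * e14 * (E' * (u * E)) * G3 * G2 * g1 +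
    E * u * E' * v * e13 * G3 * G2 * g1

end IsJM

namespace IsJM

variable {A : Type*} [Ring A] [Algebra ℂ A] {l n : ℕ} [NeZero l] {q : ℂ} {χ : AddChar (ZMod l) ℂ}
  {U : Fin (n - 1) → A} {E : Res l n → A} {y X : Fin n → A}

variable (h : IsJM q χ U E y X)
include h

lemma y_eq_of_U_E_zero (hχ : IsChar q χ) (h1 : (1 : ZMod l) ≠ 0) (r : Fin (n - 1)) {i : Res l n}
    (h0 : i (hi r) = i (lo r) + 1) (hU : U r * E i = 0) : y (hi r) * E i = y (lo r) * E i := by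
  have e1 := h.diag_eq_uC r hχ h1 (i := i) (by rw [h0]; simpa using h1)
  rw [hU, mul_zero, h0, add_sub_cancel_left, uC, if_neg h1, if_pos rfl] at e1
  rw [← sub_eq_zero, ← sub_mul]
  refine eq_zero_of_aff_mul (c := ch q) (neg_ne_zero.2 (inv_ne_zero (hχ.delta_ne h1)))
    (h.y_sq (lo r)) ?_
  rw [← mul_assoc, mul_sub, h.aff_y, h.aff_y, ← sub_mul, ← e1]

variable {m : ℤ} {e : A} (hb : IsBlob q m e U) {r s : Fin (n - 1)} (hs : s.val = r.val + 1)
  (hχ : IsChar q χ) (h1 : (1 : ZMod l) ≠ 0) (h2 : (2 : ZMod l) ≠ 0) {i : Res l n}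
include hs hχ h1 hb h2

lemma pJ_srs (hc : i (hi s) = i (lo r)) (hd : i (lo s) = i (lo r) + 1)
    (ha : 2 * i (lo r) = r.val) :
    pJ q χ U E y s * pJ q χ U E y r * pJ q χ U E y s * E i = -E i := by
  have hd' : i (hi r) = i (lo r) + 1 := by rw [← lo_eq_hi hs, hd]
  have d0 : (-1 : ZMod l) ≠ 0 := neg_ne_zero.2 h1
  have d1 : (-1 : ZMod l) ≠ 1 := fun h' => h2 (by linear_combination -h')
  have hne : i (hi s) ≠ i (lo s) := fun h' => h1 (by linear_combination hc - hd - h')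
  have hne1 : i (hi s) ≠ i (lo s) + 1 := fun h' => h2 (by linear_combination hc - hd - h')
  have hr : sw s i (hi r) = sw s i (lo r) := by
    rw [← lo_eq_hi hs, sw_lo, sw_lo_prev hs, hc]
  have e1 := h.pJ_E (χ := χ) s i
  have e2 := h.pJ_E (χ := χ) r (sw s i)
  have e3 := h.pJ_E (χ := χ) s (sw s i)
  rw [show i (hi s) - i (lo s) = -1 by rw [hc, hd]; ring, cG, if_neg d0, if_neg d1] at e1
  rw [sw_eq_self hr, hr, sub_self, cG, if_pos rfl] at e2
  rw [sw_sw, sw_hi, sw_lo, show i (lo s) - i (hi s) = 1 by rw [hc, hd]; ring, cG, if_neg h1,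
    if_pos rfl] at e3
  have e4 : U r * E i = 0 := h.U_E_zero r hχ fun h' => h1 (by linear_combination h' - hd' - ha)
  have e5 := h.U_E_ne s hχ hne
  have e6 := h.U_E_eq r hχ hr
  have e7 := h.diag_eq_uC s hχ h1 hne
  rw [show i (hi s) - i (lo s) = -1 by rw [hc, hd]; ring, uC, if_neg d0, if_neg d1] at e7
  have e8 : E i * (U s * (E (sw s i) * (U r * (E (sw s i) * (U s * E i))))) =
      aff (cD q χ (-1)) (y (lo s)) * E i := by
    have e5' : E (sw s i) * (U s * E i) = U s * E i - E i * (U s * E i) := eq_sub_of_add_eq e5.symm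
    rw [← mul_assoc (U r), ← mul_assoc (E (sw s i)) (U r * _), ← e6, mul_assoc, e5', mul_sub,
      ← mul_assoc (U r) (E i), e4, zero_mul, sub_zero, ← mul_assoc (U r), ← mul_assoc (U s),
      ← mul_assoc (U s), hb.UUU s r (Or.inr hs.symm), e7]
  have e9 := aff_mul_of_comm (affInv (ch q)) (h.off_lo s (i := sw s i) (by simpa using hne.symm)).symm
  rw [sw_sw] at e9
  have e10 : aff (affInv (cg q)) (y (lo r)) * (E (sw s i) * (U s * E i)) =
      E (sw s i) * (U s * E i) * aff (affInv (cg q)) (y (lo r)) := by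
    rw [h.affEa, h.affUa _ (by simp only [lo]; omega) (by simp only [lo]; omega), h.aff_E]
    simp only [mul_assoc]
  have e12 : aff (affInv (ch q)) (y (hi s)) * aff (cD q χ (-1)) (y (lo s)) * E i *
      aff (affInv (cg q)) (y (lo r)) * aff (affInv (cD q χ (-1))) (y (lo s)) = -E i := by
    have f0 : aff (affInv (cg q)) (y (lo r)) * E i = aff (affInv (cg q)) (y (lo s)) * E i := by
      refine aff_mul_congr _ ?_
      rw [lo_eq_hi hs, h.y_eq_of_U_E_zero hχ h1 r hd' e4]
    have f1 : aff (affInv (ch q)) (y (hi s)) * E i = aff (affInv (ch q)) (-y (lo s)) * E i :=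
      aff_mul_congr _ (by rw [h.y_neg s hχ hne1, neg_mul])
    have f2 := hχ.affInv_ch_mul_cg h1 (h.y_sq (lo s))
    have f3 := aff_mul_affInv (c := cD q χ (-1)) (by simpa [cG, h1, d1] using hχ.cG_fst_ne h1 (-1))
      (h.y_sq (lo s))
    have f4 := h.aff_E (affInv (cg q)) (lo r) i
    have f5 := h.aff_E (affInv (cD q χ (-1))) (lo s) i
    have f6 := h.yc (cD q χ (-1)) (affInv (cg q)) (lo s) (lo s) 1
    have f7 := h.aff_E (affInv (cg q)) (lo s) i
    generalize aff (cD q χ (-1)) (y (lo s)) = x at *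
    generalize aff (affInv (cD q χ (-1))) (y (lo s)) = x' at *
    generalize aff (affInv (cg q)) (y (lo r)) = z₀ at *
    generalize aff (affInv (cg q)) (y (lo s)) = z at *
    generalize aff (affInv (ch q)) (-y (lo s)) = z' at *
    generalize aff (affInv (ch q)) (y (hi s)) = z'' at *
    generalize E i = w at *
    linear_combination (norm := noncomm_ring) -z'' * x * f4 * x' + z'' * x * f0 * x' -
      z'' * x * z * f5 + z'' * f6 * x' * w + z'' * z * f3 * w + z'' * f7 + f1 * z - z' * f7 + f2 * w
  have e13 : E (sw s i) * (E (sw s i) * (U s * E i)) = E (sw s i) * (U s * E i) := h.EE _ _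
  have e14 : E (sw s i) * (E (sw s i) * (U r * E (sw s i))) = E (sw s i) * (U r * E (sw s i)) :=
    h.EE _ _
  rw [← e12, mul_assoc (aff _ (y (Statement0.hi s))) _ (E i), ← e8]
  generalize aff (affInv (ch q)) (y (hi s)) = G3 at *
  generalize aff (affInv (ch q)) (y (lo s)) = g3 at *
  generalize aff (affInv (cg q)) (y (lo r)) = g2 at *
  generalize aff (affInv (cD q χ (-1))) (y (lo s)) = g1 at *
  generalize pJ q χ U E y r = b at *
  generalize pJ q χ U E y s = a at *
  generalize E (sw s i) = E' at *
  generalize E i = E at *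
  generalize U r = v at *
  generalize U s = u at *
  linear_combination (norm := noncomm_ring) a * b * e1 - a * b * e13 * g1 +
    a * e2 * (E' * (u * E)) * g1 + a * (E' * (v * E')) * e10 * g1 -
    a * e14 * (E' * (u * E)) * g2 * g1 + e3 * (E' * (v * E')) * (E' * (u * E)) * g2 * g1 -
    e9 * (E' * (v * E')) * (E' * (u * E)) * g2 * g1 + G3 * E * u * e14 * (E' * (u * E)) * g2 * g1 +
    G3 * E * u * E' * v * e13 * g2 * g1

omit h2 in
lemma braid (h2 : (2 : ZMod l) ≠ 0) (i : Res l n) :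
    pJ q χ U E y r * pJ q χ U E y s * pJ q χ U E y r * E i =
      (pJ q χ U E y s * pJ q χ U E y r * pJ q χ U E y s +
        (if i (hi s) = i (lo r) ∧ i (lo s) = i (lo r) + 1 then 1
          else if i (hi s) = i (lo r) ∧ i (lo s) = i (lo r) - 1 then -1 else 0)) * E i := by
  have hsr : (s.val : ZMod l) = r.val + 1 := by rw [hs, Nat.cast_succ]
  have hlh := lo_eq_hi hs
  rw [add_mul]
  split_ifs with h3 h4
  · have h5 : i (lo r) + 1 ≠ i (lo r) - 1 := fun h' => h2 (by linear_combination h')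
    rw [h.pJ_rsr_zero hs hχ (by rw [h3.2]; exact fun h' => h5 h'.2.1), one_mul]
    by_cases h6 : 2 * i (lo r) = r.val
    · rw [h.pJ_srs hb hs hχ h1 h2 h3.1 h3.2 h6, neg_add_cancel]
    · rw [h.idem_zero s hχ (i := i) (by rw [h3.1, h3.2]; exact fun h' => h2 (by linear_combination -h'))
        fun h' => h6 (by linear_combination h' - h3.1 - h3.2 + hsr), mul_zero, add_zero]
  · have h5 : i (lo r) - 1 ≠ i (lo r) + 1 := fun h' => h2 (by linear_combination -h')
    rw [h.pJ_srs_zero hs hχ (by rw [h4.2]; exact fun h' => h5 h'.2.1), zero_add, neg_mul, one_mul]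
    by_cases h6 : 2 * i (lo r) = r.val + 1
    · rw [h.pJ_rsr hb hs hχ h1 h2 h4.1 h4.2 h6]
    · have h7 : i (hi r) = i (lo r) - 1 := by rw [← hlh, h4.2]
      rw [h.idem_zero r hχ (i := i) (by rw [h7]; exact h5)
        fun h' => h6 (by linear_combination h' - h7), mul_zero, neg_zero]
  · rw [h.pJ_rsr_zero hs hχ fun h' => h4 ⟨h'.1, h'.2.1⟩,
      h.pJ_srs_zero hs hχ fun h' => h3 ⟨h'.1, h'.2.1⟩, zero_mul, add_zero]

end IsJM

theorem IsBlob.exists_isKLR {A : Type*} [Ring A] [Algebra ℂ A] {q : ℂ} {m : ℤ} {n : ℕ} {e : A}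
    {U : Fin (n - 1) → A} (hb : IsBlob q m e U) {l : ℕ} [NeZero l] {χ : AddChar (ZMod l) ℂ}
    (hχ : IsChar q χ) (hd : q - q⁻¹ ≠ 0) (hm : q ^ m - q ^ (-m) ≠ 0) (hl : q ^ l = 1)
    {κ : ZMod l} (hA : IsAdm κ) (hκ : χ κ = q ^ m) (hn : 0 < n) :
    ∃ (E : Res l n → A) (y X : Fin n → A), IsKLR κ E y (pJ q χ U E y) ∧
      (∀ r, X r = XJ q (q ^ (-m)) (q ^ m) e U r) ∧
      (∀ r, y r = algebraMap ℂ A (l : ℂ)⁻¹ * (X r ^ l - 1)) ∧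
      (∀ r i, X r * E i = algebraMap ℂ A (χ (i r)) * (1 + y r) * E i) ∧
      (∀ r, UB q χ E y (pJ q χ U E y) r = U r) ∧ eB κ hn E = e := by
  obtain ⟨E, y, X, h, hX, hy, hy0, hE, he⟩ := hb.exists_isJM hχ.q0 hd hm hχ hl hκ hn
  have h1 := hA.one
  refine ⟨E, y, X, ?_, hX, hy, h.XE, fun r => h.UB_pJ r hχ h1, ?_⟩
  · exact {
      cyc1 := fun i r hr h2 h3 => by
        obtain rfl : r = ⟨0, hn⟩ := Fin.ext hr
        exact hE i h2 h3
      cyc2 := fun i r hr => by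
        obtain rfl : r = ⟨0, hn⟩ := Fin.ext hr
        rw [hy0, zero_mul]
      orth := h.orth
      idem := h.idem
      sum1 := h.sum1
      ye := h.ye
      psie := fun r i => h.psie r i
      yy := h.yy
      psiy := fun r s => h.pJ_y r s
      pp := fun r s hrs => h.pp hb hχ hrs
      py := fun r i => h.py r hχ h1
      yp := fun r i => h.yp r hχ h1
      psisq := fun r i => h.pJ_sq hb r hχ h1 hA.two
      braid := fun r s hs i => h.braid hb hs hχ h1 hA.two i
      bad := fun i r hr h2 h3 => by
        refine h.idem_zero r hχ (fun h4 => hA.two (by linear_combination h3 - h4)) fun h4 => ?_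
        rw [hr, Nat.cast_zero] at h4
        rcases h2 with h2 | h2
        · exact hA.m1 (by linear_combination h4 - h3 - 2 * h2)
        · exact hA.mm1 (by linear_combination -h4 + h3 + 2 * h2) }
  · refine h.ext_E fun i => ?_
    rw [he, eB, Finset.sum_mul, Finset.sum_eq_single i]
    · split_ifs
      · exact h.idem i
      · exact zero_mul _
    · intro j _ hj
      split_ifs
      · exact h.orth j i hj
      · exact zero_mul _
    · simp

section Map

variable {A B : Type*} [Ring A] [Algebra ℂ A] [Ring B] [Algebra ℂ B] {l n : ℕ} [NeZero l]
  (f : A →ₐ[ℂ] B)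

lemma map_aff (c : ℂ × ℂ) (t : A) : f (aff c t) = aff c (f t) := by
  simp only [aff, map_add, map_mul, AlgHom.commutes]

omit [NeZero l] in
lemma map_uC (q : ℂ) (χ : AddChar (ZMod l) ℂ) (d : ZMod l) (t t' : A) :
    f (uC q χ d t t') = uC q χ d (f t) (f t') := by
  unfold uC
  split_ifs <;> simp only [map_zero, map_mul, map_sub, map_aff]

lemma map_UB (q : ℂ) (χ : AddChar (ZMod l) ℂ) (E : Res l n → A) (y : Fin n → A)
    (p : Fin (n - 1) → A) (r : Fin (n - 1)) :
    f (UB q χ E y p r) = UB q χ (fun i => f (E i)) (fun s => f (y s)) (fun s => f (p s)) r := by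
  simp only [UB, map_sum, map_mul, map_add, map_aff, map_uC]

lemma map_eB (κ : ZMod l) (hn : 0 < n) (E : Res l n → A) :
    f (eB κ hn E) = eB κ hn fun i => f (E i) := by
  simp only [eB, map_sum, apply_ite f, map_zero]

lemma map_pJ (q : ℂ) (χ : AddChar (ZMod l) ℂ) (U : Fin (n - 1) → A) (E : Res l n → A)
    (y : Fin n → A) (r : Fin (n - 1)) :
    f (pJ q χ U E y r) = pJ q χ (fun s => f (U s)) (fun i => f (E i)) (fun s => f (y s)) r := by
  simp only [pJ, map_sum, map_mul, map_aff]

lemma map_XJ (q α β : ℂ) (e : A) (U : Fin (n - 1) → A) (r : ℕ) :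
    f (XJ q α β e U r) = XJ q α β (f e) (fun s => f (U s)) r := by
  induction r with
  | zero => simp only [XJ, map_add, map_mul, map_sub, map_one, AlgHom.commutes]
  | succ r ih =>
    simp only [XJ]
    split_ifs
    · simp only [map_add, map_mul, ih, AlgHom.commutes]
    · exact map_zero f

end Map

namespace IsKLR

variable {A : Type*} [Ring A] [Algebra ℂ A]
variable {l n : ℕ} [NeZero l] {κ : ZMod l} {E : Res l n → A} {y : Fin n → A}
  {p : Fin (n - 1) → A} {q : ℂ} {χ : AddChar (ZMod l) ℂ}

variable (h : IsKLR κ E y p)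
include h

lemma pJ_UB (hA : IsAdm κ) (hχ : IsChar q χ) : pJ q χ (UB q χ E y p) E y = p := by
  funext r
  rw [← mul_one (p r), ← h.sum1, Finset.mul_sum, pJ]
  refine Finset.sum_congr rfl fun i _ => ?_
  have e1 : E (sw r i) * (E i * uC q χ (i (hi r) - i (lo r)) (y (lo r)) (y (hi r))) = 0 := by
    by_cases h0 : i (hi r) = i (lo r)
    · rw [h0, sub_self, uC, if_pos rfl, mul_zero, mul_zero]
    · rw [← mul_assoc, h.orth _ _ (sw_ne_self h0), zero_mul]
  rw [h.UB_E_expand, mul_add, e1, add_zero, ← mul_assoc, ← mul_assoc, h.idem, mul_assoc,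
    aff_mul_affInv (hχ.cG_fst_ne hA.one _) (h.y_sq hA _), mul_one, h.psie]

lemma XB_pow_E (hA : IsAdm κ) (r : Fin n) (i : Res l n) (k : ℕ) :
    XB χ E y r ^ k * E i = algebraMap ℂ A (χ (i r) ^ k) * (1 + k * y r) * E i := by
  induction k with
  | zero => simp
  | succ k ih =>
    have e1 := h.XB_E (χ := χ) r i
    have e2 := h.ye r i
    have e3 := h.y_sq hA r
    have e4 := Algebra.commutes (A := A) (χ (i r)) (XB χ E y r ^ k)
    have e5 := Algebra.commutes (A := A) (χ (i r)) (algebraMap ℂ A (χ (i r) ^ k))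
    rw [pow_succ, pow_succ, map_mul, Nat.cast_succ]
    generalize XB χ E y r ^ k = P at *
    generalize XB χ E y r = X at *
    generalize (k : A) = K at *
    generalize algebraMap ℂ A (χ (i r) ^ k) = C at *
    generalize algebraMap ℂ A (χ (i r)) = c at *
    linear_combination (norm := noncomm_ring) P * e1 - e4 * (1 + y r) * E i + c * P * e2 +
      c * ih * (1 + y r) - c * C * (1 + K * y r) * e2 + c * C * K * e3 * E i +
      e5 * (1 + y r + K * y r) * E i

lemma y_eq_XB (hA : IsAdm κ) (r : Fin n) :
    algebraMap ℂ A (l : ℂ)⁻¹ * (XB χ E y r ^ l - 1) = y r := by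
  refine h.ext_E fun i => ?_
  have e1 : χ (i r) ^ l = 1 := by
    rw [← AddChar.map_nsmul_eq_pow, nsmul_eq_mul, ZMod.natCast_self, zero_mul,
      AddChar.map_zero_eq_one]
  have e2 : (l : ℂ) ≠ 0 := Nat.cast_ne_zero.2 (NeZero.ne l)
  rw [mul_assoc, sub_mul, h.XB_pow_E hA, e1, map_one, one_mul, one_mul, add_mul, one_mul,
    add_sub_cancel_left, mul_assoc, ← mul_assoc, ← map_natCast (algebraMap ℂ A), ← map_mul,
    inv_mul_cancel₀ e2, map_one, one_mul]

lemma eq_of_XB_E (hA : IsAdm κ) (hχ : IsChar q χ) {E' : Res l n → A}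
    (hsum : ∑ i : Res l n, E' i = 1)
    (hE : ∀ r i, XB χ E y r * E' i = algebraMap ℂ A (χ (i r)) * (1 + y r) * E' i) : E' = E := by
  have h1 : ∀ i j, j ≠ i → E j * E' i = 0 := by
    intro i j hij
    obtain ⟨r, hr⟩ := Function.ne_iff.1 hij
    have e1 : E j * XB χ E y r = algebraMap ℂ A (χ (j r)) * (1 + y r) * E j := by
      rw [XB, Finset.mul_sum, Finset.sum_eq_single j]
      · have e2 := Algebra.commutes (χ (j r)) (E j)
        have e3 := h.ye r j
        have e4 := h.idem j
        generalize algebraMap ℂ A (χ (j r)) = c at *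
        linear_combination (norm := noncomm_ring) -e2 * (1 + y r) * E j + c * e4 +
          c * y r * e4 - c * e3 * E j
      · intro i _ hi
        rw [mul_assoc, add_mul, one_mul, h.ye, ← mul_one_add, ← Algebra.left_comm, ← mul_assoc,
          h.orth _ _ hi.symm, zero_mul]
      · simp
    have e2 : (χ (j r) - χ (i r)) • ((1 + y r) * (E j * E' i)) = 0 := by
      have e3 := Algebra.commutes (χ (i r)) (E j)
      have e4 := h.ye r j
      have e5 := hE r i
      rw [Algebra.smul_def, map_sub]
      generalize algebraMap ℂ A (χ (j r)) = c at *
      generalize algebraMap ℂ A (χ (i r)) = d at *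
      linear_combination (norm := noncomm_ring) -e1 * E' i + E j * e5 - e3 * (1 + y r) * E' i -
        d * e4 * E' i
    have e3 := (smul_eq_zero.1 e2).resolve_left (sub_ne_zero.2 fun h' => hr (hχ.injective h'))
    have e4 := h.y_sq hA r
    linear_combination (norm := noncomm_ring) (1 - y r) * e3 + e4 * E j * E' i
  have h2 : ∀ i, E i * E' i = E' i := fun i => by
    conv_rhs => rw [← one_mul (E' i), ← h.sum1, Finset.sum_mul]
    exact (Finset.sum_eq_single i (fun j _ hj => h1 i j hj) (by simp)).symm
  funext i
  conv_rhs => rw [← mul_one (E i), ← hsum, Finset.mul_sum]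
  rw [← h2]
  exact (Finset.sum_eq_single i (fun j _ hj => h1 j i (Ne.symm hj)) (by simp)).symm

end IsKLR

section Root

variable {l : ℕ} [NeZero l] {q : ℂ} (hq : IsPrimitiveRoot q l)
include hq

lemma exists_isChar (hodd : Odd l) :
    ∃ χ : AddChar (ZMod l) ℂ, IsChar q χ ∧ ∀ k : ℤ, χ k = q ^ (2 * k) := by
  have h0 : q ≠ 0 := hq.ne_zero (NeZero.ne l)
  have h1 : (q ^ 2) ^ l = 1 := by rw [← pow_mul, mul_comm, pow_mul, hq.pow_eq_one, one_pow]
  have h2 : ∀ k : ℤ, AddChar.zmodChar l h1 k = q ^ (2 * k) := fun k => by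
    have h3 := AddChar.zmodChar_apply' h1 1
    rw [Nat.cast_one, pow_one] at h3
    rw [← zsmul_one, AddChar.map_zsmul_eq_zpow, h3, zpow_mul]
    rfl
  refine ⟨_, ⟨h0, ?_, fun d hd => ?_⟩, h2⟩
  · simpa using h2 1
  · obtain ⟨k, rfl⟩ := ZMod.intCast_surjective d
    rw [h2, hq.zpow_eq_one_iff_dvd] at hd
    rw [ZMod.intCast_zmod_eq_zero_iff_dvd]
    exact (Nat.isCoprime_iff_coprime.2 hodd.coprime_two_right).dvd_of_dvd_mul_left hd

omit [NeZero l] in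
lemma sub_inv_ne_zero_of_odd (hl : 3 ≤ l) : q - q⁻¹ ≠ 0 := fun h => by
  have h0 : q ≠ 0 := hq.ne_zero (by omega)
  have h1 : q ^ 2 = 1 := by
    rw [pow_two, sub_eq_zero.1 (h : q - q⁻¹ = 0)]
    nth_rw 2 [← sub_eq_zero.1 h]
    exact inv_mul_cancel₀ h0
  exact absurd (Nat.le_of_dvd two_pos (hq.dvd_of_pow_eq_one 2 h1)) (by omega)

lemma zpow_sub_zpow_neg_ne_zero (hodd : Odd l) {m : ℤ} (hm : (m : ZMod l) ≠ 0) :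
    q ^ m - q ^ (-m) ≠ 0 := fun h => by
  have h0 : q ≠ 0 := hq.ne_zero (NeZero.ne l)
  have h1 : q ^ (2 * m) = 1 := by
    rw [two_mul, zpow_add₀ h0]
    nth_rw 1 [sub_eq_zero.1 h]
    rw [← zpow_add₀ h0, neg_add_cancel, zpow_zero]
  obtain ⟨χ, hχ, hχ'⟩ := exists_isChar hq hodd
  exact hm (hχ.inj _ ((hχ' m).trans h1))

end Root

lemma isAdm_of_odd {l : ℕ} (hl : 3 ≤ l) (hodd : Odd l) {k m : ℤ} (hm0 : (m : ZMod l) ≠ 0)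
    (hm1 : (m : ZMod l) ≠ 1) (hmm1 : (m : ZMod l) ≠ -1)
    (hk : ((2 * k : ℤ) : ZMod l) = (m : ZMod l)) : IsAdm (k : ZMod l) := by
  have h3 : l ≠ 3 := by
    rintro rfl
    clear hk
    generalize (m : ZMod 3) = x at *
    revert x
    decide
  have h4 : l ≠ 4 := by rintro rfl; exact absurd hodd (by decide)
  have key : ∀ a : ℕ, 0 < a → a < l → (a : ZMod l) ≠ 0 := fun a h0 h1 h => by
    rw [ZMod.natCast_eq_zero_iff] at h
    exact absurd (Nat.le_of_dvd h0 h) (by omega)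
  push_cast at hk
  refine ⟨?_, ?_, ?_, ?_, ?_, ?_⟩
  · exact_mod_cast key 1 (by omega) (by omega)
  · exact_mod_cast key 2 (by omega) (by omega)
  · exact_mod_cast key 3 (by omega) (by omega)
  all_goals rwa [hk]

theorem IsBlob.nonempty_algEquiv {A B : Type*} [Ring A] [Algebra ℂ A] [Ring B] [Algebra ℂ B]
    {l : ℕ} [NeZero l] {q : ℂ} {m : ℤ} {κ : ZMod l} {n : ℕ} {e : A} {U : Fin (n - 1) → A}
    (hb : IsBlob q m e U) {EK : Res l n → B} {yK : Fin n → B} {pK : Fin (n - 1) → B}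
    (hK : IsKLR κ EK yK pK)
    (hb_lift : ∀ (e' : B) (U' : Fin (n - 1) → B), IsBlob q m e' U' →
      ∃ f : A →ₐ[ℂ] B, f e = e' ∧ ∀ r, f (U r) = U' r)
    (hb_ext : ∀ f : A →ₐ[ℂ] A, f e = e → (∀ r, f (U r) = U r) → f = AlgHom.id ℂ A)
    (hK_lift : ∀ (E : Res l n → A) (y : Fin n → A) (p : Fin (n - 1) → A), IsKLR κ E y p →
      ∃ f : B →ₐ[ℂ] A, (∀ i, f (EK i) = E i) ∧ (∀ r, f (yK r) = y r) ∧ ∀ r, f (pK r) = p r)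
    (hK_ext : ∀ f : B →ₐ[ℂ] B, (∀ i, f (EK i) = EK i) → (∀ r, f (yK r) = yK r) →
      (∀ r, f (pK r) = pK r) → f = AlgHom.id ℂ B)
    {χ : AddChar (ZMod l) ℂ} (hχ : IsChar q χ) (hd : q - q⁻¹ ≠ 0) (hm : q ^ m - q ^ (-m) ≠ 0)
    (hl : q ^ l = 1) (hA : IsAdm κ) (hκ : χ κ = q ^ m) (hn : 0 < n) :
    Nonempty (A ≃ₐ[ℂ] B) := by
  obtain ⟨E, y, X, h, hX, hy, hXE, hU, he⟩ := hb.exists_isKLR hχ hd hm hl hA hκ hn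
  obtain ⟨φ, φE, φy, φp⟩ := hK_lift _ _ _ h
  obtain ⟨θ, θe, θU⟩ := hb_lift _ _ (hK.isBlob hA hχ hκ hn)
  have θX : ∀ r, θ (X r) = XB χ EK yK r := fun r => by
    rw [hX, map_XJ, θe, funext θU, hK.XJ_eq_XB hA hχ hκ hn]
  have θy : ∀ r, θ (y r) = yK r := fun r => by
    rw [hy, map_mul, map_sub, map_pow, θX, map_one, AlgHom.commutes, hK.y_eq_XB hA]
  have θE : (fun i => θ (E i)) = EK := by
    refine hK.eq_of_XB_E hA hχ ?_ fun r i => ?_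
    · rw [← map_sum, h.sum1, map_one]
    · rw [← θX, ← map_mul, hXE, map_mul, map_mul, map_add, θy, map_one, AlgHom.commutes]
  refine ⟨AlgEquiv.ofAlgHom θ φ (hK_ext _ (fun i => ?_) (fun r => ?_) fun r => ?_)
    (hb_ext _ ?_ fun r => ?_)⟩
  · rw [AlgHom.comp_apply, φE]
    exact congrFun θE i
  · rw [AlgHom.comp_apply, φy, θy]
  · rw [AlgHom.comp_apply, φp, map_pJ, θE, funext θy, funext θU, hK.pJ_UB hA hχ]
  · rw [AlgHom.comp_apply, θe, map_eB, funext φE, he]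
  · rw [AlgHom.comp_apply, θU, map_UB, funext φE, funext φy, funext φp, hU]

theorem nonempty_blob_algEquiv {l : ℕ} [NeZero l] (hl : 3 ≤ l) (hodd : Odd l)
    {q : ℂ} (hq : IsPrimitiveRoot q l) {m k : ℤ} (hm0 : (m : ZMod l) ≠ 0)
    (hm1 : (m : ZMod l) ≠ 1) (hmm1 : (m : ZMod l) ≠ -1)
    (hk : ((2 * k : ℤ) : ZMod l) = (m : ZMod l)) {n : ℕ} (hn : 2 ≤ n) :
    Nonempty (Blob q m n ≃ₐ[ℂ] BQuot l n (Lam2 l k) (badSet2 l n k hn)) := by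
  obtain ⟨χ, hχ, hχ'⟩ := exists_isChar hq hodd
  have h0 : q ≠ 0 := hq.ne_zero (by omega)
  have hκ : χ k = q ^ m := by
    have h1 : q ^ (2 * k - m) = 1 := by
      rw [hq.zpow_eq_one_iff_dvd, ← ZMod.intCast_zmod_eq_zero_iff_dvd, Int.cast_sub, hk, sub_self]
    rw [hχ', ← sub_add_cancel (2 * k) m, zpow_add₀ h0, h1, one_mul]
  exact (isBlob_mk q m n).nonempty_algEquiv (isKLR_mk (l := l) (k := k) (hn := hn))
    (fun _ _ h => h.exists_lift) (fun _ he hU => blob_hom_ext he hU)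
    (fun _ _ _ h => h.exists_lift)
    (fun f hE hy hp => bquot_hom_ext (A := BQuot l n (Lam2 l k) (badSet2 l n k hn)) hE hy hp) hχ
    (sub_inv_ne_zero_of_odd hq hl) (zpow_sub_zpow_neg_ne_zero hq hodd hm0) hq.pow_eq_one
    (isAdm_of_odd hl hodd hm0 hm1 hmm1 hk) hκ (by omega)

section

open AddMonoidAlgebra (single single_mul_single single_add single_zero)

lemma cartan_self {l : ℕ} (a : ZMod l) : cartan l a a = 2 := if_pos rfl

lemma cartan_symm {l : ℕ} (a b : ZMod l) : cartan l a b = cartan l b a := by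
  have h1 : (b = a + 1 ∨ b = a - 1) ↔ (a = b + 1 ∨ a = b - 1) := by
    rw [eq_sub_iff_add_eq, eq_sub_iff_add_eq, eq_comm (b := a + 1), eq_comm (b := a), or_comm]
  simp only [cartan, eq_comm (a := a) (b := b), h1]

lemma cartan_adj {l : ℕ} (h1 : (1 : ZMod l) ≠ 0) {a b : ZMod l} (h : b = a + 1 ∨ b = a - 1) :
    cartan l a b = -1 := by
  rw [cartan, if_neg _, if_pos h]
  rintro rfl
  rcases h with h | h
  · exact h1 (by linear_combination -h)
  · exact h1 (by linear_combination h)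

/-- The degree of `ψ_r e(i)`. -/
def psiDeg {l n : ℕ} (r : Fin (n - 1)) (i : Res l n) : ℤ := -(cartan l (i (lo r)) (i (hi r)))

lemma psiDeg_sw {l n : ℕ} (r : Fin (n - 1)) (i : Res l n) : psiDeg r (sw r i) = psiDeg r i := by
  rw [psiDeg, psiDeg, sw_lo, sw_hi, cartan_symm]

/-- The image of `ψ_r` under the coaction defining the grading. -/
def psiGr {A : Type*} [Ring A] {l n : ℕ} [NeZero l] (E : Res l n → A) (p : Fin (n - 1) → A)
    (r : Fin (n - 1)) : AddMonoidAlgebra A ℤ :=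
  ∑ i : Res l n, single (psiDeg r i) (p r * E i)

namespace IsKLR

variable {A : Type*} [Ring A] {l n : ℕ} [NeZero l] {κ : ZMod l} {E : Res l n → A}
  {y : Fin n → A} {p : Fin (n - 1) → A} (h : IsKLR κ E y p)
include h

lemma psiGr_mul_single (r : Fin (n - 1)) {i : Res l n} (d : ℤ) {a : A} (ha : E i * a = a) :
    psiGr E p r * single d a = single (psiDeg r i + d) (p r * a) := by
  rw [psiGr, Finset.sum_mul, Finset.sum_eq_single i]
  · rw [single_mul_single, mul_assoc, ha]
  · intro j _ hj
    rw [single_mul_single, ← ha, mul_assoc, ← mul_assoc (E j), h.orth _ _ hj, zero_mul, mul_zero,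
      single_zero]
  · simp

lemma E_mul_p (r : Fin (n - 1)) {i : Res l n} {a : A} (ha : E i * a = a) :
    E (sw r i) * (p r * a) = p r * a := by
  rw [← mul_assoc, ← h.psie, mul_assoc, ha]

lemma E_mul_y (r : Fin n) {i : Res l n} {a : A} (ha : E i * a = a) :
    E i * (y r * a) = y r * a := by
  rw [← mul_assoc, ← h.ye, mul_assoc, ha]

lemma ext_single_E {a b : AddMonoidAlgebra A ℤ}
    (hab : ∀ i, a * single 0 (E i) = b * single 0 (E i)) : a = b := by
  have h1 : ∑ i : Res l n, (single 0 (E i) : AddMonoidAlgebra A ℤ) = 1 := by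
    rw [AddMonoidAlgebra.one_def, ← h.sum1]
    exact (map_sum (AddMonoidAlgebra.singleAddHom (R := A) (0 : ℤ)) E Finset.univ).symm
  rw [← mul_one a, ← mul_one b, ← h1, Finset.mul_sum, Finset.mul_sum]
  exact Finset.sum_congr rfl fun i _ => hab i

theorem isKLR_single (h1 : (1 : ZMod l) ≠ 0) :
    IsKLR κ (fun i => (single 0 (E i) : AddMonoidAlgebra A ℤ)) (fun r => single 2 (y r))
      (psiGr E p) where
  cyc1 i r hr h2 h3 := by rw [h.cyc1 i r hr h2 h3, single_zero]
  cyc2 i r hr := by rw [single_mul_single, h.cyc2 i r hr, single_zero]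
  orth i j hij := by rw [single_mul_single, h.orth i j hij, single_zero]
  idem i := by rw [single_mul_single, h.idem, add_zero]
  sum1 := by
    rw [AddMonoidAlgebra.one_def, ← h.sum1]
    exact (map_sum (AddMonoidAlgebra.singleAddHom (R := A) (0 : ℤ)) E Finset.univ).symm
  ye r i := by rw [single_mul_single, single_mul_single, h.ye, add_comm]
  psie r i := by
    rw [h.psiGr_mul_single r 0 (h.idem i), psiGr, Finset.mul_sum, Finset.sum_eq_single i]
    · rw [single_mul_single, h.E_mul_p r (h.idem i), add_comm]
    · intro j _ hj
      rw [single_mul_single, h.psie, ← mul_assoc, h.orth, zero_mul, single_zero]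
      intro h'
      exact hj (by rw [← sw_sw r j, ← h', sw_sw])
    · simp
  yy r s := by rw [single_mul_single, single_mul_single, h.yy]
  psiy r s h2 h3 := by
    refine h.ext_single_E fun i => ?_
    rw [mul_assoc, mul_assoc, h.psiGr_mul_single r 0 (h.idem i), single_mul_single,
      single_mul_single, h.psiGr_mul_single r _ (h.E_mul_y s (h.idem i)), ← mul_assoc, ← mul_assoc,
      h.psiy r s h2 h3]
    congr 1
    ring
  pp r s hrs := by
    refine h.ext_single_E fun i => ?_
    rw [mul_assoc, mul_assoc, h.psiGr_mul_single r 0 (h.idem i),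
      h.psiGr_mul_single s 0 (h.idem i), h.psiGr_mul_single r _ (h.E_mul_p s (h.idem i)),
      h.psiGr_mul_single s _ (h.E_mul_p r (h.idem i)), ← mul_assoc, ← mul_assoc, h.pp r s hrs]
    congr 1
    rw [psiDeg, psiDeg, psiDeg, psiDeg, sw_lo_of_far hrs, sw_hi_of_far hrs, sw_lo_of_far hrs.symm,
      sw_hi_of_far hrs.symm]
    ring
  py r i := by
    have h2 : psiDeg r i + (2 + 0) = 2 + (psiDeg r i + 0) := by ring
    rw [single_mul_single, h.psiGr_mul_single r _ (h.E_mul_y _ (h.idem i)), h.py, add_mul,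
      add_mul, mul_assoc (single 2 _), h.psiGr_mul_single r _ (h.idem i), single_mul_single,
      single_add, mul_assoc, h2]
    congr 1
    split_ifs with h3
    · rw [one_mul, one_mul, psiDeg, h3, cartan_self]
      rfl
    · rw [zero_mul, zero_mul, single_zero]
  yp r i := by
    have h2 : psiDeg r i + (2 + 0) = 2 + (psiDeg r i + 0) := by ring
    rw [h.psiGr_mul_single r _ (h.idem i), single_mul_single, h.yp, add_mul, add_mul, single_add,
      mul_assoc (psiGr E p r), single_mul_single, h.psiGr_mul_single r _ (h.E_mul_y _ (h.idem i)),
      mul_assoc, h2]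
    congr 1
    split_ifs with h3
    · rw [one_mul, one_mul, psiDeg, h3, cartan_self]
      rfl
    · rw [zero_mul, zero_mul, single_zero]
  psisq r i := by
    rw [mul_assoc, h.psiGr_mul_single r _ (h.idem i),
      h.psiGr_mul_single r _ (h.E_mul_p r (h.idem i)), psiDeg_sw, ← mul_assoc, h.psisq, psiDeg]
    split_ifs with h2 h3 h4
    · rw [zero_mul, zero_mul, single_zero]
    · rw [cartan_adj h1 (Or.inl h3), ← AddMonoidAlgebra.single_sub, single_mul_single]
      rfl
    · rw [cartan_adj h1 (Or.inr h4), ← AddMonoidAlgebra.single_sub, single_mul_single]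
      rfl
    · rw [cartan, if_neg (Ne.symm h2), if_neg (not_or.2 ⟨h3, h4⟩), one_mul, one_mul]
      rfl
  braid r s hs i := by
    have h2 : psiDeg r (sw s (sw r i)) + (psiDeg s (sw r i) + (psiDeg r i + 0)) =
        -cartan l (i (lo s)) (i (hi s)) - cartan l (i (lo r)) (i (hi s)) -
          cartan l (i (lo r)) (i (lo s)) := by
      simp only [psiDeg, sw_lo_prev hs, sw_hi_prev hs, sw_hi_next hs, sw_lo, lo_eq_hi hs, sw_hi]
      ring
    have h3 : psiDeg s (sw r (sw s i)) + (psiDeg r (sw s i) + (psiDeg s i + 0)) =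
        -cartan l (i (lo s)) (i (hi s)) - cartan l (i (lo r)) (i (hi s)) -
          cartan l (i (lo r)) (i (lo s)) := by
      have h4 := sw_hi s i
      rw [lo_eq_hi hs] at h4
      simp only [psiDeg, sw_lo_prev hs, sw_hi_prev hs, sw_hi_next hs, lo_eq_hi hs, sw_hi, h4]
      ring
    rw [add_mul, mul_assoc, mul_assoc, mul_assoc, mul_assoc, h.psiGr_mul_single r _ (h.idem i),
      h.psiGr_mul_single s _ (h.E_mul_p r (h.idem i)),
      h.psiGr_mul_single r _ (h.E_mul_p s (h.E_mul_p r (h.idem i))),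
      h.psiGr_mul_single s _ (h.idem i),
      h.psiGr_mul_single r _ (h.E_mul_p s (h.idem i)),
      h.psiGr_mul_single s _ (h.E_mul_p r (h.E_mul_p s (h.idem i))), h2, h3, ← mul_assoc,
      ← mul_assoc, h.braid r s hs i, add_mul, single_add, ← mul_assoc, ← mul_assoc]
    congr 1
    split_ifs with h4 h5
    · rw [h4.1, cartan_self, cartan_symm, cartan_adj h1 (Or.inl h4.2), one_mul, one_mul]
      rfl
    · rw [h5.1, cartan_self, cartan_symm, cartan_adj h1 (Or.inr h5.2), neg_mul, one_mul, neg_mul,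
        one_mul, ← AddMonoidAlgebra.single_neg]
      rfl
    · rw [zero_mul, zero_mul, single_zero]
  bad i r hr h2 h3 := by rw [h.bad i r hr h2 h3, single_zero]

end IsKLR

end

section

open AddMonoidAlgebra (single single_mul_single single_add single_zero)

section Grading

variable {A : Type*} [Ring A] [Algebra ℂ A] (Δ : A →ₐ[ℂ] AddMonoidAlgebra A ℤ)

/-- The elements of degree `d` for a coaction `Δ`. -/
def grading (d : ℤ) : Submodule ℂ A where
  carrier := {x | Δ x = single d x}
  add_mem' {a b} (ha : Δ a = _) (hb : Δ b = _) := by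
    rw [Set.mem_ofPred_eq, map_add, ha, hb, single_add]
  zero_mem' := by rw [Set.mem_ofPred_eq, map_zero, single_zero]
  smul_mem' c x (hx : Δ x = _) := by
    rw [Set.mem_ofPred_eq, map_smul, hx, AddMonoidAlgebra.smul_single]

variable {Δ}

lemma mem_grading {d : ℤ} {x : A} : x ∈ grading Δ d ↔ Δ x = single d x := Iff.rfl

instance : SetLike.GradedMonoid (grading Δ) where
  one_mem := by rw [mem_grading, map_one, AddMonoidAlgebra.one_def]
  mul_mem i j a b ha hb := by
    rw [mem_grading] at *
    rw [map_mul, ha, hb, single_mul_single]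

lemma coeff_coe_grading (x : DirectSum ℤ fun d => grading Δ d) (d : ℤ) :
    (Δ (DirectSum.coeAlgHom (grading Δ) x)).coeff d = x d := by
  induction x using DirectSum.induction_on with
  | zero => simp
  | of i x =>
    rw [DirectSum.coeAlgHom_of, mem_grading.1 x.2, AddMonoidAlgebra.coeff_single,
      DirectSum.of_apply, Finsupp.single_apply]
    split_ifs with h
    · subst h; rfl
    · rfl
  | add x y hx hy =>
    rw [map_add, map_add, AddMonoidAlgebra.coeff_add, Finsupp.add_apply, hx, hy,
      DirectSum.add_apply, Submodule.coe_add]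

theorem nonempty_gradedAlgebra (hΔ : (DirectSum.coeAlgHom (grading Δ)).range = ⊤) :
    Nonempty (GradedAlgebra (grading Δ)) := by
  have h : DirectSum.IsInternal (grading Δ) := by
    constructor
    · intro a b hab
      replace hab : DirectSum.coeAlgHom (grading Δ) a = DirectSum.coeAlgHom (grading Δ) b := hab
      refine DFinsupp.ext fun d => Subtype.ext ?_
      exact (coeff_coe_grading a d).symm.trans
        ((congrArg (fun z => (Δ z).coeff d) hab).trans (coeff_coe_grading b d))
    · intro a
      exact (AlgHom.range_eq_top _).1 hΔ a
  exact ⟨{ h.chooseDecomposition with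
    one_mem := SetLike.GradedOne.one_mem
    mul_mem := fun _ _ _ _ ha hb => SetLike.mul_mem_graded ha hb }⟩

lemma mem_range_coeAlgHom_grading {d : ℤ} {x : A} (hx : Δ x = single d x) :
    x ∈ (DirectSum.coeAlgHom (grading Δ)).range :=
  ⟨DirectSum.of (fun d => grading Δ d) d ⟨x, hx⟩, DirectSum.coeAlgHom_of _ _ _⟩

end Grading

theorem IsKLR.exists_grading {A : Type*} [Ring A] [Algebra ℂ A] {l n : ℕ} [NeZero l]
    {κ : ZMod l} {E : Res l n → A} {y : Fin n → A} {p : Fin (n - 1) → A} (h : IsKLR κ E y p)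
    (h1 : (1 : ZMod l) ≠ 0)
    (hlift : ∀ (E' : Res l n → AddMonoidAlgebra A ℤ) (y' : Fin n → AddMonoidAlgebra A ℤ)
      (p' : Fin (n - 1) → AddMonoidAlgebra A ℤ), IsKLR κ E' y' p' →
      ∃ f : A →ₐ[ℂ] AddMonoidAlgebra A ℤ,
        (∀ i, f (E i) = E' i) ∧ (∀ r, f (y r) = y' r) ∧ ∀ r, f (p r) = p' r)
    (hgen : ∀ S : Subalgebra ℂ A, (∀ i, E i ∈ S) → (∀ r, y r ∈ S) → (∀ r, p r ∈ S) → S = ⊤) :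
    ∃ 𝒜 : ℤ → Submodule ℂ A, Nonempty (GradedAlgebra 𝒜) ∧ (∀ i, E i ∈ 𝒜 0) ∧
      (∀ r, y r ∈ 𝒜 2) ∧ ∀ r i, p r * E i ∈ 𝒜 (-(cartan l (i (lo r)) (i (hi r)))) := by
  obtain ⟨Δ, hE, hy, hp⟩ := hlift _ _ _ (h.isKLR_single h1)
  have hpE : ∀ r i, Δ (p r * E i) = single (psiDeg r i) (p r * E i) := fun r i => by
    rw [map_mul, hp, hE, h.psiGr_mul_single r 0 (h.idem i), add_zero]
  refine ⟨grading Δ, nonempty_gradedAlgebra (hgen _ ?_ ?_ ?_), hE, hy, hpE⟩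
  · exact fun i => mem_range_coeAlgHom_grading (hE i)
  · exact fun r => mem_range_coeAlgHom_grading (hy r)
  · intro r
    rw [← mul_one (p r), ← h.sum1, Finset.mul_sum]
    exact sum_mem fun i _ => mem_range_coeAlgHom_grading (hpE r i)

lemma bquot_subalgebra_eq_top {l n : ℕ} [NeZero l] {k : ℤ} {hn : 2 ≤ n}
    (S : Subalgebra ℂ (BQuot l n (Lam2 l k) (badSet2 l n k hn)))
    (hE : ∀ i, Eq' l n k hn i ∈ S) (hy : ∀ r, yq l n k hn r ∈ S)
    (hp : ∀ r, pq l n k hn r ∈ S) : S = ⊤ := by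
  have h1 : S.comap (bmk l n (Lam2 l k) (badSet2 l n k hn)) = ⊤ := by
    rw [eq_top_iff, ← FreeAlgebra.adjoin_range_ι, Algebra.adjoin_le_iff]
    rintro _ ⟨x, rfl⟩
    cases x with
    | e i => exact hE i
    | y r => exact hy r
    | psi r => exact hp r
  rw [eq_top_iff]
  intro x _
  obtain ⟨x, rfl⟩ := RingQuot.mkAlgHom_surjective ℂ _ x
  obtain ⟨x, rfl⟩ := RingQuot.mkAlgHom_surjective ℂ _ x
  exact (h1.ge (Algebra.mem_top : x ∈ ⊤) : _)

theorem exists_grading_bquot {l : ℕ} [NeZero l] (hl : 3 ≤ l) (k : ℤ) {n : ℕ} (hn : 2 ≤ n) :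
    ∃ 𝒜 : ℤ → Submodule ℂ (BQuot l n (Lam2 l k) (badSet2 l n k hn)),
      Nonempty (GradedAlgebra 𝒜) ∧ (∀ i, Eq' l n k hn i ∈ 𝒜 0) ∧ (∀ r, yq l n k hn r ∈ 𝒜 2) ∧
      ∀ r i, pq l n k hn r * Eq' l n k hn i ∈ 𝒜 (-(cartan l (i (lo r)) (i (hi r)))) := by
  have h1 : (1 : ZMod l) ≠ 0 := by
    rw [← Nat.cast_one, Ne, ZMod.natCast_eq_zero_iff, Nat.dvd_one]
    omega
  exact (isKLR_mk (l := l) (k := k) (hn := hn)).exists_grading h1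
    (fun _ _ _ h => h.exists_lift) bquot_subalgebra_eq_top

end

/-- Let `l ≥ 3` be odd, `q` a primitive `l`-th root of unity, `m ≢ 0, ±1 (mod l)`,
`2k ≡ m (mod l)` and `n ≥ 2`.  Then the blob algebra `b_n(m)` is isomorphic as a `ℂ`-algebra to
the quotient of the level-two cyclotomic KLR algebra by the two-sided ideal generated by the
idempotents `e(i)` with `(i₁, i₂) ≡ (k, k-1)` or `(-k, -k-1) (mod l)`; moreover this quotient
carries a `ℤ`-grading induced from the KLR grading (so `b_n(m)` becomes a `ℤ`-graded algebra). -/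
theorem statement0 (l : ℕ) [NeZero l] (hl : 3 ≤ l) (hodd : Odd l)
    (q : ℂ) (hq : IsPrimitiveRoot q l)
    (m k : ℤ) (hm0 : (m : ZMod l) ≠ 0) (hm1 : (m : ZMod l) ≠ 1) (hmm1 : (m : ZMod l) ≠ -1)
    (hk : ((2 * k : ℤ) : ZMod l) = (m : ZMod l))
    (n : ℕ) (hn : 2 ≤ n) :
    Nonempty (Blob q m n ≃ₐ[ℂ] BQuot l n (Lam2 l k) (badSet2 l n k hn)) ∧
    ∃ 𝒜 : ℤ → Submodule ℂ (BQuot l n (Lam2 l k) (badSet2 l n k hn)),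
      Nonempty (GradedAlgebra 𝒜) ∧
      (∀ i : Res l n, bmk l n (Lam2 l k) (badSet2 l n k hn) (eG l n i) ∈ 𝒜 0) ∧
      (∀ r : Fin n, bmk l n (Lam2 l k) (badSet2 l n k hn) (yG l n r) ∈ 𝒜 2) ∧
      (∀ (r : Fin (n - 1)) (i : Res l n),
        bmk l n (Lam2 l k) (badSet2 l n k hn) (pG l n r * eG l n i) ∈
          𝒜 (-(cartan l (i (lo r)) (i (hi r))))) := by
  refine ⟨nonempty_blob_algEquiv hl hodd hq hm0 hm1 hmm1 hk hn, ?_⟩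
  obtain ⟨𝒜, h𝒜, hE, hy, hp⟩ := exists_grading_bquot hl k hn
  exact ⟨𝒜, h𝒜, hE, hy, fun r i => by simpa only [Eq', pq, map_mul] using hp r i⟩

end Statement0
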